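/- Let $\gamma:\mathbb R\to\mathbb R$ be even or odd, smooth on $[-1,1]$, with $\gamma(0)=0$, $\gamma(1)=1$, strictly increasing on $[0,1]$, with $\gamma''>0$ on $(0,1]$, and extended beyond $1$ by $\gamma(t)=\gamma(1/t)^{-1}$ for $t\ge 1$. Assume (i) $\inf_{0<t\le1}|(\gamma'/\gamma'')'(t)|>0$; (ii) $\min_{j\in\{1,2\}}\inf_{0<t\le1}|t^j\gamma^{(j)}(t)/\gamma(t)|>0$; (iii) $\sup_{1\le j\le 10^3}\sup_{0<t\le1}|t^j\gamma^{(j)}(t)/\gamma(t)|<\infty$, where derivatives at $t=1$ are those of $\gamma|_{[-1,1]}$ (one-sided). Then there is $\varepsilon_1>0$, depending only on $\gamma$, such that the following holds for every $0<\varepsilon_0\le\varepsilon_1$. Let $\tilde\varphi:\mathbb R\to[0,\infty)$ be smooth, supported in $(-\varepsilon_0,\varepsilon_0)$ and equal to $1$ on $[-\varepsilon_0/2,\varepsilon_0/2]$. Let $\phi\in C_c^\infty(\mathbb R)$ be supported in $\{1/2\le|t|\le2\}$ with $\sum_{k\in\mathbb Z}\phi(2^{-k}t)=1$ for all $t\ne0$,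 and let $\tilde\phi_2\in C_c^\infty(\mathbb R\setminus\{0\})$ be equal to $1$ on $\{1/4\le|t|\le4\}$. Put $$P_k^2f=(\phi(2^{-k}\xi_2)\hat f(\xi))^\vee,\qquad \tilde P_k^2f=(\tilde\phi_2(2^{-k}\xi_2)\hat f(\xi))^\vee,$$ and, for $u:\mathbb R^2\to(0,\infty)$, $$H^\gamma f(x_1,x_2)=\mathrm{p.v.}\int_{\mathbb R}f(x_1-t,\,x_2-u(x_1,x_2)\gamma(t))\,\tilde\varphi(t)\,\frac{dt}{t}.$$ For every $1<p<\infty$ there is a constant $C$, depending only on $p$, $\gamma$ and the fixed cutoff functions $\tilde\varphi,\phi,\tilde\phi_2$, such that for every $u:\mathbb R^2\to(0,\infty)$ with $|u(x)-u(y)|\le\frac12|x-y|$ for all $x,y\in\mathbb R^2$ and every Schwartz function $f$ on $\mathbb R^2$, the terms $(\mathrm{Id}-\tilde P_k^2)H^\gamma P_k^2f$ are well defined (the principal values exist at every point, and $H^\gamma P_k^2 f$ and $\tilde\phi_2(2^{-k}\xi_2)\,\widehat{H^\gamma P_k^2f}(\xi)$ are integrable), the series $\sum_{k\in\mathbb Z}(\mathrm{Id}-\tilde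 P_k^2)H^\gamma P_k^2f$ converges absolutely almost everywhere to a function in $L^p(\mathbb R^2)$, and $$\Big\|\sum_{k\in\mathbb Z}(\mathrm{Id}-\tilde P_k^2)H^\gamma P_k^2f\Big\|_{L^p(\mathbb R^2)}\le C\,\|f\|_{L^p(\mathbb R^2)} .$$ -/

import Mathlib

open MeasureTheory Set Filter Topology
open scoped ContDiff ENNReal NNReal SchwartzMap FourierTransform

/-- The Euclidean plane; the two coordinates of `x` are `x 0` and `x 1`. -/
abbrev Plane : Type := EuclideanSpace ℝ (Fin 2)

/-- The standing assumptions on the curve `γ`. Derivatives on `(0, 1]` are those of the restriction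
of `γ` to `[-1, 1]`, hence one-sided at `t = 1`: the extension of `γ` beyond `1` prescribed by
`extend` is in general not twice differentiable at `1`. -/
structure IsAdmissibleCurve (γ : ℝ → ℝ) : Prop where
  zero : γ 0 = 0
  one : γ 1 = 1
  smooth : ContDiffOn ℝ ∞ γ (Icc (-1) 1)
  parity : (∀ t, γ (-t) = γ t) ∨ (∀ t, γ (-t) = -γ t)
  strictMono : StrictMonoOn γ (Icc 0 1)
  quotient_deriv : ∃ c > 0, ∀ t ∈ Ioc (0 : ℝ) 1,
    c ≤ |derivWithin (fun s => derivWithin γ (Icc (-1) 1) s /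
      iteratedDerivWithin 2 γ (Icc (-1) 1) s) (Icc (-1) 1) t|
  lower : ∃ c > 0, ∀ j ∈ ({1, 2} : Set ℕ), ∀ t ∈ Ioc (0 : ℝ) 1,
    c ≤ |t ^ j * iteratedDerivWithin j γ (Icc (-1) 1) t / γ t|
  upper : ∃ C : ℝ, ∀ j : ℕ, 1 ≤ j → j ≤ 1000 → ∀ t ∈ Ioc (0 : ℝ) 1,
    |t ^ j * iteratedDerivWithin j γ (Icc (-1) 1) t / γ t| ≤ C
  convex : ∀ t ∈ Ioc (0 : ℝ) 1, 0 < iteratedDerivWithin 2 γ (Icc (-1) 1) t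
  extend : ∀ t : ℝ, 1 ≤ t → γ t = (γ t⁻¹)⁻¹

/-- `χ(2^{-k} ξ₂) f̂(ξ)`: the Fourier transform of `f`, localized in the second frequency variable
by the cutoff `χ` at scale `2^k`. -/
noncomputable def freqCut (χ : ℝ → ℂ) (k : ℤ) (f : Plane → ℂ) (ξ : Plane) : ℂ :=
  χ ((2 : ℝ) ^ (-k) * ξ 1) * 𝓕 f ξ

/-- The frequency projection in the second variable, `(χ(2^{-k} ξ₂) f̂(ξ))^∨`. -/
noncomputable def proj₂ (χ : ℝ → ℂ) (k : ℤ) (f : Plane → ℂ) : Plane → ℂ :=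
  𝓕⁻ (freqCut χ k f)

/-- The part `|t| > η` of the integral
`∫ g(x₁ - t, x₂ - u(x) γ(t)) φt(t) dt / t`. -/
noncomputable def truncHilbert (γ φt : ℝ → ℝ) (u : Plane → ℝ) (g : Plane → ℂ) (x : Plane)
    (η : ℝ) : ℂ :=
  ∫ t in {t : ℝ | η < |t|}, g !₂[x 0 - t, x 1 - u x * γ t] * ((φt t / t : ℝ) : ℂ)

/-- The smoothly truncated Hilbert transform along `(t, u(x) γ(t))`: the principal value
`p.v. ∫ g(x₁ - t, x₂ - u(x) γ(t)) φt(t) dt / t`. -/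
noncomputable def hilbertAlong (γ φt : ℝ → ℝ) (u : Plane → ℝ) (g : Plane → ℂ) (x : Plane) : ℂ :=
  limUnder (𝓝[>] (0 : ℝ)) (truncHilbert γ φt u g x)

/-- The `k`-th off-diagonal term `(Id - P̃²ₖ) H^γ P²ₖ f`, where `P²ₖ` and `P̃²ₖ` have the cutoffs
`φ` and `ψ`. -/
noncomputable def offDiagTerm (γ φt : ℝ → ℝ) (φ ψ : ℝ → ℂ) (u : Plane → ℝ) (f : Plane → ℂ)
    (k : ℤ) (x : Plane) : ℂ :=
  hilbertAlong γ φt u (proj₂ φ k f) x - proj₂ ψ k (hilbertAlong γ φt u (proj₂ φ k f)) x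

/-- Bounded measurable integrable functions on the line. -/
structure IsTame (f : ℝ → ℂ) : Prop where
  meas : Measurable f
  integrable : Integrable f
  bdd : ∃ M : ℝ, ∀ x, ‖f x‖ ≤ M

/-- The integral operator with kernel `M`. -/
noncomputable def kernelOp (M : ℝ → ℝ → ℂ) (f : ℝ → ℂ) (y : ℝ) : ℂ := ∫ x, M y x * f x

/-- Measurable kernels with uniformly integrable rows and columns. -/
structure IsSchurKernel (A : ℝ≥0) (M : ℝ → ℝ → ℂ) : Prop where
  meas : Measurable (Function.uncurry M)
  row : ∀ y, ∫⁻ x, ‖M y x‖ₑ ≤ A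
  col : ∀ x, ∫⁻ y, ‖M y x‖ₑ ≤ A

/-- Schur kernels living at the scale `2 ^ (-k)` near the diagonal and Hölder continuous
(in the mean) in the input variable. -/
structure IsScaleKernel (A : ℝ≥0) (k : ℤ) (M : ℝ → ℝ → ℂ) : Prop extends IsSchurKernel A M where
  moment : ∀ y, ∫⁻ x, ‖M y x‖ₑ * ENNReal.ofReal √((2 : ℝ) ^ k * |x - y|) ≤ A
  holder : ∀ x x', ∫⁻ y, ‖M y x - M y x'‖ₑ ≤ A * ENNReal.ofReal √((2 : ℝ) ^ k * |x - x'|)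

namespace IsTame

variable {f g : ℝ → ℂ}

lemma exists_bound_nonneg (hf : IsTame f) : ∃ M : ℝ≥0, ∀ x, ‖f x‖ₑ ≤ M := by
  obtain ⟨M, hM⟩ := hf.bdd
  refine ⟨M.toNNReal, fun x => ?_⟩
  rw [← ofReal_norm]
  exact ENNReal.ofReal_le_ofReal (hM x)

lemma of_enorm_le (hm : Measurable f) (h1 : ∫⁻ x, ‖f x‖ₑ < ⊤) {M : ℝ≥0} (hM : ∀ x, ‖f x‖ₑ ≤ M) :
    IsTame f :=
  ⟨hm, ⟨hm.aestronglyMeasurable, h1⟩, M, fun x => by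
    have := hM x
    rw [enorm_le_coe] at this
    exact_mod_cast this⟩

lemma lintegral_lt_top (hf : IsTame f) : ∫⁻ x, ‖f x‖ₑ < ⊤ := hf.integrable.2

lemma add (hf : IsTame f) (hg : IsTame g) : IsTame (fun x => f x + g x) := by
  obtain ⟨M, hM⟩ := hf.bdd
  obtain ⟨N, hN⟩ := hg.bdd
  exact ⟨hf.meas.add hg.meas, hf.integrable.add hg.integrable, M + N, fun x =>
    (norm_add_le _ _).trans (add_le_add (hM x) (hN x))⟩

lemma conj (hf : IsTame f) : IsTame (fun x => (starRingEnd ℂ) (f x)) := by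
  obtain ⟨M, hM⟩ := hf.bdd
  refine ⟨by have := hf.meas; fun_prop, ?_, M, fun x => by simpa using hM x⟩
  exact (Complex.conjCLE.toContinuousLinearMap.integrable_comp hf.integrable)

lemma mul_bdd (hf : IsTame f) (hg : Measurable g) {N : ℝ} (hN : ∀ x, ‖g x‖ ≤ N) :
    IsTame (fun x => f x * g x) := by
  obtain ⟨M, hM⟩ := hf.bdd
  refine ⟨hf.meas.mul hg, ?_, M * N, fun x => ?_⟩
  · exact hf.integrable.mul_bdd hg.aestronglyMeasurable (ae_of_all _ hN)
  · rw [norm_mul]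
    exact mul_le_mul (hM x) (hN x) (norm_nonneg _) ((norm_nonneg _).trans (hM x))

lemma mul (hf : IsTame f) (hg : IsTame g) : IsTame (fun x => f x * g x) := by
  obtain ⟨N, hN⟩ := hg.bdd
  exact hf.mul_bdd hg.meas hN

lemma zero : IsTame (fun _ => 0) := ⟨measurable_const, integrable_zero _ _ _, 0, by simp⟩

lemma sum {ι : Type*} (s : Finset ι) {F : ι → ℝ → ℂ} (h : ∀ i ∈ s, IsTame (F i)) :
    IsTame (fun x => ∑ i ∈ s, F i x) := by
  classical
  induction s using Finset.induction_on with
  | empty => simpa using zero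
  | insert i s hi ih =>
    simp only [Finset.sum_insert hi]
    exact (h i (by simp)).add (ih fun j hj => h j (by simp [hj]))

lemma integrable_sq (hf : IsTame f) : Integrable (fun x => ‖f x‖ ^ 2) := by
  have := (hf.mul hf).integrable.norm
  simpa [pow_two] using this

lemma lintegral_sq (hf : IsTame f) :
    ∫⁻ x, ‖f x‖ₑ ^ 2 = ENNReal.ofReal (∫ x, ‖f x‖ ^ 2) := by
  rw [ofReal_integral_eq_lintegral_ofReal hf.integrable_sq (ae_of_all _ fun x => by positivity)]
  refine lintegral_congr fun x => ?_
  rw [ENNReal.ofReal_pow (norm_nonneg _), ofReal_norm]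

end IsTame

namespace IsSchurKernel

variable {A : ℝ≥0} {M : ℝ → ℝ → ℂ} {f g : ℝ → ℂ}

lemma flip (h : IsSchurKernel A M) : IsSchurKernel A (fun x y => M y x) :=
  ⟨h.meas.comp measurable_swap, h.col, h.row⟩

lemma meas_row (h : IsSchurKernel A M) (y : ℝ) : Measurable (M y) :=
  h.meas.comp measurable_prodMk_left

lemma meas_col (h : IsSchurKernel A M) (x : ℝ) : Measurable (fun y => M y x) :=
  h.meas.comp measurable_prodMk_right

lemma integrable_row (h : IsSchurKernel A M) (y : ℝ) : Integrable (M y) :=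
  ⟨(h.meas_row y).aestronglyMeasurable, (h.row y).trans_lt ENNReal.coe_lt_top⟩

lemma integrable_row_mul (h : IsSchurKernel A M) (y : ℝ) (hf : Measurable f) {N : ℝ}
    (hN : ∀ x, ‖f x‖ ≤ N) : Integrable (fun x => M y x * f x) :=
  (h.integrable_row y).mul_bdd hf.aestronglyMeasurable (ae_of_all _ hN)

lemma measurable_kernelOp (hM : Measurable (Function.uncurry M)) (hf : Measurable f) :
    Measurable (kernelOp M f) := by
  have h : Measurable (Function.uncurry fun y x => M y x * f x) := by
    simp only [Function.uncurry_def]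
    exact hM.mul (hf.comp measurable_snd)
  exact h.stronglyMeasurable.integral_prod_right.measurable

lemma enorm_kernelOp_le (y : ℝ) : ‖kernelOp M f y‖ₑ ≤ ∫⁻ x, ‖M y x‖ₑ * ‖f x‖ₑ := by
  refine (enorm_integral_le_lintegral_enorm _).trans (le_of_eq ?_)
  simp [enorm_mul]

lemma lintegral_kernel_mul_le (h : IsSchurKernel A M) {F : ℝ → ℝ≥0∞} (hF : Measurable F) :
    ∫⁻ y, ∫⁻ x, ‖M y x‖ₑ * F x ≤ A * ∫⁻ x, F x := by
  have hm : Measurable (Function.uncurry fun y x => ‖M y x‖ₑ * F x) := by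
    simp only [Function.uncurry_def]
    exact h.meas.enorm.mul (hF.comp measurable_snd)
  rw [lintegral_lintegral_swap hm.aemeasurable, ← lintegral_const_mul _ hF]
  refine lintegral_mono fun x => ?_
  rw [lintegral_mul_const _ (h.meas_col x).enorm]
  gcongr
  exact h.col x

lemma kernelOp_tame (h : IsSchurKernel A M) (hf : IsTame f) : IsTame (kernelOp M f) := by
  obtain ⟨N, hN⟩ := hf.exists_bound_nonneg
  refine IsTame.of_enorm_le (M := A * N) (measurable_kernelOp h.meas hf.meas) ?_ fun y => ?_
  · calc ∫⁻ y, ‖kernelOp M f y‖ₑ ≤ ∫⁻ y, ∫⁻ x, ‖M y x‖ₑ * ‖f x‖ₑ :=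
          lintegral_mono fun y => enorm_kernelOp_le y
      _ ≤ A * ∫⁻ x, ‖f x‖ₑ := h.lintegral_kernel_mul_le hf.meas.enorm
      _ < ⊤ := ENNReal.mul_lt_top ENNReal.coe_lt_top hf.lintegral_lt_top
  · calc ‖kernelOp M f y‖ₑ ≤ ∫⁻ x, ‖M y x‖ₑ * ‖f x‖ₑ := enorm_kernelOp_le y
      _ ≤ ∫⁻ x, ‖M y x‖ₑ * N := lintegral_mono fun x => by gcongr; exact hN x
      _ = (∫⁻ x, ‖M y x‖ₑ) * N := lintegral_mul_const _ (h.meas_row y).enorm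
      _ ≤ _ := by push_cast; gcongr; exact h.row y

lemma integrable_prod (h : IsSchurKernel A M) (hf : IsTame f) (hg : Measurable g) {N : ℝ}
    (hN : ∀ x, ‖g x‖ ≤ N) :
    Integrable (Function.uncurry fun y x => M y x * f x * g y) (volume.prod volume) := by
  have hm : Measurable (Function.uncurry fun y x => M y x * f x) := by
    simp only [Function.uncurry_def]
    exact h.meas.mul (hf.meas.comp measurable_snd)
  have h1 : Integrable (Function.uncurry fun y x => M y x * f x) (volume.prod volume) := by
    refine ⟨hm.aestronglyMeasurable, ?_⟩
    rw [HasFiniteIntegral, lintegral_prod _ hm.enorm.aemeasurable]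
    simp only [Function.uncurry, enorm_mul]
    exact (h.lintegral_kernel_mul_le hf.meas.enorm).trans_lt
      (ENNReal.mul_lt_top ENNReal.coe_lt_top hf.lintegral_lt_top)
  exact h1.mul_bdd (hg.comp measurable_fst).aestronglyMeasurable (ae_of_all _ fun x => hN _)

lemma kernelOp_dual (h : IsSchurKernel A M) (hf : IsTame f) (hg : IsTame g) :
    ∫ y, kernelOp M f y * g y = ∫ x, f x * kernelOp (fun x y => M y x) g x := by
  obtain ⟨N, hN⟩ := hg.bdd
  calc ∫ y, kernelOp M f y * g y = ∫ y, ∫ x, M y x * f x * g y := by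
        simp only [kernelOp, integral_mul_const]
    _ = ∫ x, ∫ y, M y x * f x * g y := integral_integral_swap (h.integrable_prod hf hg.meas hN)
    _ = ∫ x, f x * kernelOp (fun x y => M y x) g x := by
        simp only [kernelOp, ← integral_const_mul]
        congr! 4
        ring

end IsSchurKernel

lemma enorm_mul_le_weighted (a b : ℂ) {c : ℝ} (hc : 0 < c) :
    ‖a‖ₑ * ‖b‖ₑ ≤ ENNReal.ofReal c * ‖a‖ₑ ^ 2 + ENNReal.ofReal c⁻¹ * ‖b‖ₑ ^ 2 := by
  simp only [← ofReal_norm]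
  rw [← ENNReal.ofReal_mul (by positivity), ← ENNReal.ofReal_pow (by positivity),
    ← ENNReal.ofReal_pow (by positivity), ← ENNReal.ofReal_mul (by positivity),
    ← ENNReal.ofReal_mul (by positivity), ← ENNReal.ofReal_add (by positivity) (by positivity)]
  refine ENNReal.ofReal_le_ofReal ?_
  have h := sq_nonneg (c * ‖a‖ - ‖b‖)
  have h2 : 0 ≤ ‖a‖ * ‖b‖ := by positivity
  have h3 : c * (‖a‖ * ‖b‖) ≤ c * (c * ‖a‖ ^ 2 + c⁻¹ * ‖b‖ ^ 2) := by
    have : c * (c * ‖a‖ ^ 2 + c⁻¹ * ‖b‖ ^ 2) = (c * ‖a‖) ^ 2 + ‖b‖ ^ 2 := by field_simp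
    rw [this]; nlinarith
  exact le_of_mul_le_mul_left h3 hc

namespace IsScaleKernel

variable {A : ℝ≥0} {j k : ℤ} {R S : ℝ → ℝ → ℂ} {G H : ℝ → ℂ}

lemma kernelOp_eq_of_cancel (hR : IsScaleKernel A j R) {m : ℝ → ℂ} (hm : Measurable m)
    (hm2 : ∀ x, ‖m x‖ ≤ 2) {V : ℝ → ℂ} (hV : IsTame V) (h0 : ∀ y, ∫ x, R y x * m x = 0) (y : ℝ) :
    kernelOp R (fun x => m x * V x) y = ∫ x, R y x * m x * (V x - V y) := by
  obtain ⟨N, hN⟩ := hV.bdd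
  have h1 := hR.integrable_row_mul y hm hm2
  have h2 : Integrable (fun x => R y x * m x * V x) :=
    h1.mul_bdd hV.meas.aestronglyMeasurable (ae_of_all _ hN)
  simp only [mul_sub]
  rw [integral_sub h2 (h1.mul_const _), integral_mul_const, h0 y, zero_mul, sub_zero]
  simp only [kernelOp, mul_assoc]

lemma enorm_kernelOp_flip_sub_le (hS : IsScaleKernel A k S) (hH : IsTame H) (x y : ℝ) :
    ‖kernelOp (fun x y => S y x) H x - kernelOp (fun x y => S y x) H y‖ₑ ≤
      ∫⁻ z, ‖S z x - S z y‖ₑ * ‖H z‖ₑ := by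
  obtain ⟨N, hN⟩ := hH.bdd
  simp only [kernelOp]
  rw [← integral_sub (hS.toIsSchurKernel.flip.integrable_row_mul x hH.meas hN)
    (hS.toIsSchurKernel.flip.integrable_row_mul y hH.meas hN)]
  refine (enorm_integral_le_lintegral_enorm _).trans (le_of_eq ?_)
  simp only [← sub_mul, enorm_mul]

lemma lintegral_pair_le (hkj : k ≤ j) (hR : IsScaleKernel A j R) (hS : IsScaleKernel A k S)
    {m : ℝ → ℂ} (hm : Measurable m) (hm2 : ∀ x, ‖m x‖ ≤ 2) (h0 : ∀ y, ∫ x, R y x * m x = 0)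
    (hG : IsTame G) (hH : IsTame H) :
    ∫⁻ y, ‖G y‖ₑ * ‖kernelOp R
        (fun x => m x * (starRingEnd ℂ) (kernelOp (fun x y => S y x) H x)) y‖ₑ ≤
      ENNReal.ofReal (4 * A ^ 2 * ((2 : ℝ) ^ (-(1 / 4) : ℝ)) ^ (j - k).natAbs) *
        ((∫⁻ y, ‖G y‖ₑ ^ 2) + ∫⁻ y, ‖H y‖ₑ ^ 2) := by
  set c : ℝ := ((2 : ℝ) ^ (1 / 4 : ℝ)) ^ (j - k).natAbs with hc
  have hcpos : 0 < c := by positivity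
  have hcinv : c⁻¹ = ((2 : ℝ) ^ (-(1 / 4) : ℝ)) ^ (j - k).natAbs := by
    rw [hc, Real.rpow_neg (by norm_num), inv_pow]
  rw [← hcinv]
  set F : ℝ → ℝ≥0∞ := fun x => ∫⁻ z, ‖S z x‖ₑ * ‖H z‖ₑ ^ 2 with hF
  have hFm : Measurable F := by
    have : Measurable (Function.uncurry fun x z => ‖S z x‖ₑ * ‖H z‖ₑ ^ 2) := by
      simp only [Function.uncurry_def]
      exact (hS.meas.comp measurable_swap).enorm.mul
        ((hH.meas.comp measurable_snd).enorm.pow_const 2)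
    exact this.lintegral_prod_right'
  have hFint : ∫⁻ x, F x ≤ A * ∫⁻ y, ‖H y‖ₑ ^ 2 :=
    hS.toIsSchurKernel.flip.lintegral_kernel_mul_le (hH.meas.enorm.pow_const 2)
  have hscale : ∀ x y : ℝ, √((2 : ℝ) ^ k * |x - y|) = c⁻¹ ^ 2 * √((2 : ℝ) ^ j * |x - y|) := by
    intro x y
    have e1 : (2 : ℝ) ^ k = (c⁻¹ ^ 2) ^ 2 * (2 : ℝ) ^ j := by
      have : ((c⁻¹) ^ 2) ^ 2 = (2 : ℝ) ^ (k - j) := by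
        rw [hcinv, ← pow_mul, ← pow_mul, ← Real.rpow_natCast, ← Real.rpow_mul (by norm_num),
          ← Real.rpow_intCast]
        congr 1
        have : ((j - k).natAbs : ℝ) = j - k := by
          have h := Int.natAbs_of_nonneg (sub_nonneg.2 hkj)
          have h' : (((j - k).natAbs : ℤ) : ℝ) = ((j - k : ℤ) : ℝ) := by rw [h]
          push_cast at h'
          simpa using h'
        push_cast
        rw [this]
        ring
      rw [this, ← zpow_add₀ (by norm_num)]
      congr 1; ring
    rw [e1, mul_assoc, Real.sqrt_mul (by positivity), Real.sqrt_sq (by positivity)]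
  have key : ∀ y x, ‖G y‖ₑ * ∫⁻ z, ‖S z x - S z y‖ₑ * ‖H z‖ₑ ≤
      ENNReal.ofReal c⁻¹ * (‖G y‖ₑ ^ 2 * A * ENNReal.ofReal √((2 : ℝ) ^ j * |x - y|) +
        (F x + F y)) := by
    intro y x
    have hSd : Measurable fun z => ‖S z x - S z y‖ₑ :=
      ((hS.meas_col x).sub (hS.meas_col y)).enorm
    calc ‖G y‖ₑ * ∫⁻ z, ‖S z x - S z y‖ₑ * ‖H z‖ₑ
        = ∫⁻ z, ‖S z x - S z y‖ₑ * (‖G y‖ₑ * ‖H z‖ₑ) := by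
          rw [← lintegral_const_mul' _ _ (by simp)]
          exact lintegral_congr fun z => by ring
      _ ≤ ∫⁻ z, (‖S z x - S z y‖ₑ * (ENNReal.ofReal c * ‖G y‖ₑ ^ 2) +
            ENNReal.ofReal c⁻¹ * (‖S z x‖ₑ * ‖H z‖ₑ ^ 2 + ‖S z y‖ₑ * ‖H z‖ₑ ^ 2)) := by
          refine lintegral_mono fun z => ?_
          calc ‖S z x - S z y‖ₑ * (‖G y‖ₑ * ‖H z‖ₑ)
              ≤ ‖S z x - S z y‖ₑ * (ENNReal.ofReal c * ‖G y‖ₑ ^ 2 +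
                ENNReal.ofReal c⁻¹ * ‖H z‖ₑ ^ 2) := by
                gcongr; exact enorm_mul_le_weighted _ _ hcpos
            _ ≤ ‖S z x - S z y‖ₑ * (ENNReal.ofReal c * ‖G y‖ₑ ^ 2) +
                (‖S z x‖ₑ + ‖S z y‖ₑ) * (ENNReal.ofReal c⁻¹ * ‖H z‖ₑ ^ 2) := by
                rw [mul_add]; gcongr; exact enorm_sub_le
            _ = _ := by ring
      _ = (∫⁻ z, ‖S z x - S z y‖ₑ) * (ENNReal.ofReal c * ‖G y‖ₑ ^ 2) +
            ENNReal.ofReal c⁻¹ * (F x + F y) := by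
          have m1 : Measurable fun z => ‖S z x‖ₑ * ‖H z‖ₑ ^ 2 :=
            (hS.meas_col x).enorm.mul (hH.meas.enorm.pow_const 2)
          have m2 : Measurable fun z => ‖S z y‖ₑ * ‖H z‖ₑ ^ 2 :=
            (hS.meas_col y).enorm.mul (hH.meas.enorm.pow_const 2)
          rw [lintegral_add_left (hSd.mul_const _), lintegral_mul_const _ hSd,
            lintegral_const_mul' _ _ (by simp), lintegral_add_left m1]
      _ ≤ (A * ENNReal.ofReal (c⁻¹ ^ 2 * √((2 : ℝ) ^ j * |x - y|))) *
            (ENNReal.ofReal c * ‖G y‖ₑ ^ 2) + ENNReal.ofReal c⁻¹ * (F x + F y) := by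
          rw [← hscale]; gcongr; exact hS.holder x y
      _ = _ := by
          have : ENNReal.ofReal (c⁻¹ ^ 2 * √((2 : ℝ) ^ j * |x - y|)) * ENNReal.ofReal c =
              ENNReal.ofReal c⁻¹ * ENNReal.ofReal √((2 : ℝ) ^ j * |x - y|) := by
            rw [← ENNReal.ofReal_mul (by positivity), ← ENNReal.ofReal_mul (by positivity)]
            congr 1; field_simp
          rw [show (A * ENNReal.ofReal (c⁻¹ ^ 2 * √((2 : ℝ) ^ j * |x - y|))) *
            (ENNReal.ofReal c * ‖G y‖ₑ ^ 2) =
            (ENNReal.ofReal (c⁻¹ ^ 2 * √((2 : ℝ) ^ j * |x - y|)) * ENNReal.ofReal c) *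
            (A * ‖G y‖ₑ ^ 2) by ring, this]
          ring
  set U := kernelOp (fun x y => S y x) H with hU
  have hUt : IsTame U := hS.toIsSchurKernel.flip.kernelOp_tame hH
  have point : ∀ y, ‖G y‖ₑ * ‖kernelOp R (fun x => m x * (starRingEnd ℂ) (U x)) y‖ₑ ≤
      ENNReal.ofReal (2 * c⁻¹) * ((‖G y‖ₑ ^ 2 * A * A + A * F y) + ∫⁻ x, ‖R y x‖ₑ * F x) := by
    intro y
    rw [hR.kernelOp_eq_of_cancel hm hm2 hUt.conj h0 y]
    have hRF : Measurable fun x => ‖R y x‖ₑ * F x := (hR.meas_row y).enorm.mul hFm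
    have hRm : Measurable fun x => ‖R y x‖ₑ * ENNReal.ofReal √((2 : ℝ) ^ j * |x - y|) :=
      (hR.meas_row y).enorm.mul (by fun_prop)
    calc ‖G y‖ₑ * ‖∫ x, R y x * m x * ((starRingEnd ℂ) (U x) - (starRingEnd ℂ) (U y))‖ₑ
        ≤ ‖G y‖ₑ * ∫⁻ x, ‖R y x‖ₑ * 2 * ∫⁻ z, ‖S z x - S z y‖ₑ * ‖H z‖ₑ := by
          gcongr
          refine (enorm_integral_le_lintegral_enorm _).trans (lintegral_mono fun x => ?_)
          rw [enorm_mul, enorm_mul]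
          have h2 : ‖m x‖ₑ ≤ 2 := by
            rw [← ofReal_norm]
            exact (ENNReal.ofReal_le_ofReal (hm2 x)).trans (by simp)
          have h3 : ‖(starRingEnd ℂ) (U x) - (starRingEnd ℂ) (U y)‖ₑ = ‖U x - U y‖ₑ := by
            rw [← map_sub, ← ofReal_norm, ← ofReal_norm, RCLike.norm_conj]
          rw [h3]
          gcongr
          exact hS.enorm_kernelOp_flip_sub_le hH x y
      _ ≤ ∫⁻ x, ENNReal.ofReal (2 * c⁻¹) * (‖G y‖ₑ ^ 2 * A *
            (‖R y x‖ₑ * ENNReal.ofReal √((2 : ℝ) ^ j * |x - y|)) +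
            (‖R y x‖ₑ * F x + ‖R y x‖ₑ * F y)) := by
          rw [← lintegral_const_mul' _ _ (by simp)]
          refine lintegral_mono fun x => ?_
          calc ‖G y‖ₑ * (‖R y x‖ₑ * 2 * ∫⁻ z, ‖S z x - S z y‖ₑ * ‖H z‖ₑ)
              = (‖R y x‖ₑ * 2) * (‖G y‖ₑ * ∫⁻ z, ‖S z x - S z y‖ₑ * ‖H z‖ₑ) := by ring
            _ ≤ (‖R y x‖ₑ * 2) * (ENNReal.ofReal c⁻¹ * (‖G y‖ₑ ^ 2 * A *
                ENNReal.ofReal √((2 : ℝ) ^ j * |x - y|) + (F x + F y))) :=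
              mul_le_mul' le_rfl (key y x)
            _ = _ := by
              rw [ENNReal.ofReal_mul (by norm_num), ENNReal.ofReal_ofNat]; ring
      _ = ENNReal.ofReal (2 * c⁻¹) * (‖G y‖ₑ ^ 2 * A *
            (∫⁻ x, ‖R y x‖ₑ * ENNReal.ofReal √((2 : ℝ) ^ j * |x - y|)) +
            ((∫⁻ x, ‖R y x‖ₑ * F x) + (∫⁻ x, ‖R y x‖ₑ) * F y)) := by
          rw [lintegral_const_mul' _ _ ENNReal.ofReal_ne_top, lintegral_add_left (hRm.const_mul _),
            lintegral_const_mul _ hRm, lintegral_add_left hRF,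
            lintegral_mul_const _ (hR.meas_row y).enorm]
      _ ≤ ENNReal.ofReal (2 * c⁻¹) * (‖G y‖ₑ ^ 2 * A * A +
            ((∫⁻ x, ‖R y x‖ₑ * F x) + A * F y)) := by
          gcongr
          · exact hR.moment y
          · exact hR.row y
      _ = _ := by ring
  have hG2 : Measurable fun y => ‖G y‖ₑ ^ 2 := hG.meas.enorm.pow_const 2
  calc ∫⁻ y, ‖G y‖ₑ * ‖kernelOp R (fun x => m x * (starRingEnd ℂ) (U x)) y‖ₑ
      ≤ ∫⁻ y, ENNReal.ofReal (2 * c⁻¹) *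
        ((‖G y‖ₑ ^ 2 * A * A + A * F y) + ∫⁻ x, ‖R y x‖ₑ * F x) := lintegral_mono point
    _ = ENNReal.ofReal (2 * c⁻¹) * (((∫⁻ y, ‖G y‖ₑ ^ 2) * A * A + A * ∫⁻ y, F y) +
          ∫⁻ y, ∫⁻ x, ‖R y x‖ₑ * F x) := by
        rw [lintegral_const_mul' _ _ ENNReal.ofReal_ne_top, lintegral_add_left (by fun_prop),
          lintegral_add_left (by fun_prop), lintegral_mul_const _ (hG2.mul_const _),
          lintegral_mul_const _ hG2, lintegral_const_mul _ hFm]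
    _ ≤ ENNReal.ofReal (2 * c⁻¹) * (((∫⁻ y, ‖G y‖ₑ ^ 2) * A * A +
          A * (A * ∫⁻ y, ‖H y‖ₑ ^ 2)) + A * (A * ∫⁻ y, ‖H y‖ₑ ^ 2)) := by
        gcongr
        exact (hR.lintegral_kernel_mul_le hFm).trans (by gcongr)
    _ ≤ ENNReal.ofReal (2 * c⁻¹) * (2 * A ^ 2 * ((∫⁻ y, ‖G y‖ₑ ^ 2) + ∫⁻ y, ‖H y‖ₑ ^ 2)) := by
        gcongr
        calc ((∫⁻ y, ‖G y‖ₑ ^ 2) * A * A +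
          A * (A * ∫⁻ y, ‖H y‖ₑ ^ 2)) + A * (A * ∫⁻ y, ‖H y‖ₑ ^ 2)
            = A ^ 2 * (∫⁻ y, ‖G y‖ₑ ^ 2) + 2 * A ^ 2 * ∫⁻ y, ‖H y‖ₑ ^ 2 := by ring
          _ ≤ 2 * A ^ 2 * (∫⁻ y, ‖G y‖ₑ ^ 2) + 2 * A ^ 2 * ∫⁻ y, ‖H y‖ₑ ^ 2 := by
            gcongr
            exact le_mul_of_one_le_left' (by norm_num)
          _ = _ := by ring
    _ = _ := by
        rw [← mul_assoc]
        congr 1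
        rw [show (4 * (A : ℝ) ^ 2 * c⁻¹) = (2 * c⁻¹) * (2 * A ^ 2) by ring,
          ENNReal.ofReal_mul (p := 2 * c⁻¹) (by positivity)]
        congr 1
        rw [ENNReal.ofReal_mul (by norm_num), ENNReal.ofReal_pow (by positivity)]
        simp

end IsScaleKernel

/-- The sum of the two-sided geometric series with ratio `2 ^ (-1/4)`. -/
noncomputable def geomConst : ℝ := ∑' d : ℤ, ((2 : ℝ) ^ (-(1 / 4) : ℝ)) ^ d.natAbs

lemma summable_pow_natAbs {r : ℝ} (h0 : 0 ≤ r) (h1 : r < 1) :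
    Summable fun d : ℤ => r ^ d.natAbs := by
  apply Summable.of_nat_of_neg <;> simpa using summable_geometric_of_lt_one h0 h1

lemma geomRatio_lt_one : (2 : ℝ) ^ (-(1 / 4) : ℝ) < 1 :=
  Real.rpow_lt_one_of_one_lt_of_neg (by norm_num) (by norm_num)

lemma geomConst_pos : 0 < geomConst := by
  have h := (summable_pow_natAbs (by positivity) geomRatio_lt_one).le_tsum 0
    (fun j _ => by positivity)
  exact lt_of_lt_of_le (by simp) h

lemma sum_pow_natAbs_le (F : Finset ℤ) (k : ℤ) :
    ∑ j ∈ F, ((2 : ℝ) ^ (-(1 / 4) : ℝ)) ^ (j - k).natAbs ≤ geomConst := by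
  have hs := summable_pow_natAbs (r := (2 : ℝ) ^ (-(1 / 4) : ℝ)) (by positivity) geomRatio_lt_one
  have hs' : Summable fun j : ℤ => ((2 : ℝ) ^ (-(1 / 4) : ℝ)) ^ (j - k).natAbs :=
    hs.comp_injective (i := fun j : ℤ => j - k) fun _ _ h => by simpa using h
  refine (hs'.sum_le_tsum F (fun j _ => by positivity)).trans (le_of_eq ?_)
  exact Equiv.tsum_eq (Equiv.subRight k) (fun d : ℤ => ((2 : ℝ) ^ (-(1 / 4) : ℝ)) ^ d.natAbs)

lemma double_sum_pow_natAbs_le (F : Finset ℤ) {n : ℤ → ℝ} (hn : ∀ k, 0 ≤ n k) :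
    ∑ j ∈ F, ∑ k ∈ F, ((2 : ℝ) ^ (-(1 / 4) : ℝ)) ^ (j - k).natAbs * (n j + n k) ≤
      2 * geomConst * ∑ k ∈ F, n k := by
  simp only [mul_add, Finset.sum_add_distrib]
  have h1 : ∑ j ∈ F, ∑ k ∈ F, ((2 : ℝ) ^ (-(1 / 4) : ℝ)) ^ (j - k).natAbs * n k ≤
      geomConst * ∑ k ∈ F, n k := by
    rw [Finset.sum_comm, Finset.mul_sum]
    refine Finset.sum_le_sum fun k _ => ?_
    rw [← Finset.sum_mul]
    exact mul_le_mul_of_nonneg_right (sum_pow_natAbs_le F k) (hn k)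
  have h2 : ∑ j ∈ F, ∑ k ∈ F, ((2 : ℝ) ^ (-(1 / 4) : ℝ)) ^ (j - k).natAbs * n j ≤
      geomConst * ∑ k ∈ F, n k := by
    rw [Finset.mul_sum]
    refine Finset.sum_le_sum fun j _ => ?_
    rw [← Finset.sum_mul]
    refine mul_le_mul_of_nonneg_right ?_ (hn j)
    refine le_trans (le_of_eq (Finset.sum_congr rfl fun k _ => ?_)) (sum_pow_natAbs_le F j)
    rw [← Int.natAbs_neg, neg_sub]
  linarith

namespace IsScaleKernel

variable {A : ℝ≥0} {R : ℤ → ℝ → ℝ → ℂ} {m : ℝ → ℝ}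

lemma norm_pair_le (hR : ∀ k, IsScaleKernel A k (R k)) (hm : Measurable m) (hm0 : ∀ x, 0 ≤ m x)
    (hm2 : ∀ x, m x ≤ 2) (h0 : ∀ k y, ∫ x, R k y x * m x = 0) {G : ℤ → ℝ → ℂ}
    (hG : ∀ k, IsTame (G k)) (j k : ℤ) :
    ‖∫ x, kernelOp (fun x y => R j y x) (G j) x *
        ((m x : ℂ) * (starRingEnd ℂ) (kernelOp (fun x y => R k y x) (G k) x))‖ ≤
      4 * A ^ 2 * (((2 : ℝ) ^ (-(1 / 4) : ℝ)) ^ (j - k).natAbs *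
        ((∫ y, ‖G j y‖ ^ 2) + ∫ y, ‖G k y‖ ^ 2)) := by
  have hmc : Measurable fun x => (m x : ℂ) := by fun_prop
  have hmc2 : ∀ x, ‖(m x : ℂ)‖ ≤ 2 := fun x => by
    simpa [abs_of_nonneg (hm0 x)] using hm2 x
  have hU : ∀ k, IsTame (kernelOp (fun x y => R k y x) (G k)) := fun k =>
    (hR k).toIsSchurKernel.flip.kernelOp_tame (hG k)
  wlog hkj : k ≤ j generalizing j k with H
  · have := H k j (le_of_not_ge hkj)
    rw [← RCLike.norm_conj, ← integral_conj, ← Int.natAbs_neg, neg_sub,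
      add_comm (∫ y, ‖G j y‖ ^ 2)]
    refine le_trans (le_of_eq ?_) this
    congr 2
    ext x
    simp only [map_mul, RCLike.conj_conj, Complex.conj_ofReal]
    ring
  have hW : IsTame fun x =>
      (m x : ℂ) * (starRingEnd ℂ) (kernelOp (fun x y => R k y x) (G k) x) := by
    have := (hU k).conj.mul_bdd hmc hmc2
    simpa only [mul_comm] using this
  rw [(hR j).toIsSchurKernel.flip.kernelOp_dual (hG j) hW]
  have h1 := lintegral_pair_le hkj (hR j) (hR k) hmc hmc2 (h0 j) (hG j) (hG k)
  rw [(hG j).lintegral_sq, (hG k).lintegral_sq, ← ENNReal.ofReal_add (by positivity)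
    (by positivity), ← ENNReal.ofReal_mul (by positivity), mul_assoc] at h1
  have h2 := (enorm_integral_le_lintegral_enorm (μ := volume) (fun y => G j y * kernelOp (R j)
    (fun x => (m x : ℂ) * (starRingEnd ℂ) (kernelOp (fun x y => R k y x) (G k) x)) y))
  simp only [enorm_mul] at h2
  have h3 := h2.trans h1
  rw [← ofReal_norm] at h3
  exact (ENNReal.ofReal_le_ofReal_iff (by positivity)).1 h3

lemma integral_weighted_sum_le (hR : ∀ k, IsScaleKernel A k (R k)) (hm : Measurable m)
    (hm0 : ∀ x, 0 ≤ m x) (hm2 : ∀ x, m x ≤ 2) (h0 : ∀ k y, ∫ x, R k y x * m x = 0)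
    {G : ℤ → ℝ → ℂ} (hG : ∀ k, IsTame (G k)) (F : Finset ℤ) :
    ∫ x, m x * ‖∑ k ∈ F, kernelOp (fun x y => R k y x) (G k) x‖ ^ 2 ≤
      8 * geomConst * A ^ 2 * ∑ k ∈ F, ∫ y, ‖G k y‖ ^ 2 := by
  have hmc : Measurable fun x => (m x : ℂ) := by fun_prop
  have hmc2 : ∀ x, ‖(m x : ℂ)‖ ≤ 2 := fun x => by
    simpa [abs_of_nonneg (hm0 x)] using hm2 x
  set U : ℤ → ℝ → ℂ := fun k => kernelOp (fun x y => R k y x) (G k) with hUdef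
  have hU : ∀ k, IsTame (U k) := fun k =>
    (hR k).toIsSchurKernel.flip.kernelOp_tame (hG k)
  have hW : ∀ k, IsTame fun x => (m x : ℂ) * (starRingEnd ℂ) (U k x) := fun k => by
    have := (hU k).conj.mul_bdd hmc hmc2
    simpa only [mul_comm] using this
  have e1 : ((∫ x, m x * ‖∑ k ∈ F, U k x‖ ^ 2 : ℝ) : ℂ) =
      ∑ j ∈ F, ∑ k ∈ F, ∫ x, U j x * ((m x : ℂ) * (starRingEnd ℂ) (U k x)) := by
    have : ∀ x, ((m x * ‖∑ k ∈ F, U k x‖ ^ 2 : ℝ) : ℂ) =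
        ∑ j ∈ F, ∑ k ∈ F, U j x * ((m x : ℂ) * (starRingEnd ℂ) (U k x)) := fun x => by
      rw [← Finset.sum_mul_sum, ← Finset.mul_sum, ← map_sum]
      push_cast
      rw [← Complex.mul_conj']
      ring
    rw [← integral_complex_ofReal]
    simp only [this]
    rw [integral_finsetSum _ fun j _ => integrable_finsetSum _ fun k _ =>
      ((hU j).mul (hW k)).integrable]
    exact Finset.sum_congr rfl fun j _ => integral_finsetSum _ fun k _ =>
      ((hU j).mul (hW k)).integrable
  calc ∫ x, m x * ‖∑ k ∈ F, U k x‖ ^ 2 ≤ ‖((∫ x, m x * ‖∑ k ∈ F, U k x‖ ^ 2 : ℝ) : ℂ)‖ := by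
        rw [Complex.norm_real]; exact le_abs_self _
    _ ≤ ∑ j ∈ F, ∑ k ∈ F, 4 * A ^ 2 * (((2 : ℝ) ^ (-(1 / 4) : ℝ)) ^ (j - k).natAbs *
        ((∫ y, ‖G j y‖ ^ 2) + ∫ y, ‖G k y‖ ^ 2)) := by
        rw [e1]
        exact norm_sum_le_of_le _ fun j _ => norm_sum_le_of_le _ fun k _ =>
          norm_pair_le hR hm hm0 hm2 h0 hG j k
    _ ≤ 4 * A ^ 2 * (2 * geomConst * ∑ k ∈ F, ∫ y, ‖G k y‖ ^ 2) := by
        simp only [← Finset.mul_sum]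
        exact mul_le_mul_of_nonneg_left
          (double_sum_pow_natAbs_le F fun k => by positivity) (by positivity)
    _ = _ := by ring

/-- Almost orthogonality: kernels at different scales that annihilate the density `m` have a
bounded square function. -/
theorem square_function_le (hA : 0 < A) (hR : ∀ k, IsScaleKernel A k (R k)) (hm : Measurable m)
    (hm0 : ∀ x, 0 ≤ m x) (hm2 : ∀ x, m x ≤ 2) (h0 : ∀ k y, ∫ x, R k y x * m x = 0)
    {h : ℝ → ℂ} (hh : IsTame h) (F : Finset ℤ) :
    ∑ k ∈ F, ∫ y, ‖kernelOp (R k) (fun x => h x * m x) y‖ ^ 2 ≤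
      16 * geomConst * A ^ 2 * ∫ x, ‖h x‖ ^ 2 := by
  have hmc : Measurable fun x => (m x : ℂ) := by fun_prop
  have hmc2 : ∀ x, ‖(m x : ℂ)‖ ≤ 2 := fun x => by
    simpa [abs_of_nonneg (hm0 x)] using hm2 x
  have hhm := hh.mul_bdd hmc hmc2
  set g : ℤ → ℝ → ℂ := fun k => kernelOp (R k) (fun x => h x * m x) with hg
  have hgt : ∀ k, IsTame (g k) := fun k => (hR k).kernelOp_tame hhm
  set G : ℤ → ℝ → ℂ := fun k y => (starRingEnd ℂ) (g k y) with hGd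
  have hG : ∀ k, IsTame (G k) := fun k => (hgt k).conj
  set U : ℝ → ℂ := fun x => ∑ k ∈ F, kernelOp (fun x y => R k y x) (G k) x with hUd
  have hUk : ∀ k, IsTame (kernelOp (fun x y => R k y x) (G k)) := fun k =>
    (hR k).toIsSchurKernel.flip.kernelOp_tame (hG k)
  have hU : IsTame U := IsTame.sum F fun k _ => hUk k
  set S := ∑ k ∈ F, ∫ y, ‖g k y‖ ^ 2 with hS
  have hW := integral_weighted_sum_le hR hm hm0 hm2 h0 hG F
  have hGS : ∑ k ∈ F, ∫ y, ‖G k y‖ ^ 2 = S := by simp [hGd, hS]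
  rw [hGS] at hW
  set N : ℝ := 8 * geomConst * A ^ 2 with hN
  have hNpos : 0 < N := by have := geomConst_pos; positivity
  have e1 : (S : ℂ) = ∫ x, (h x * m x) * U x := by
    rw [hS]
    push_cast
    simp only [hUd, Finset.mul_sum]
    rw [integral_finsetSum _ fun k _ => (hhm.mul (hUk k)).integrable]
    refine Finset.sum_congr rfl fun k _ => ?_
    rw [← (hR k).kernelOp_dual hhm (hG k), ← integral_complex_ofReal]
    refine integral_congr_ae (ae_of_all _ fun y => ?_)
    simp only [hGd]
    rw [Complex.mul_conj']
    push_cast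
    rfl
  have i1 : Integrable fun x => ‖h x‖ ^ 2 := hh.integrable_sq
  have i2 : Integrable fun x => m x * ‖U x‖ ^ 2 :=
    hU.integrable_sq.bdd_mul hm.aestronglyMeasurable (c := 2) (ae_of_all _ fun x => by
      simpa [abs_of_nonneg (hm0 x)] using hm2 x)
  have e2 : S ≤ ∫ x, (N * ‖h x‖ ^ 2 + (2 * N)⁻¹ * (m x * ‖U x‖ ^ 2)) := by
    calc S ≤ ‖(S : ℂ)‖ := by rw [Complex.norm_real]; exact le_abs_self _
      _ ≤ ∫ x, ‖(h x * m x) * U x‖ := by rw [e1]; exact norm_integral_le_integral_norm _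
      _ ≤ _ := by
        refine integral_mono (hhm.mul hU).integrable.norm
          ((i1.const_mul N).add (i2.const_mul _)) fun x => ?_
        simp only [norm_mul, Complex.norm_real, Real.norm_eq_abs, abs_of_nonneg (hm0 x)]
        have a1 : ‖h x‖ * ‖U x‖ ≤ N / 2 * ‖h x‖ ^ 2 + (2 * N)⁻¹ * ‖U x‖ ^ 2 := by
          have := sq_nonneg (N * ‖h x‖ - ‖U x‖)
          have e : N / 2 * ‖h x‖ ^ 2 + (2 * N)⁻¹ * ‖U x‖ ^ 2 =
            ((N * ‖h x‖) ^ 2 + ‖U x‖ ^ 2) / (2 * N) := by field_simp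
          rw [e, le_div_iff₀ (by positivity)]
          nlinarith
        have a2 := mul_le_mul_of_nonneg_left a1 (hm0 x)
        have a3 : m x * (N / 2 * ‖h x‖ ^ 2) ≤ 2 * (N / 2 * ‖h x‖ ^ 2) :=
          mul_le_mul_of_nonneg_right (hm2 x) (by positivity)
        nlinarith
  rw [integral_add (i1.const_mul N) (i2.const_mul _), integral_const_mul, integral_const_mul] at e2
  have e3 : (2 * N)⁻¹ * ∫ x, m x * ‖U x‖ ^ 2 ≤ S / 2 := by
    calc (2 * N)⁻¹ * ∫ x, m x * ‖U x‖ ^ 2 ≤ (2 * N)⁻¹ * (N * S) := by gcongr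
      _ = S / 2 := by field_simp
  have : S ≤ 2 * (N * ∫ x, ‖h x‖ ^ 2) := by linarith
  calc S ≤ _ := this
    _ = _ := by rw [hN]; ring

end IsScaleKernel

lemma enorm_integral_mul_le {A : ℝ≥0} {M f : ℝ → ℂ} (hA : ∫⁻ x, ‖M x‖ₑ ≤ A) {N : ℝ}
    (hf : ∀ x, ‖f x‖ ≤ N) : ‖∫ x, M x * f x‖ ≤ A * N := by
  have hN : 0 ≤ N := (norm_nonneg _).trans (hf 0)
  have : ‖∫ x, M x * f x‖ₑ ≤ ENNReal.ofReal (A * N) := by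
    refine (enorm_integral_le_lintegral_enorm _).trans ?_
    calc ∫⁻ x, ‖M x * f x‖ₑ ≤ ∫⁻ x, ‖M x‖ₑ * ENNReal.ofReal N := by
          refine lintegral_mono fun x => ?_
          rw [enorm_mul, ← ofReal_norm (f x)]
          gcongr
          exact hf x
      _ = (∫⁻ x, ‖M x‖ₑ) * ENNReal.ofReal N := lintegral_mul_const' _ _ ENNReal.ofReal_ne_top
      _ ≤ A * ENNReal.ofReal N := by gcongr
      _ = _ := by rw [ENNReal.ofReal_mul (by positivity)]; simp
  rw [← ofReal_norm] at this
  exact (ENNReal.ofReal_le_ofReal_iff (by positivity)).1 this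

namespace IsScaleKernel

variable {A B : ℝ≥0} {k : ℤ} {M E : ℝ → ℝ → ℂ}

lemma sub_mul (hM : IsScaleKernel A k M) (hE : IsScaleKernel B k E) {ρ : ℝ → ℂ}
    (hρ : Measurable ρ) {c : ℝ≥0} (hc : ∀ y, ‖ρ y‖ ≤ c) :
    IsScaleKernel (A + c * B) k (fun y x => M y x - ρ y * E y x) := by
  have hc' : ∀ y, ‖ρ y‖ₑ ≤ c := fun y => by
    rw [enorm_le_coe]; exact_mod_cast hc y
  have hb : ∀ y x, ‖M y x - ρ y * E y x‖ₑ ≤ ‖M y x‖ₑ + c * ‖E y x‖ₑ := fun y x => by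
    refine enorm_sub_le.trans ?_
    rw [enorm_mul]
    gcongr
    exact hc' y
  refine ⟨⟨?_, fun y => ?_, fun x => ?_⟩, fun y => ?_, fun x x' => ?_⟩
  · exact hM.meas.sub ((hρ.comp measurable_fst).mul hE.meas)
  · calc _ ≤ ∫⁻ x, (‖M y x‖ₑ + c * ‖E y x‖ₑ) := lintegral_mono (hb y)
      _ = (∫⁻ x, ‖M y x‖ₑ) + c * ∫⁻ x, ‖E y x‖ₑ := by
        rw [lintegral_add_left (hM.meas_row y).enorm, lintegral_const_mul _ (hE.meas_row y).enorm]
      _ ≤ _ := by push_cast; gcongr; exacts [hM.row y, hE.row y]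
  · calc _ ≤ ∫⁻ y, (‖M y x‖ₑ + c * ‖E y x‖ₑ) := lintegral_mono fun y => hb y x
      _ = (∫⁻ y, ‖M y x‖ₑ) + c * ∫⁻ y, ‖E y x‖ₑ := by
        rw [lintegral_add_left (hM.meas_col x).enorm, lintegral_const_mul _ (hE.meas_col x).enorm]
      _ ≤ _ := by push_cast; gcongr; exacts [hM.col x, hE.col x]
  · set w : ℝ → ℝ≥0∞ := fun x => ENNReal.ofReal √((2 : ℝ) ^ k * |x - y|)
    have hw : Measurable w := by fun_prop
    calc _ ≤ ∫⁻ x, (‖M y x‖ₑ * w x + c * (‖E y x‖ₑ * w x)) := lintegral_mono fun x => by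
          refine (mul_le_mul_left (hb y x) _).trans (le_of_eq (by ring))
      _ = (∫⁻ x, ‖M y x‖ₑ * w x) + c * ∫⁻ x, ‖E y x‖ₑ * w x := by
        have e : Measurable fun x => ‖M y x‖ₑ * w x := (hM.meas_row y).enorm.mul hw
        rw [lintegral_add_left e,
          lintegral_const_mul' _ _ ENNReal.coe_ne_top]
      _ ≤ _ := by push_cast; gcongr; exacts [hM.moment y, hE.moment y]
  · calc _ ≤ ∫⁻ y, (‖M y x - M y x'‖ₑ + c * ‖E y x - E y x'‖ₑ) := lintegral_mono fun y => by
          rw [show M y x - ρ y * E y x - (M y x' - ρ y * E y x') =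
            (M y x - M y x') - ρ y * (E y x - E y x') by ring]
          refine enorm_sub_le.trans ?_
          rw [enorm_mul]
          gcongr
          exact hc' y
      _ = (∫⁻ y, ‖M y x - M y x'‖ₑ) + c * ∫⁻ y, ‖E y x - E y x'‖ₑ := by
        have e : Measurable fun y => ‖M y x - M y x'‖ₑ :=
          ((hM.meas_col x).sub (hM.meas_col x')).enorm
        rw [lintegral_add_left e,
          lintegral_const_mul' _ _ ENNReal.coe_ne_top]
      _ ≤ A * ENNReal.ofReal √((2 : ℝ) ^ k * |x - x'|) +
            c * (B * ENNReal.ofReal √((2 : ℝ) ^ k * |x - x'|)) := by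
          gcongr; exacts [hM.holder x x', hE.holder x x']
      _ = _ := by push_cast; ring

end IsScaleKernel

/-- Nonnegative kernels of mass one at every dyadic scale. -/
structure IsAveraging (B : ℝ≥0) (E : ℤ → ℝ → ℝ → ℝ) : Prop where
  scale : ∀ k, IsScaleKernel B k (fun y x => (E k y x : ℂ))
  nonneg : ∀ k y x, 0 ≤ E k y x
  mass : ∀ k y, ∫ x, E k y x = 1

namespace IsAveraging

variable {A B : ℝ≥0} {E : ℤ → ℝ → ℝ → ℝ} {m : ℝ → ℝ}

lemma integrable (hE : IsAveraging B E) (k : ℤ) (y : ℝ) : Integrable (E k y) := by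
  have := ((hE.scale k).integrable_row y).re
  simpa using this

lemma integrable_mul (hE : IsAveraging B E) (k : ℤ) (y : ℝ) (hm : Measurable m)
    (h1 : ∀ x, 1 / 2 ≤ m x) (h2 : ∀ x, m x ≤ 2) : Integrable (fun x => E k y x * m x) :=
  (hE.integrable k y).mul_bdd (c := 2) hm.aestronglyMeasurable (ae_of_all _ fun x => by
    rw [Real.norm_of_nonneg (by linarith [h1 x])]; exact h2 x)

lemma mean_mem (hE : IsAveraging B E) (k : ℤ) (y : ℝ) (hm : Measurable m)
    (h1 : ∀ x, 1 / 2 ≤ m x) (h2 : ∀ x, m x ≤ 2) :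
    1 / 2 ≤ ∫ x, E k y x * m x ∧ ∫ x, E k y x * m x ≤ 2 := by
  have hi := hE.integrable_mul k y hm h1 h2
  constructor
  · calc (1 / 2 : ℝ) = ∫ x, E k y x * (1 / 2) := by rw [integral_mul_const, hE.mass]; norm_num
      _ ≤ _ := integral_mono ((hE.integrable k y).mul_const _) hi fun x =>
        mul_le_mul_of_nonneg_left (h1 x) (hE.nonneg k y x)
  · calc _ ≤ ∫ x, E k y x * 2 := integral_mono hi ((hE.integrable k y).mul_const _) fun x =>
        mul_le_mul_of_nonneg_left (h2 x) (hE.nonneg k y x)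
      _ = 2 := by rw [integral_mul_const, hE.mass]; norm_num

/-- Subtracting the paraproduct part from a family of scale kernels leaves a family with bounded
square function. -/
lemma corrected_square_function_le (hE : IsAveraging B E) (hA : 0 < A)
    {M : ℤ → ℝ → ℝ → ℂ} (hM : ∀ k, IsScaleKernel A k (M k)) (hm : Measurable m)
    (h1 : ∀ x, 1 / 2 ≤ m x) (h2 : ∀ x, m x ≤ 2) {h : ℝ → ℂ} (hh : IsTame h) (F : Finset ℤ) :
    ∑ k ∈ F, ∫ y, ‖kernelOp (M k) (fun x => h x * m x) y -
        (∫ x, M k y x * m x) / ((∫ x, E k y x * m x : ℝ) : ℂ) *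
        kernelOp (fun y x => (E k y x : ℂ)) (fun x => h x * m x) y‖ ^ 2 ≤
      16 * geomConst * (A + 4 * A * B) ^ 2 * ∫ x, ‖h x‖ ^ 2 := by
  have hmc : Measurable fun x => (m x : ℂ) := by fun_prop
  have hm0 : ∀ x, 0 ≤ m x := fun x => by linarith [h1 x]
  have hmc2 : ∀ x, ‖(m x : ℂ)‖ ≤ 2 := fun x => by
    simpa [abs_of_nonneg (hm0 x)] using h2 x
  set ρ : ℤ → ℝ → ℂ := fun k y => (∫ x, M k y x * m x) / ((∫ x, E k y x * m x : ℝ) : ℂ) with hρ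
  have hρm : ∀ k, Measurable (ρ k) := fun k => by
    refine Measurable.div (IsSchurKernel.measurable_kernelOp (hM k).meas hmc) ?_
    have := IsSchurKernel.measurable_kernelOp (hE.scale k).meas hmc
    convert this using 1
    ext y
    simp only [kernelOp]
    rw [← integral_complex_ofReal]
    push_cast
    rfl
  have hρb : ∀ k y, ‖ρ k y‖ ≤ (4 * A : ℝ≥0) := fun k y => by
    have e1 : ‖∫ x, M k y x * m x‖ ≤ A * 2 := enorm_integral_mul_le ((hM k).row y) hmc2
    have e2 := (hE.mean_mem k y hm h1 h2).1
    simp only [hρ]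
    rw [norm_div, Complex.norm_real, Real.norm_of_nonneg (by linarith), div_le_iff₀ (by linarith)]
    push_cast
    nlinarith [A.coe_nonneg]
  set R : ℤ → ℝ → ℝ → ℂ := fun k y x => M k y x - ρ k y * E k y x with hRdef
  have hR : ∀ k, IsScaleKernel (A + 4 * A * B) k (R k) := fun k =>
    (hM k).sub_mul (hE.scale k) (hρm k) (hρb k)
  have h0 : ∀ k y, ∫ x, R k y x * m x = 0 := fun k y => by
    simp only [hRdef, _root_.sub_mul, mul_assoc]
    rw [integral_sub ((hM k).integrable_row_mul y hmc hmc2)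
      (((hE.scale k).integrable_row_mul y hmc hmc2).const_mul _), integral_const_mul]
    have e2 := (hE.mean_mem k y hm h1 h2).1
    have e3 : ∫ x, (E k y x : ℂ) * m x = ((∫ x, E k y x * m x : ℝ) : ℂ) := by
      rw [← integral_complex_ofReal]; push_cast; rfl
    rw [e3]
    simp only [hρ]
    rw [div_mul_cancel₀, sub_self]
    exact_mod_cast (by linarith : (∫ x, E k y x * m x) ≠ 0)
  have key := IsScaleKernel.square_function_le (A := A + 4 * A * B) (by positivity) hR hm hm0 h2 h0
    hh F
  push_cast at key
  refine le_trans (le_of_eq ?_) key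
  refine Finset.sum_congr rfl fun k _ => integral_congr_ae (ae_of_all _ fun y => ?_)
  obtain ⟨N, hN⟩ := (hh.mul_bdd hmc hmc2).bdd
  have hhm := (hh.mul_bdd hmc hmc2).meas
  have : kernelOp (R k) (fun x => h x * m x) y = kernelOp (M k) (fun x => h x * m x) y -
      ρ k y * kernelOp (fun y x => (E k y x : ℂ)) (fun x => h x * m x) y := by
    simp only [kernelOp, hRdef, _root_.sub_mul, mul_assoc]
    rw [integral_sub ((hM k).integrable_row_mul y hhm hN)
      (((hE.scale k).integrable_row_mul y hhm hN).const_mul _), integral_const_mul]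
  simp only [this]
  rfl

lemma norm_sub_sq_le (a b : ℂ) : ‖a - b‖ ^ 2 ≤ 2 * ‖a‖ ^ 2 + 2 * ‖b‖ ^ 2 := by
  have := norm_sub_le a b
  nlinarith [sq_nonneg (‖a‖ - ‖b‖), norm_nonneg (a - b), norm_nonneg a, norm_nonneg b]

/-- The constant of the Carleson embedding. -/
noncomputable def _root_.carlesonConst (A B : ℝ≥0) : ℝ :=
  8 * (16 * geomConst * A ^ 2) + 32 * (16 * geomConst * (A + 4 * A * B) ^ 2)

lemma _root_.carlesonConst_nonneg (A B : ℝ≥0) : 0 ≤ carlesonConst A B := by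
  have := geomConst_pos
  unfold carlesonConst
  positivity

/-- A Carleson embedding for Littlewood–Paley pieces of a bounded function. -/
lemma carleson_half (hE : IsAveraging B E) (hA : 0 < A) {P : ℤ → ℝ → ℝ → ℂ}
    (hP : ∀ k, IsScaleKernel A k (P k)) (hP0 : ∀ k y, ∫ x, P k y x = 0) {β : ℝ → ℝ}
    (hβ : Measurable β) (hβ2 : ∀ x, |β x| ≤ 1 / 2) {g : ℝ → ℂ} (hg : IsTame g) (F : Finset ℤ) :
    ∑ k ∈ F, ∫ y, ‖(∫ x, P k y x * β x) * kernelOp (fun y x => (E k y x : ℂ)) g y‖ ^ 2 ≤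
      carlesonConst A B * ∫ x, ‖g x‖ ^ 2 := by
  set m : ℝ → ℝ := fun x => 1 + β x with hmdef
  have hm : Measurable m := by fun_prop
  have h1 : ∀ x, 1 / 2 ≤ m x := fun x => by have := abs_le.1 (hβ2 x); simp only [hmdef]; linarith
  have h2 : ∀ x, m x ≤ 2 := fun x => by have := abs_le.1 (hβ2 x); simp only [hmdef]; linarith
  set h : ℝ → ℂ := fun x => g x * ((m x)⁻¹ : ℝ) with hh
  have hinv : ∀ x, ‖(((m x)⁻¹ : ℝ) : ℂ)‖ ≤ 2 := fun x => by
    rw [Complex.norm_real, Real.norm_of_nonneg (by have := h1 x; positivity)]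
    rw [inv_le_comm₀ (by linarith [h1 x]) (by norm_num)]
    linarith [h1 x]
  have hht : IsTame h := hg.mul_bdd (by fun_prop) hinv
  have hhm : (fun x => h x * m x) = g := by
    ext x
    simp only [hh]
    have : m x ≠ 0 := by linarith [h1 x]
    push_cast
    field_simp
    exact mul_div_cancel_right₀ _ (by exact_mod_cast this)
  have hh2 : ∫ x, ‖h x‖ ^ 2 ≤ 4 * ∫ x, ‖g x‖ ^ 2 := by
    rw [← integral_const_mul]
    refine integral_mono hht.integrable_sq (hg.integrable_sq.const_mul 4) fun x => ?_
    simp only [hh, norm_mul, mul_pow]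
    calc ‖g x‖ ^ 2 * ‖(((m x)⁻¹ : ℝ) : ℂ)‖ ^ 2 ≤ ‖g x‖ ^ 2 * 2 ^ 2 := by gcongr; exact hinv x
      _ = _ := by ring
  have c1 := hE.corrected_square_function_le hA hP hm h1 h2 hht F
  simp only [hhm] at c1
  have c2 := IsScaleKernel.square_function_le hA hP (m := fun _ => 1) measurable_const
    (fun _ => zero_le_one) (fun _ => one_le_two) (by simpa using hP0) hg F
  simp only [Complex.ofReal_one, mul_one] at c2
  have hPm : ∀ k y, ∫ x, P k y x * m x = ∫ x, P k y x * β x := fun k y => by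
    have i2 : Integrable fun x => P k y x * β x :=
      (hP k).integrable_row_mul (N := 1 / 2) (f := fun x => (β x : ℂ)) y (by fun_prop)
        fun x => by simpa using hβ2 x
    simp only [hmdef, Complex.ofReal_add, Complex.ofReal_one, mul_add, mul_one]
    rw [integral_add ((hP k).integrable_row y) i2, hP0, zero_add]
  simp only [hPm] at c1
  have tP : ∀ k, IsTame (kernelOp (P k) g) := fun k => (hP k).kernelOp_tame hg
  have tE : ∀ k, IsTame (kernelOp (fun y x => (E k y x : ℂ)) g) := fun k =>
    (hE.scale k).kernelOp_tame hg
  have mβ : ∀ k, Measurable fun y => ∫ x, P k y x * β x := fun k =>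
    IsSchurKernel.measurable_kernelOp (hP k).meas (f := fun x => (β x : ℂ)) (by fun_prop)
  have bβ : ∀ k y, ‖∫ x, P k y x * β x‖ ≤ A * (1 / 2) := fun k y =>
    enorm_integral_mul_le ((hP k).row y) fun x => by simpa using hβ2 x
  have mE : ∀ k, Measurable fun y => ∫ x, E k y x * m x := fun k => by
    have : Measurable (Function.uncurry fun y x => E k y x * m x) := by
      have := (hE.scale k).meas
      have e : Measurable (Function.uncurry (E k)) := Complex.measurable_re.comp this
      exact e.mul (hm.comp measurable_snd)
    exact this.stronglyMeasurable.integral_prod_right.measurable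
  set D : ℤ → ℝ → ℂ := fun k y => kernelOp (P k) g y - (∫ x, P k y x * β x) /
    ((∫ x, E k y x * m x : ℝ) : ℂ) * kernelOp (fun y x => (E k y x : ℂ)) g y with hD
  have tD : ∀ k, IsTame (D k) := fun k => by
    have := (tE k).mul_bdd (g := fun y => -((∫ x, P k y x * β x) / ((∫ x, E k y x * m x : ℝ) : ℂ)))
      ((mβ k).div (by have := mE k; fun_prop)).neg (N := A) fun y => by
        have e2 := (hE.mean_mem k y hm h1 h2).1
        rw [norm_neg, norm_div, Complex.norm_real, Real.norm_of_nonneg (by linarith),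
          div_le_iff₀ (by linarith)]
        nlinarith [bβ k y, A.coe_nonneg]
    have := (tP k).add this
    convert this using 1
    ext y; simp only [hD]; ring
  have point : ∀ k y, ‖(∫ x, P k y x * β x) * kernelOp (fun y x => (E k y x : ℂ)) g y‖ ^ 2 ≤
      8 * ‖kernelOp (P k) g y‖ ^ 2 + 8 * ‖D k y‖ ^ 2 := fun k y => by
    obtain ⟨e1, e2⟩ := hE.mean_mem k y hm h1 h2
    have e3 : ((∫ x, E k y x * m x : ℝ) : ℂ) ≠ 0 := by
      exact_mod_cast (by linarith : (∫ x, E k y x * m x) ≠ 0)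
    have : (∫ x, P k y x * β x) * kernelOp (fun y x => (E k y x : ℂ)) g y =
        ((∫ x, E k y x * m x : ℝ) : ℂ) * (kernelOp (P k) g y - D k y) := by
      simp only [hD]
      field_simp
      ring
    rw [this, norm_mul, mul_pow, Complex.norm_real, Real.norm_of_nonneg (by linarith)]
    have n := norm_sub_sq_le (kernelOp (P k) g y) (D k y)
    have n2 : (∫ x, E k y x * m x) ^ 2 ≤ 4 := by nlinarith
    calc _ ≤ 4 * (2 * ‖kernelOp (P k) g y‖ ^ 2 + 2 * ‖D k y‖ ^ 2) := by gcongr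
      _ = _ := by ring
  calc _ ≤ ∑ k ∈ F, (8 * (∫ y, ‖kernelOp (P k) g y‖ ^ 2) + 8 * ∫ y, ‖D k y‖ ^ 2) := by
        refine Finset.sum_le_sum fun k _ => ?_
        rw [← integral_const_mul, ← integral_const_mul, ← integral_add
          ((tP k).integrable_sq.const_mul _) ((tD k).integrable_sq.const_mul _)]
        refine integral_mono_of_nonneg (ae_of_all _ fun y => by positivity)
          (((tP k).integrable_sq.const_mul _).add ((tD k).integrable_sq.const_mul _))
          (ae_of_all _ (point k))
    _ = 8 * (∑ k ∈ F, ∫ y, ‖kernelOp (P k) g y‖ ^ 2) + 8 * ∑ k ∈ F, ∫ y, ‖D k y‖ ^ 2 := by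
        rw [Finset.sum_add_distrib, Finset.mul_sum, Finset.mul_sum]
    _ ≤ 8 * (16 * geomConst * A ^ 2 * ∫ x, ‖g x‖ ^ 2) +
        8 * (16 * geomConst * (A + 4 * A * B) ^ 2 * (4 * ∫ x, ‖g x‖ ^ 2)) := by
        have := geomConst_pos
        gcongr
        exact c1.trans (by gcongr)
    _ = _ := by unfold carlesonConst; ring

lemma carleson (hE : IsAveraging B E) (hA : 0 < A) {P : ℤ → ℝ → ℝ → ℂ}
    (hP : ∀ k, IsScaleKernel A k (P k)) (hP0 : ∀ k y, ∫ x, P k y x = 0) {b : ℝ → ℝ}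
    (hb : Measurable b) {ε : ℝ} (hε : 0 < ε) (hb2 : ∀ x, |b x| ≤ ε) {g : ℝ → ℂ} (hg : IsTame g)
    (F : Finset ℤ) :
    ∑ k ∈ F, ∫ y, ‖(∫ x, P k y x * b x) * kernelOp (fun y x => (E k y x : ℂ)) g y‖ ^ 2 ≤
      4 * carlesonConst A B * ε ^ 2 * ∫ x, ‖g x‖ ^ 2 := by
  have h := hE.carleson_half hA hP hP0 (β := fun x => (2 * ε)⁻¹ * b x) (hb.const_mul _)
    (fun x => by
      rw [abs_mul, abs_of_pos (by positivity), inv_mul_le_iff₀ (by positivity)]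
      linarith [hb2 x]) hg F
  have e : ∀ k y, ∫ x, P k y x * (((2 * ε)⁻¹ * b x : ℝ) : ℂ) =
      (((2 * ε)⁻¹ : ℝ) : ℂ) * ∫ x, P k y x * b x := fun k y => by
    rw [← integral_const_mul]
    congr 1; ext x; push_cast; ring
  simp only [e, mul_assoc, norm_mul _ (_ * _), mul_pow, integral_const_mul] at h
  rw [← Finset.mul_sum, Complex.norm_real, Real.norm_of_nonneg (by positivity), inv_pow,
    inv_mul_le_iff₀ (by positivity)] at h
  refine h.trans (le_of_eq (by ring))

/-- The square function of scale kernels whose action on the density `m` is a Littlewood–Paley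
piece of `m - 1`. -/
theorem square_function_le (hE : IsAveraging B E) {A₁ : ℝ≥0} (hA : 0 < A) (hA₁ : 0 < A₁)
    {P : ℤ → ℝ → ℝ → ℂ} (hP : ∀ k, IsScaleKernel A₁ k (P k)) (hP0 : ∀ k y, ∫ x, P k y x = 0)
    {M : ℤ → ℝ → ℝ → ℂ} (hM : ∀ k, IsScaleKernel A k (M k)) (hm : Measurable m) {ε : ℝ}
    (hε : 0 < ε) (hε2 : ε ≤ 1 / 2) (hmε : ∀ x, |m x - 1| ≤ ε)
    (hMP : ∀ k y, ∫ x, M k y x * m x = ∫ x, P k y x * ((m x - 1 : ℝ) : ℂ)) {h : ℝ → ℂ}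
    (hh : IsTame h) (F : Finset ℤ) :
    ∑ k ∈ F, ∫ y, ‖kernelOp (M k) (fun x => h x * m x) y‖ ^ 2 ≤
      (32 * geomConst * (1 + 4 * B) ^ 2 * A ^ 2 + 128 * carlesonConst A₁ B * ε ^ 2) *
        ∫ x, ‖h x‖ ^ 2 := by
  have h1 : ∀ x, 1 / 2 ≤ m x := fun x => by have := abs_le.1 (hmε x); linarith
  have h2 : ∀ x, m x ≤ 2 := fun x => by have := abs_le.1 (hmε x); linarith
  have hmc : Measurable fun x => (m x : ℂ) := by fun_prop
  have hmc2 : ∀ x, ‖(m x : ℂ)‖ ≤ 2 := fun x => by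
    simpa [abs_of_nonneg (by linarith [h1 x] : 0 ≤ m x)] using h2 x
  have hhm := hh.mul_bdd hmc hmc2
  have hhm2 : ∫ x, ‖h x * m x‖ ^ 2 ≤ 4 * ∫ x, ‖h x‖ ^ 2 := by
    rw [← integral_const_mul]
    refine integral_mono hhm.integrable_sq (hh.integrable_sq.const_mul 4) fun x => ?_
    simp only [norm_mul, mul_pow]
    calc ‖h x‖ ^ 2 * ‖(m x : ℂ)‖ ^ 2 ≤ ‖h x‖ ^ 2 * 2 ^ 2 := by gcongr; exact hmc2 x
      _ = _ := by ring
  have c1 := hE.corrected_square_function_le hA hM hm h1 h2 hh F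
  have c2 := hE.carleson hA₁ hP hP0 (hm.sub_const 1) hε hmε hhm F
  simp only [hMP] at c1
  set Q : ℤ → ℝ → ℂ := fun k y => ∫ x, P k y x * ((m x - 1 : ℝ) : ℂ) with hQ
  set V : ℤ → ℝ → ℂ := fun k => kernelOp (fun y x => (E k y x : ℂ)) (fun x => h x * m x) with hV
  have tM : ∀ k, IsTame (kernelOp (M k) (fun x => h x * m x)) := fun k =>
    (hM k).kernelOp_tame hhm
  have tV : ∀ k, IsTame (V k) := fun k => (hE.scale k).kernelOp_tame hhm
  have mQ : ∀ k, Measurable (Q k) := fun k =>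
    IsSchurKernel.measurable_kernelOp (hP k).meas (f := fun x => ((m x - 1 : ℝ) : ℂ)) (by fun_prop)
  have bQ : ∀ k y, ‖Q k y‖ ≤ A₁ * ε := fun k y =>
    enorm_integral_mul_le ((hP k).row y) fun x => by
      rw [Complex.norm_real]; exact hmε x
  have tQV : ∀ k, IsTame fun y => Q k y * V k y := fun k => by
    simpa only [mul_comm] using (tV k).mul_bdd (mQ k) (bQ k)
  have mE : ∀ k, Measurable fun y => ∫ x, E k y x * m x := fun k => by
    have : Measurable (Function.uncurry fun y x => E k y x * m x) := by
      have := (hE.scale k).meas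
      have e : Measurable (Function.uncurry (E k)) := Complex.measurable_re.comp this
      exact e.mul (hm.comp measurable_snd)
    exact this.stronglyMeasurable.integral_prod_right.measurable
  set W : ℤ → ℝ → ℂ := fun k y => Q k y / ((∫ x, E k y x * m x : ℝ) : ℂ) * V k y with hW
  have bW : ∀ k y, ‖W k y‖ ^ 2 ≤ 4 * ‖Q k y * V k y‖ ^ 2 := fun k y => by
    have e1 := (hE.mean_mem k y hm h1 h2).1
    have e2 : ‖W k y‖ ≤ 2 * ‖Q k y * V k y‖ := by
      simp only [hW]
      rw [div_mul_eq_mul_div, norm_div, Complex.norm_real, Real.norm_of_nonneg (by linarith),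
        div_le_iff₀ (by linarith)]
      nlinarith [norm_nonneg (Q k y * V k y)]
    calc ‖W k y‖ ^ 2 ≤ (2 * ‖Q k y * V k y‖) ^ 2 := by gcongr
      _ = _ := by ring
  have tW : ∀ k, IsTame (W k) := fun k => by
    have := (tQV k).mul_bdd (g := fun y => ((∫ x, E k y x * m x : ℝ) : ℂ)⁻¹)
      (by have := mE k; fun_prop) (N := 2) fun y => by
        have e1 := (hE.mean_mem k y hm h1 h2).1
        rw [norm_inv, Complex.norm_real, Real.norm_of_nonneg (by linarith),
          inv_le_comm₀ (by linarith) (by norm_num)]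
        linarith
    convert this using 1
    ext y; simp only [hW]; ring
  have tD : ∀ k, IsTame fun y => kernelOp (M k) (fun x => h x * m x) y - W k y := fun k => by
    have := (tM k).add ((tW k).mul_bdd (g := fun _ => -1) measurable_const (N := 1) (by simp))
    convert this using 1
    ext y; ring
  have point : ∀ k y, ‖kernelOp (M k) (fun x => h x * m x) y‖ ^ 2 ≤
      2 * ‖kernelOp (M k) (fun x => h x * m x) y - W k y‖ ^ 2 + 8 * ‖Q k y * V k y‖ ^ 2 := by
    intro k y
    have n := norm_sub_sq_le (kernelOp (M k) (fun x => h x * m x) y - W k y) (-W k y)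
    rw [norm_neg, sub_neg_eq_add, sub_add_cancel] at n
    linarith [bW k y]
  calc _ ≤ ∑ k ∈ F, (2 * (∫ y, ‖kernelOp (M k) (fun x => h x * m x) y - W k y‖ ^ 2) +
        8 * ∫ y, ‖Q k y * V k y‖ ^ 2) := by
        refine Finset.sum_le_sum fun k _ => ?_
        rw [← integral_const_mul, ← integral_const_mul, ← integral_add
          ((tD k).integrable_sq.const_mul _) ((tQV k).integrable_sq.const_mul _)]
        exact integral_mono (tM k).integrable_sq
          (((tD k).integrable_sq.const_mul _).add ((tQV k).integrable_sq.const_mul _)) (point k)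
    _ = 2 * (∑ k ∈ F, ∫ y, ‖kernelOp (M k) (fun x => h x * m x) y - W k y‖ ^ 2) +
        8 * ∑ k ∈ F, ∫ y, ‖Q k y * V k y‖ ^ 2 := by
        rw [Finset.sum_add_distrib, Finset.mul_sum, Finset.mul_sum]
    _ ≤ 2 * (16 * geomConst * (A + 4 * A * B) ^ 2 * ∫ x, ‖h x‖ ^ 2) +
        8 * (4 * carlesonConst A₁ B * ε ^ 2 * (4 * ∫ x, ‖h x‖ ^ 2)) := by
        have := carlesonConst_nonneg A₁ B
        gcongr
        exact c2.trans (by gcongr)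
    _ = _ := by ring

end IsAveraging

lemma lintegral_comp_mul_left_pos (f : ℝ → ℝ≥0∞) {c : ℝ} (hc : 0 < c) :
    ∫⁻ x, f (c * x) = ENNReal.ofReal c⁻¹ * ∫⁻ x, f x := by
  have h := Real.map_volume_mul_left hc.ne'
  have he : MeasurableEmbedding (fun x : ℝ => c * x) :=
    (Homeomorph.mulLeft₀ c hc.ne').measurableEmbedding
  calc ∫⁻ x, f (c * x) = ∫⁻ x, f x ∂(Measure.map (fun x : ℝ => c * x) volume) :=
        (he.lintegral_map f).symm
    _ = _ := by
      rw [h, lintegral_smul_measure, abs_of_pos (inv_pos.2 hc), smul_eq_mul]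

/-- The `L¹`-normalized dilation `2 ^ k a(2 ^ k ·)`. -/
noncomputable def dil (k : ℤ) (a : ℝ → ℂ) (r : ℝ) : ℂ := ((2 : ℝ) ^ k : ℝ) * a ((2 : ℝ) ^ k * r)

lemma IsScaleKernel.dilate {A : ℝ≥0} {M : ℝ → ℝ → ℂ} (h : IsScaleKernel A 0 M) (k : ℤ) :
    IsScaleKernel A k
      (fun y x => (((2 : ℝ) ^ k : ℝ) : ℂ) * M ((2 : ℝ) ^ k * y) ((2 : ℝ) ^ k * x)) := by
  set c : ℝ := (2 : ℝ) ^ k with hc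
  have hcp : 0 < c := by positivity
  have hn : ‖(c : ℂ)‖ₑ = ENNReal.ofReal c := by
    rw [← ofReal_norm, Complex.norm_real, Real.norm_of_nonneg hcp.le]
  have hcc : ENNReal.ofReal c * ENNReal.ofReal c⁻¹ = 1 := by
    rw [← ENNReal.ofReal_mul hcp.le, mul_inv_cancel₀ hcp.ne', ENNReal.ofReal_one]
  have key : ∀ f : ℝ → ℝ≥0∞, ∫⁻ x, ENNReal.ofReal c * f (c * x) = ∫⁻ x, f x := fun f => by
    rw [lintegral_const_mul' _ _ ENNReal.ofReal_ne_top, lintegral_comp_mul_left_pos f hcp,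
      ← mul_assoc, hcc, one_mul]
  have habs : ∀ x y : ℝ, c * |x - y| = 1 * |c * x - c * y| := fun x y => by
    rw [← mul_sub, abs_mul, abs_of_pos hcp, one_mul]
  refine ⟨⟨?_, fun y => ?_, fun x => ?_⟩, fun y => ?_, fun x x' => ?_⟩
  · have : Measurable fun p : ℝ × ℝ => Function.uncurry M (c * p.1, c * p.2) :=
      h.meas.comp (by fun_prop)
    exact measurable_const.mul this
  · simp only [enorm_mul, hn]
    rw [key fun x => ‖M (c * y) x‖ₑ]
    exact h.row _
  · simp only [enorm_mul, hn]
    rw [key fun y => ‖M y (c * x)‖ₑ]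
    exact h.col _
  · have := h.moment (c * y)
    rw [zpow_zero] at this
    rw [← key] at this
    refine le_trans (le_of_eq (lintegral_congr fun x => ?_)) this
    rw [enorm_mul, hn, habs, mul_assoc]
  · have := h.holder (c * x) (c * x')
    rw [zpow_zero, ← habs] at this
    rw [← key] at this
    refine le_trans (le_of_eq (lintegral_congr fun y => ?_)) this
    rw [← mul_sub, enorm_mul, hn]

lemma schwartz_norm_le {E F : Type*} [NormedAddCommGroup E] [NormedSpace ℝ E]
    [NormedAddCommGroup F] [NormedSpace ℝ F] (g : 𝓢(E, F)) (N : ℕ) :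
    ∃ C : ℝ, 0 < C ∧ ∀ x, ‖g x‖ ≤ C / (1 + ‖x‖) ^ N := by
  have h := fun x => SchwartzMap.one_add_le_sup_seminorm_apply (𝕜 := ℝ) (m := (N, 0)) le_rfl le_rfl
    g x
  simp only [norm_iteratedFDeriv_zero] at h
  set S := (2 : ℝ) ^ N * ((Finset.Iic (N, 0)).sup fun m => SchwartzMap.seminorm ℝ m.1 m.2) g
  refine ⟨|S| + 1, by positivity, fun x => ?_⟩
  rw [le_div_iff₀ (by positivity), mul_comm]
  exact (h x).trans ((le_abs_self _).trans (by linarith))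

lemma schwartz_exists_bound {E F : Type*} [NormedAddCommGroup E] [NormedSpace ℝ E]
    [NormedAddCommGroup F] [NormedSpace ℝ F] (g : 𝓢(E, F)) : ∃ M : ℝ, ∀ x, ‖g x‖ ≤ M := by
  obtain ⟨C, -, hC⟩ := schwartz_norm_le g 0
  exact ⟨C, fun x => by simpa using hC x⟩

lemma schwartz_decay (a : 𝓢(ℝ, ℂ)) (n : ℕ) :
    ∃ C : ℝ, 0 < C ∧ ∀ x, ‖a x‖ ≤ C / (1 + |x|) ^ n := by
  simpa only [Real.norm_eq_abs] using schwartz_norm_le a n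

lemma integrable_inv_one_add_abs_sq : Integrable fun x : ℝ => ((1 + |x|) ^ 2)⁻¹ := by
  have := integrable_one_add_norm (E := ℝ) (μ := volume) (r := 2) (by simp)
  refine this.congr (ae_of_all _ fun x => ?_)
  simp only [Real.norm_eq_abs]
  rw [Real.rpow_neg (by positivity)]
  norm_cast

/-- The mass of `(1 + |x|)⁻²`. -/
noncomputable def decayConst : ℝ := ∫ x : ℝ, ((1 + |x|) ^ 2)⁻¹

lemma decayConst_nonneg : 0 ≤ decayConst := integral_nonneg fun x => by positivity

lemma lintegral_inv_one_add_abs_sq :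
    ∫⁻ x : ℝ, ENNReal.ofReal ((1 + |x|) ^ 2)⁻¹ = ENNReal.ofReal decayConst := by
  rw [decayConst, ofReal_integral_eq_lintegral_ofReal integrable_inv_one_add_abs_sq
    (ae_of_all _ fun x => by positivity)]

lemma lintegral_translate_sub_le {a a' : ℝ → ℂ} (ha : ∀ x, HasDerivAt a (a' x) x)
    (hc : Continuous a') (x x' : ℝ) :
    ∫⁻ y, ‖a (y - x) - a (y - x')‖ₑ ≤ ENNReal.ofReal |x - x'| * ∫⁻ y, ‖a' y‖ₑ := by
  have key : ∀ y, ‖a (y - x) - a (y - x')‖ₑ ≤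
      ∫⁻ τ in Ioc (0 : ℝ) 1, ENNReal.ofReal |x - x'| * ‖a' (y - x' + τ * (x' - x))‖ₑ := by
    intro y
    have hd : ∀ τ ∈ uIcc (0 : ℝ) 1, HasDerivAt (fun τ : ℝ => a (y - x' + τ * (x' - x)))
        ((x' - x) • a' (y - x' + τ * (x' - x))) τ := fun τ _ => by
      have h2 : HasDerivAt (fun τ : ℝ => y - x' + τ * (x' - x)) (x' - x) τ := by
        simpa using ((hasDerivAt_id τ).mul_const (x' - x)).const_add (y - x')
      exact (ha _).scomp τ h2
    have hi : IntervalIntegrable (fun τ : ℝ => (x' - x) • a' (y - x' + τ * (x' - x)))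
        volume 0 1 := Continuous.intervalIntegrable (by fun_prop) _ _
    have h := intervalIntegral.integral_eq_sub_of_hasDerivAt hd hi
    have e : y - x' + 1 * (x' - x) = y - x := by ring
    rw [e, zero_mul, add_zero, intervalIntegral.integral_of_le zero_le_one] at h
    rw [← h]
    refine (enorm_integral_le_lintegral_enorm _).trans (lintegral_mono fun τ => ?_)
    rw [enorm_smul, ← ofReal_norm (x' - x), Real.norm_eq_abs, abs_sub_comm]
  have hm : Measurable (Function.uncurry fun y τ : ℝ =>
      ENNReal.ofReal |x - x'| * ‖a' (y - x' + τ * (x' - x))‖ₑ) := by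
    simp only [Function.uncurry_def]
    have : Continuous fun p : ℝ × ℝ => a' (p.1 - x' + p.2 * (x' - x)) := by fun_prop
    exact this.measurable.enorm.const_mul _
  calc _ ≤ ∫⁻ y, ∫⁻ τ in Ioc (0 : ℝ) 1,
        ENNReal.ofReal |x - x'| * ‖a' (y - x' + τ * (x' - x))‖ₑ := lintegral_mono key
    _ = ∫⁻ τ in Ioc (0 : ℝ) 1, ∫⁻ y,
        ENNReal.ofReal |x - x'| * ‖a' (y - x' + τ * (x' - x))‖ₑ :=
        lintegral_lintegral_swap hm.aemeasurable
    _ = ∫⁻ τ in Ioc (0 : ℝ) 1, ENNReal.ofReal |x - x'| * ∫⁻ y, ‖a' y‖ₑ := by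
        refine lintegral_congr fun τ => ?_
        rw [lintegral_const_mul' _ _ ENNReal.ofReal_ne_top]
        congr 1
        have := lintegral_add_right_eq_self (μ := volume) (fun y => ‖a' y‖ₑ) (-x' + τ * (x' - x))
        rw [← this]
        exact lintegral_congr fun y => by congr 2; ring
    _ = _ := by simp

lemma ofReal_le_ofReal_sqrt_mul {L : ℝ≥0∞} {u v : ℝ} (hu : 0 ≤ u)
    (h1 : L ≤ ENNReal.ofReal u) (h2 : L ≤ ENNReal.ofReal v) : L ≤ ENNReal.ofReal (√u * √v) := by
  rcases le_total 0 v with hv | hv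
  · rcases le_total u v with h | h
    · refine h1.trans (ENNReal.ofReal_le_ofReal ?_)
      calc u = √u * √u := (Real.mul_self_sqrt hu).symm
        _ ≤ _ := by gcongr
    · refine h2.trans (ENNReal.ofReal_le_ofReal ?_)
      calc v = √v * √v := (Real.mul_self_sqrt hv).symm
        _ ≤ _ := by gcongr
  · rw [ENNReal.ofReal_of_nonpos hv] at h2
    exact h2.trans zero_le

/-- Kernels with rapid decay off the diagonal that are Lipschitz in the mean are scale kernels, with
a constant that is small when the size of the kernel is. -/
lemma isScaleKernel_of_decay {M : ℝ → ℝ → ℂ} (hM : Measurable (Function.uncurry M)) {C D σ : ℝ}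
    (hC : 0 ≤ C) (hD : 0 ≤ D) (hσ : 0 ≤ σ) (hσ1 : σ ≤ 1)
    (hsize : ∀ y x, ‖M y x‖ ≤ C * σ / (1 + |y - x|) ^ 3)
    (hlip : ∀ x x', ∫⁻ y, ‖M y x - M y x'‖ₑ ≤ ENNReal.ofReal (D * |x - x'|)) :
    IsScaleKernel ((C * decayConst + √(2 * C * decayConst) * √D) * √σ).toNNReal 0 M := by
  have hd := decayConst_nonneg
  have hσs : σ ≤ √σ := by
    rw [Real.le_sqrt hσ hσ]; nlinarith
  have hA : ENNReal.ofReal (C * σ * decayConst) ≤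
      ((C * decayConst + √(2 * C * decayConst) * √D) * √σ).toNNReal := by
    refine ENNReal.ofReal_le_ofReal ?_
    rw [add_mul]
    have : C * σ * decayConst ≤ C * decayConst * √σ := by
      rw [mul_right_comm]; gcongr
    have : 0 ≤ √(2 * C * decayConst) * √D * √σ := by positivity
    linarith
  have hb : ∀ y x, ‖M y x‖ₑ * ENNReal.ofReal √(1 * |x - y|) ≤
      ENNReal.ofReal (C * σ) * ENNReal.ofReal ((1 + |y - x|) ^ 2)⁻¹ := fun y x => by
    rw [← ofReal_norm, ← ENNReal.ofReal_mul (norm_nonneg _), ← ENNReal.ofReal_mul (by positivity)]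
    refine ENNReal.ofReal_le_ofReal ?_
    have h1 : √(1 * |x - y|) ≤ 1 + |y - x| := by
      rw [one_mul, abs_sub_comm]
      exact Real.sqrt_le_iff.2 ⟨by positivity, by nlinarith [abs_nonneg (y - x)]⟩
    calc ‖M y x‖ * √(1 * |x - y|) ≤ C * σ / (1 + |y - x|) ^ 3 * (1 + |y - x|) := by
          gcongr; exact hsize y x
      _ = _ := by field_simp
  have hb0 : ∀ y x, ‖M y x‖ₑ ≤
      ENNReal.ofReal (C * σ) * ENNReal.ofReal ((1 + |y - x|) ^ 2)⁻¹ := fun y x => by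
    rw [← ofReal_norm, ← ENNReal.ofReal_mul (by positivity)]
    refine ENNReal.ofReal_le_ofReal ((hsize y x).trans ?_)
    rw [div_eq_mul_inv]
    gcongr 2
    exact pow_le_pow_right₀ (by linarith [abs_nonneg (y - x)]) (by norm_num)
  have i1 : ∀ y, ∫⁻ x, ENNReal.ofReal (C * σ) * ENNReal.ofReal ((1 + |y - x|) ^ 2)⁻¹ =
      ENNReal.ofReal (C * σ * decayConst) := fun y => by
    rw [lintegral_const_mul' _ _ ENNReal.ofReal_ne_top,
      lintegral_sub_left_eq_self (fun z => ENNReal.ofReal ((1 + |z|) ^ 2)⁻¹) y,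
      lintegral_inv_one_add_abs_sq, ← ENNReal.ofReal_mul (by positivity)]
  have i2 : ∀ x, ∫⁻ y, ENNReal.ofReal (C * σ) * ENNReal.ofReal ((1 + |y - x|) ^ 2)⁻¹ =
      ENNReal.ofReal (C * σ * decayConst) := fun x => by
    rw [← i1 x]
    exact lintegral_congr fun y => by rw [abs_sub_comm]
  have hcol : ∀ x, ∫⁻ y, ‖M y x‖ₑ ≤ ENNReal.ofReal (C * σ * decayConst) := fun x =>
    (lintegral_mono fun y => hb0 y x).trans (i2 x).le
  refine ⟨⟨hM, fun y => ?_, fun x => (hcol x).trans hA⟩, fun y => ?_, fun x x' => ?_⟩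
  · exact ((lintegral_mono (hb0 y)).trans (i1 y).le).trans hA
  · simp only [zpow_zero]
    exact ((lintegral_mono (hb y)).trans (i1 y).le).trans hA
  · have h2 : ∫⁻ y, ‖M y x - M y x'‖ₑ ≤ ENNReal.ofReal (2 * (C * σ * decayConst)) := by
      calc _ ≤ ∫⁻ y, (‖M y x‖ₑ + ‖M y x'‖ₑ) := lintegral_mono fun y => enorm_sub_le
        _ = (∫⁻ y, ‖M y x‖ₑ) + ∫⁻ y, ‖M y x'‖ₑ :=
          lintegral_add_left (hM.comp measurable_prodMk_right).enorm _
        _ ≤ _ := by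
          rw [two_mul, ENNReal.ofReal_add (by positivity) (by positivity)]
          gcongr
          exacts [hcol x, hcol x']
    refine (ofReal_le_ofReal_sqrt_mul (by positivity) h2 (hlip x x')).trans ?_
    rw [← ENNReal.ofReal_coe_nnreal, ← ENNReal.ofReal_mul (by positivity),
      Real.coe_toNNReal _ (by positivity), zpow_zero, one_mul]
    refine ENNReal.ofReal_le_ofReal ?_
    rw [show 2 * (C * σ * decayConst) = (2 * C * decayConst) * σ by ring,
      Real.sqrt_mul (by positivity), Real.sqrt_mul hD]
    have : 0 ≤ C * decayConst * √σ * √|x - x'| := by positivity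
    nlinarith

lemma schwartz_hasDerivAt (a : 𝓢(ℝ, ℂ)) (x : ℝ) :
    HasDerivAt a (SchwartzMap.derivCLM ℝ ℂ a x) x := by
  have := (a.differentiable x).hasDerivAt
  simpa using this

/-- Convolution with a Schwartz function, dilated to the scale `2 ^ (-k)`. -/
lemma exists_isScaleKernel_conv (a : 𝓢(ℝ, ℂ)) :
    ∃ A : ℝ≥0, 0 < A ∧ ∀ k, IsScaleKernel A k (fun y x => dil k a (y - x)) := by
  obtain ⟨C, hC, hCa⟩ := schwartz_decay a 3
  set D : ℝ := ∫ y, ‖SchwartzMap.derivCLM ℝ ℂ a y‖ with hD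
  have hD' : ∫⁻ y, ‖SchwartzMap.derivCLM ℝ ℂ a y‖ₑ = ENNReal.ofReal D := by
    rw [hD, ofReal_integral_norm_eq_lintegral_enorm (SchwartzMap.integrable _)]
  have hD0 : 0 ≤ D := by positivity
  have h := isScaleKernel_of_decay (M := fun y x => a (y - x)) (C := C) (D := D) (σ := 1)
    (by
      have : Continuous fun p : ℝ × ℝ => a (p.1 - p.2) := a.continuous.comp (by fun_prop)
      exact this.measurable) hC.le hD0 zero_le_one le_rfl
    (fun y x => by simpa using hCa (y - x)) (fun x x' => by
      refine (lintegral_translate_sub_le (schwartz_hasDerivAt a)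
        (SchwartzMap.continuous _) x x').trans (le_of_eq ?_)
      rw [hD', mul_comm, ENNReal.ofReal_mul hD0])
  set A := ((C * decayConst + √(2 * C * decayConst) * √D) * √1).toNNReal
  have mono : ∀ k, IsScaleKernel (A + 1) k (fun y x => dil k a (y - x)) := fun k => by
    have h1 := h.dilate k
    simp only [← mul_sub] at h1
    have hle : (A : ℝ≥0∞) ≤ ((A + 1 : ℝ≥0) : ℝ≥0∞) := by push_cast; exact le_self_add
    exact ⟨⟨h1.meas, fun y => (h1.row y).trans hle, fun x => (h1.col x).trans hle⟩,
      fun y => (h1.moment y).trans hle, fun x x' => (h1.holder x x').trans (by gcongr)⟩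
  exact ⟨A + 1, by positivity, mono⟩

lemma exists_isAveraging : ∃ (B : ℝ≥0) (E : ℤ → ℝ → ℝ → ℝ), IsAveraging B E := by
  let b : ContDiffBump (0 : ℝ) := default
  have hs : HasCompactSupport fun x : ℝ => ((b.normed volume x : ℝ) : ℂ) :=
    b.hasCompactSupport_normed.comp_left (g := fun r : ℝ => (r : ℂ)) (by simp)
  have hd : ContDiff ℝ ∞ fun x : ℝ => ((b.normed volume x : ℝ) : ℂ) :=
    Complex.ofRealCLM.contDiff.comp b.contDiff_normed
  obtain ⟨B, -, hB⟩ := exists_isScaleKernel_conv (hs.toSchwartzMap hd)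
  refine ⟨B, fun k y x => (2 : ℝ) ^ k * b.normed volume ((2 : ℝ) ^ k * (y - x)), fun k => ?_,
    fun k y x => mul_nonneg (by positivity) (b.nonneg_normed _), fun k y => ?_⟩
  · have := hB k
    simpa [dil] using this
  · rw [integral_const_mul, integral_sub_left_eq_self
      (fun z => b.normed volume ((2 : ℝ) ^ k * z)) volume y,
      Measure.integral_comp_mul_left (b.normed volume) ((2 : ℝ) ^ k), b.integral_normed]
    have : (0 : ℝ) < 2 ^ k := by positivity
    rw [abs_of_pos (by positivity), smul_eq_mul, mul_one, mul_inv_cancel₀ this.ne']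

/-- A homeomorphism `Φ` of the line, with inverse `X`, that is `σ`-close to the identity in the
Lipschitz sense. -/
structure IsNearId (σ : ℝ) (Φ X : ℝ → ℝ) : Prop where
  near : ∀ x y, |Φ x - Φ y - (x - y)| ≤ σ * |x - y|
  right_inv : ∀ w, Φ (X w) = w
  left_inv : ∀ x, X (Φ x) = x
  nonneg : 0 ≤ σ
  le : σ ≤ 1 / 4

lemma exists_isNearId {σ : ℝ} {Φ : ℝ → ℝ} (h0 : 0 ≤ σ) (h1 : σ ≤ 1 / 4)
    (h : ∀ x y, |Φ x - Φ y - (x - y)| ≤ σ * |x - y|) : ∃ X, IsNearId σ Φ X := by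
  have happ : ApproximatesLinearOn Φ ((ContinuousLinearEquiv.refl ℝ ℝ : ℝ ≃L[ℝ] ℝ) : ℝ →L[ℝ] ℝ)
      univ σ.toNNReal := by
    intro x _ y _
    simpa [Real.coe_toNNReal _ h0] using h x y
  have hlt : σ.toNNReal < ‖((ContinuousLinearEquiv.refl ℝ ℝ).symm : ℝ →L[ℝ] ℝ)‖₊⁻¹ := by
    have : ‖((ContinuousLinearEquiv.refl ℝ ℝ).symm : ℝ →L[ℝ] ℝ)‖₊ = 1 := by
      ext
      simp [ContinuousLinearEquiv.refl]
      exact ContinuousLinearMap.norm_id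
    rw [this, inv_one, ← NNReal.coe_lt_coe, Real.coe_toNNReal _ h0]
    norm_num; linarith
  let e := happ.toHomeomorph Φ (Or.inr hlt)
  exact ⟨e.symm, h, fun w => e.apply_symm_apply w, fun x => e.symm_apply_apply x, h0, h1⟩

namespace IsNearId

variable {σ : ℝ} {Φ X : ℝ → ℝ}

lemma lipschitz (h : IsNearId σ Φ X) (x y : ℝ) : |Φ x - Φ y| ≤ (1 + σ) * |x - y| := by
  have h1 := h.near x y
  have h2 := abs_add_le (Φ x - Φ y - (x - y)) (x - y)
  rw [sub_add_cancel] at h2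
  linarith

lemma antilipschitz (h : IsNearId σ Φ X) (w w' : ℝ) : |X w - X w'| ≤ (1 - σ)⁻¹ * |w - w'| := by
  have h1 := h.near (X w) (X w')
  rw [h.right_inv, h.right_inv] at h1
  have h2 := abs_sub_abs_le_abs_sub (X w - X w') (w - w')
  rw [abs_sub_comm (X w - X w')] at h2
  have := h.le
  rw [← div_eq_inv_mul, le_div_iff₀ (by linarith)]
  linarith

lemma inv_le (h : IsNearId σ Φ X) : (1 - σ)⁻¹ ≤ 1 + 2 * σ := by
  have := h.le
  have := h.nonneg
  rw [inv_le_iff_one_le_mul₀ (by linarith)]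
  nlinarith

lemma lipschitzWith (h : IsNearId σ Φ X) : LipschitzWith (1 + σ).toNNReal Φ :=
  LipschitzWith.of_dist_le_mul fun x y => by
    rw [Real.coe_toNNReal _ (by linarith [h.nonneg]), Real.dist_eq, Real.dist_eq]
    exact h.lipschitz x y

lemma lipschitzWith_inv (h : IsNearId σ Φ X) : LipschitzWith (1 - σ)⁻¹.toNNReal X :=
  LipschitzWith.of_dist_le_mul fun x y => by
    rw [Real.coe_toNNReal _ (inv_nonneg.2 (by linarith [h.le])), Real.dist_eq, Real.dist_eq]
    exact h.antilipschitz x y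

lemma continuous (h : IsNearId σ Φ X) : Continuous Φ := h.lipschitzWith.continuous

lemma continuous_inv (h : IsNearId σ Φ X) : Continuous X := h.lipschitzWith_inv.continuous

lemma dilate (h : IsNearId σ Φ X) {c : ℝ} (hc : 0 < c) :
    IsNearId σ (fun x => c * Φ (c⁻¹ * x)) (fun x => c * X (c⁻¹ * x)) where
  near x y := by
    have h1 := h.near (c⁻¹ * x) (c⁻¹ * y)
    rw [show c * Φ (c⁻¹ * x) - c * Φ (c⁻¹ * y) - (x - y) =
      c * (Φ (c⁻¹ * x) - Φ (c⁻¹ * y) - (c⁻¹ * x - c⁻¹ * y)) by field_simp, abs_mul, abs_of_pos hc]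
    rw [← mul_sub, abs_mul, abs_of_pos (inv_pos.2 hc)] at h1
    calc _ ≤ c * (σ * (c⁻¹ * |x - y|)) := by rw [← mul_sub]; gcongr
      _ = _ := by field_simp
  right_inv w := by
    rw [← mul_assoc, inv_mul_cancel₀ hc.ne', one_mul, h.right_inv, ← mul_assoc,
      mul_inv_cancel₀ hc.ne', one_mul]
  left_inv w := by
    rw [← mul_assoc, inv_mul_cancel₀ hc.ne', one_mul, h.left_inv, ← mul_assoc,
      mul_inv_cancel₀ hc.ne', one_mul]
  nonneg := h.nonneg
  le := h.le

lemma volume_image_le {f : ℝ → ℝ} {K : ℝ≥0} (hf : LipschitzWith K f) (s : Set ℝ) :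
    volume (f '' s) ≤ K * volume s := by
  have := hf.hausdorffMeasure_image_le (d := 1) zero_le_one s
  simpa [hausdorffMeasure_real] using this

lemma preimage_eq (h : IsNearId σ Φ X) (s : Set ℝ) : Φ ⁻¹' s = X '' s := by
  ext x
  constructor
  · intro hx
    exact ⟨Φ x, hx, h.left_inv x⟩
  · rintro ⟨w, hw, rfl⟩
    rwa [mem_preimage, h.right_inv]

lemma preimage_inv_eq (h : IsNearId σ Φ X) (s : Set ℝ) : X ⁻¹' s = Φ '' s := by
  ext x
  constructor
  · intro hx
    exact ⟨X x, hx, h.right_inv x⟩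
  · rintro ⟨w, hw, rfl⟩
    rwa [mem_preimage, h.left_inv]

lemma map_le (h : IsNearId σ Φ X) :
    Measure.map Φ volume ≤ ENNReal.ofReal (1 - σ)⁻¹ • (volume : Measure ℝ) := by
  refine Measure.le_iff.2 fun s hs => ?_
  rw [Measure.map_apply h.continuous.measurable hs, h.preimage_eq, Measure.smul_apply, smul_eq_mul]
  exact volume_image_le h.lipschitzWith_inv s

lemma map_inv_le (h : IsNearId σ Φ X) :
    Measure.map X volume ≤ ENNReal.ofReal (1 + σ) • (volume : Measure ℝ) := by
  refine Measure.le_iff.2 fun s hs => ?_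
  rw [Measure.map_apply h.continuous_inv.measurable hs, h.preimage_inv_eq, Measure.smul_apply,
    smul_eq_mul]
  exact volume_image_le h.lipschitzWith s

lemma volume_le (h : IsNearId σ Φ X) :
    (volume : Measure ℝ) ≤ ENNReal.ofReal (1 + σ) • Measure.map Φ volume := by
  refine Measure.le_iff.2 fun s hs => ?_
  rw [Measure.smul_apply, smul_eq_mul, Measure.map_apply h.continuous.measurable hs]
  have : s = Φ '' (Φ ⁻¹' s) := by
    rw [h.preimage_eq, image_image]; simp [h.right_inv]
  conv_lhs => rw [this]
  exact volume_image_le h.lipschitzWith _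

lemma lintegral_comp_le (h : IsNearId σ Φ X) {f : ℝ → ℝ≥0∞} (hf : Measurable f) :
    ∫⁻ x, f (Φ x) ≤ 2 * ∫⁻ x, f x := by
  rw [← lintegral_map hf h.continuous.measurable]
  refine (lintegral_mono' h.map_le le_rfl).trans ?_
  rw [lintegral_smul_measure, smul_eq_mul]
  gcongr
  have := h.inv_le
  exact (ENNReal.ofReal_le_ofReal (by linarith [h.le] : _ ≤ (2 : ℝ))).trans (by simp)

lemma lintegral_comp_inv_le (h : IsNearId σ Φ X) {f : ℝ → ℝ≥0∞} (hf : Measurable f) :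
    ∫⁻ x, f (X x) ≤ 2 * ∫⁻ x, f x := by
  rw [← lintegral_map hf h.continuous_inv.measurable]
  refine (lintegral_mono' h.map_inv_le le_rfl).trans ?_
  rw [lintegral_smul_measure, smul_eq_mul]
  gcongr
  exact (ENNReal.ofReal_le_ofReal (by linarith [h.le] : _ ≤ (2 : ℝ))).trans (by simp)

/-- The image of Lebesgue measure under a near-identity homeomorphism has a density close to one. -/
lemma exists_density (h : IsNearId σ Φ X) :
    ∃ m : ℝ → ℝ, Measurable m ∧ (∀ x, |m x - 1| ≤ 2 * σ) ∧
      Measure.map Φ volume = volume.withDensity fun x => ENNReal.ofReal (m x) := by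
  have h0 := h.nonneg
  have hle := h.le
  set μ := Measure.map Φ volume with hμ
  have hac : μ ≪ volume := by
    refine Measure.AbsolutelyContinuous.trans (Measure.absolutelyContinuous_of_le h.map_le) ?_
    exact Measure.smul_absolutelyContinuous
  have : SigmaFinite μ := by
    let e : ℝ ≃ₜ ℝ := ⟨⟨Φ, X, h.left_inv, h.right_inv⟩, h.continuous, h.continuous_inv⟩
    exact e.toMeasurableEquiv.sigmaFinite_map
  set d := μ.rnDeriv volume with hd
  have hdm : Measurable d := Measure.measurable_rnDeriv _ _
  have hwd : volume.withDensity d = μ := Measure.withDensity_rnDeriv_eq _ _ hac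
  have up : d ≤ᵐ[volume] fun _ => ENNReal.ofReal (1 - σ)⁻¹ := by
    refine ae_le_of_forall_setLIntegral_le_of_sigmaFinite hdm fun s hs _ => ?_
    rw [← withDensity_apply _ hs, hwd, setLIntegral_const]
    exact h.map_le s
  have lo : (fun _ => (ENNReal.ofReal (1 + σ))⁻¹) ≤ᵐ[volume] d := by
    refine ae_le_of_forall_setLIntegral_le_of_sigmaFinite measurable_const fun s hs _ => ?_
    rw [setLIntegral_const, ← withDensity_apply d hs, hwd]
    have := h.volume_le s
    rw [Measure.smul_apply, smul_eq_mul] at this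
    rw [ENNReal.inv_mul_le_iff (by simp; linarith) (by simp)]
    exact this
  refine ⟨fun x => max (1 - 2 * σ) (min (1 + 2 * σ) (d x).toReal), by fun_prop, fun x => ?_, ?_⟩
  · rw [abs_le]
    constructor
    · linarith [le_max_left (1 - 2 * σ) (min (1 + 2 * σ) (d x).toReal)]
    · have : max (1 - 2 * σ) (min (1 + 2 * σ) (d x).toReal) ≤ 1 + 2 * σ :=
        max_le (by linarith) (min_le_left _ _)
      linarith
  · rw [← hwd]
    refine withDensity_congr_ae ?_
    filter_upwards [up, lo] with x hx1 hx2
    have hfin : d x ≠ ⊤ := ne_top_of_le_ne_top ENNReal.ofReal_ne_top hx1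
    have t1 : (d x).toReal ≤ 1 + 2 * σ :=
      (ENNReal.toReal_le_of_le_ofReal (inv_nonneg.2 (by linarith)) hx1).trans h.inv_le
    have t2 : 1 - 2 * σ ≤ (d x).toReal := by
      have e := ENNReal.toReal_mono hfin hx2
      rw [ENNReal.toReal_inv, ENNReal.toReal_ofReal (by linarith)] at e
      refine le_trans ?_ e
      rw [le_inv_comm₀ (by linarith) (by linarith), inv_eq_one_div, le_div_iff₀ (by linarith)]
      nlinarith
    rw [min_eq_right t1, max_eq_right t2, ENNReal.ofReal_toReal hfin]

end IsNearId

/-- The kernel of `f ↦ a_k * f - (q_k * ((a_k * f) ∘ Φ)) ∘ X`, where `a_k` and `q_k` are the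
dilations of `a` and `q` to the scale `2 ^ (-k)`. -/
noncomputable def commKernel (a q : ℝ → ℂ) (Φ X : ℝ → ℝ) (k : ℤ) (w y : ℝ) : ℂ :=
  dil k a (w - y) - ∫ u, dil k q (X w - u) * dil k a (Φ u - y)

lemma dil_zero (a : ℝ → ℂ) : dil 0 a = a := by
  ext r; simp [dil]

lemma commKernel_eq_dilate (a q : ℝ → ℂ) (Φ X : ℝ → ℝ) (k : ℤ) (w y : ℝ) :
    commKernel a q Φ X k w y = (((2 : ℝ) ^ k : ℝ) : ℂ) *
      commKernel a q (fun x => (2 : ℝ) ^ k * Φ (((2 : ℝ) ^ k)⁻¹ * x))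
        (fun x => (2 : ℝ) ^ k * X (((2 : ℝ) ^ k)⁻¹ * x)) 0 ((2 : ℝ) ^ k * w) ((2 : ℝ) ^ k * y) := by
  set c : ℝ := (2 : ℝ) ^ k with hc
  have hcp : 0 < c := by positivity
  have hcc : ∀ x, c⁻¹ * (c * x) = x := fun x => by field_simp
  simp only [commKernel, dil_zero, hcc]
  have e := Measure.integral_comp_mul_left
    (fun u => q (c * X w - u) * a (c * Φ (c⁻¹ * u) - c * y)) c
  rw [abs_of_pos (by positivity)] at e
  have e2 : ∫ u, q (c * X w - u) * a (c * Φ (c⁻¹ * u) - c * y) =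
      (c : ℂ) * ∫ u, q (c * X w - c * u) * a (c * Φ (c⁻¹ * (c * u)) - c * y) := by
    rw [e, Complex.real_smul, ← mul_assoc, ← Complex.ofReal_mul, mul_inv_cancel₀ hcp.ne']
    simp
  rw [e2, mul_sub, ← mul_sub c w y]
  simp only [hcc, dil, ← integral_const_mul, ← mul_sub]
  congr 2
  ext u
  rw [← hc]
  ring

section Bounds

variable {σ : ℝ} {Φ X : ℝ → ℝ} (a q : 𝓢(ℝ, ℂ))

lemma measurable_commKernel (h : IsNearId σ Φ X) :
    Measurable (Function.uncurry (commKernel a q Φ X 0)) := by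
  simp only [Function.uncurry_def, commKernel, dil_zero]
  have hΦ := h.continuous
  have hX := h.continuous_inv
  have c1 : Continuous fun p : ℝ × ℝ => a (p.1 - p.2) := a.continuous.comp (by fun_prop)
  have c2 : Continuous fun p : (ℝ × ℝ) × ℝ => q (X p.1.1 - p.2) * a (Φ p.2 - p.1.2) :=
    (q.continuous.comp (by fun_prop)).mul (a.continuous.comp (by fun_prop))
  exact c1.measurable.sub c2.measurable.stronglyMeasurable.integral_prod_right'.measurable

lemma schwartz_bounded : ∃ C : ℝ, ∀ x, ‖a x‖ ≤ C := by
  obtain ⟨C, -, hC⟩ := schwartz_decay a 0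
  exact ⟨C, fun x => by simpa using hC x⟩

lemma integrable_schwartz_mul {f : ℝ → ℂ} (hf : Measurable f) {N : ℝ} (hN : ∀ x, ‖f x‖ ≤ N) :
    Integrable fun z => q z * f z :=
  q.integrable.mul_bdd hf.aestronglyMeasurable (ae_of_all _ hN)

lemma commKernel_eq_integral (hqa : ∀ r, ∫ z, q z * a (r - z) = a r) (h : IsNearId σ Φ X)
    (w y : ℝ) : commKernel a q Φ X 0 w y =
      ∫ z, q z * (a (w - y - z) - a (Φ (X w - z) - y)) := by
  obtain ⟨C, hC⟩ := schwartz_bounded a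
  have hΦ := h.continuous
  have i1 : Integrable fun z => q z * a (w - y - z) := integrable_schwartz_mul q
    (f := fun z => a (w - y - z)) (a.continuous.comp (by fun_prop)).measurable fun x => hC _
  have i2 : Integrable fun z => q z * a (Φ (X w - z) - y) := integrable_schwartz_mul q
    (f := fun z => a (Φ (X w - z) - y)) (a.continuous.comp (by fun_prop)).measurable fun x => hC _
  simp only [commKernel, dil_zero, mul_sub]
  rw [integral_sub i1 i2, hqa]
  congr 1
  rw [← integral_sub_left_eq_self (fun u => q (X w - u) * a (Φ u - y)) volume (X w)]
  simp

lemma norm_schwartz_sub_le : ∃ C : ℝ, 0 < C ∧ ∀ r z r' : ℝ, |r' - (r - z)| ≤ |z| →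
    ‖a (r - z) - a r'‖ ≤ C * |r' - (r - z)| * (1 + 2 * |z|) ^ 3 / (1 + |r|) ^ 3 := by
  obtain ⟨C, hC, hCa⟩ := schwartz_decay (SchwartzMap.derivCLM ℝ ℂ a) 3
  refine ⟨C, hC, fun r z r' hr => ?_⟩
  have hb : ∀ ζ ∈ uIcc r' (r - z), ‖SchwartzMap.derivCLM ℝ ℂ a ζ‖ ≤
      C * (1 + 2 * |z|) ^ 3 / (1 + |r|) ^ 3 := by
    intro ζ hζ
    have h1 : |ζ - (r - z)| ≤ |r' - (r - z)| := by
      rw [abs_sub_comm ζ, abs_sub_comm r']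
      exact abs_sub_right_of_mem_uIcc hζ
    have h2 : |r| ≤ |ζ| + 2 * |z| := by
      have : r = ζ + -(ζ - (r - z)) + z := by ring
      calc |r| = |ζ + -(ζ - (r - z)) + z| := by rw [← this]
        _ ≤ |ζ + -(ζ - (r - z))| + |z| := abs_add_le _ _
        _ ≤ |ζ| + |-(ζ - (r - z))| + |z| := by gcongr; exact abs_add_le _ _
        _ ≤ _ := by rw [abs_neg]; linarith
    have h3 : 1 + |r| ≤ (1 + |ζ|) * (1 + 2 * |z|) := by
      nlinarith [abs_nonneg ζ, abs_nonneg z, mul_nonneg (abs_nonneg ζ) (abs_nonneg z)]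
    refine (hCa ζ).trans ?_
    rw [div_le_div_iff₀ (by positivity) (by positivity)]
    calc C * (1 + |r|) ^ 3 ≤ C * ((1 + |ζ|) * (1 + 2 * |z|)) ^ 3 := by gcongr
      _ = _ := by ring
  have := Convex.norm_image_sub_le_of_norm_hasDerivWithin_le (f := a)
    (fun ζ _ => (schwartz_hasDerivAt a ζ).hasDerivWithinAt) hb (convex_uIcc r' (r - z))
    left_mem_uIcc right_mem_uIcc
  rw [Real.norm_eq_abs, abs_sub_comm] at this
  refine this.trans (le_of_eq (by ring))

lemma exists_commKernel_size (hqa : ∀ r, ∫ z, q z * a (r - z) = a r) :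
    ∃ C : ℝ, 0 < C ∧ ∀ σ Φ X, IsNearId σ Φ X → ∀ w y,
      ‖commKernel a q Φ X 0 w y‖ ≤ C * σ / (1 + |w - y|) ^ 3 := by
  obtain ⟨C, hC, hCa⟩ := norm_schwartz_sub_le a
  obtain ⟨D, hD, hDq⟩ := schwartz_decay q 6
  refine ⟨C * (8 * D) * (decayConst + 1), by have := decayConst_nonneg; positivity,
    fun σ Φ X h w y => ?_⟩
  have hσ := h.nonneg
  have hdc := decayConst_nonneg
  rw [commKernel_eq_integral a q hqa h]
  have point : ∀ z, ‖q z * (a (w - y - z) - a (Φ (X w - z) - y))‖ ≤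
      (C * (8 * D) * σ / (1 + |w - y|) ^ 3) * ((1 + |z|) ^ 2)⁻¹ := by
    intro z
    have e1 : |Φ (X w - z) - y - (w - y - z)| ≤ σ * |z| := by
      have := h.near (X w - z) (X w)
      rw [h.right_inv] at this
      rw [show X w - z - X w = -z by ring, abs_neg] at this
      rwa [show Φ (X w - z) - y - (w - y - z) = Φ (X w - z) - w - -z by ring]
    have e2 : |Φ (X w - z) - y - (w - y - z)| ≤ |z| :=
      e1.trans (by nlinarith [abs_nonneg z, h.le])
    rw [norm_mul]
    calc ‖q z‖ * ‖a (w - y - z) - a (Φ (X w - z) - y)‖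
        ≤ D / (1 + |z|) ^ 6 * (C * (σ * (1 + |z|)) * (2 * (1 + |z|)) ^ 3 / (1 + |w - y|) ^ 3) := by
          gcongr
          · exact hDq z
          · refine (hCa _ _ _ e2).trans ?_
            gcongr
            · exact e1.trans (by gcongr; linarith)
            · linarith
      _ = _ := by field_simp; ring
  refine (norm_integral_le_of_norm_le (integrable_inv_one_add_abs_sq.const_mul _)
    (ae_of_all _ point)).trans ?_
  rw [integral_const_mul, ← decayConst]
  calc C * (8 * D) * σ / (1 + |w - y|) ^ 3 * decayConst
      = C * (8 * D) * decayConst * σ / (1 + |w - y|) ^ 3 := by ring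
    _ ≤ _ := by gcongr; linarith

lemma exists_commKernel_lipschitz_left :
    ∃ D : ℝ, 0 ≤ D ∧ ∀ σ Φ X, IsNearId σ Φ X → ∀ w w',
      ∫⁻ y, ‖commKernel a q Φ X 0 w y - commKernel a q Φ X 0 w' y‖ₑ ≤
        ENNReal.ofReal (D * |w - w'|) := by
  set a' := SchwartzMap.derivCLM ℝ ℂ a
  set q' := SchwartzMap.derivCLM ℝ ℂ q
  set N : 𝓢(ℝ, ℂ) → ℝ := fun f => ∫ x, ‖f x‖
  have hN : ∀ f : 𝓢(ℝ, ℂ), ∫⁻ x, ‖f x‖ₑ = ENNReal.ofReal (N f) := fun f =>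
    (ofReal_integral_norm_eq_lintegral_enorm f.integrable).symm
  have hN0 : ∀ f, 0 ≤ N f := fun f => integral_nonneg fun x => norm_nonneg _
  have hNa := hN0 a
  have hNa' := hN0 a'
  have hNq' := hN0 q'
  refine ⟨N a' + 2 * N q' * N a, by positivity, fun σ Φ X h w w' => ?_⟩
  have hΦ := h.continuous
  obtain ⟨C, hC⟩ := schwartz_bounded a
  have i1 : ∀ w y, Integrable fun u => q (X w - u) * a (Φ u - y) := fun w y =>
    (q.integrable.comp_sub_left (X w)).mul_bdd
      (a.continuous.comp (by fun_prop)).aestronglyMeasurable (ae_of_all _ fun u => hC _)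
  have point : ∀ y, ‖commKernel a q Φ X 0 w y - commKernel a q Φ X 0 w' y‖ₑ ≤
      ‖a (w - y) - a (w' - y)‖ₑ +
        ∫⁻ u, ‖q (X w - u) - q (X w' - u)‖ₑ * ‖a (Φ u - y)‖ₑ := by
    intro y
    simp only [commKernel, dil_zero]
    rw [sub_sub_sub_comm, ← integral_sub (i1 w y) (i1 w' y)]
    refine enorm_sub_le.trans ?_
    gcongr
    refine (enorm_integral_le_lintegral_enorm _).trans (le_of_eq (lintegral_congr fun u => ?_))
    rw [← sub_mul, enorm_mul]
  have t1 : ∫⁻ y, ‖a (w - y) - a (w' - y)‖ₑ ≤ ENNReal.ofReal (N a' * |w - w'|) := by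
    have := lintegral_translate_sub_le (schwartz_hasDerivAt a) a'.continuous (-w) (-w')
    rw [hN a'] at this
    have e := lintegral_neg_eq_self (μ := volume) fun y => ‖a (w + y) - a (w' + y)‖ₑ
    calc ∫⁻ y, ‖a (w - y) - a (w' - y)‖ₑ = ∫⁻ y, ‖a (w + y) - a (w' + y)‖ₑ := by
          rw [← e]; rfl
      _ = ∫⁻ y, ‖a (y - -w) - a (y - -w')‖ₑ := by
          refine lintegral_congr fun y => ?_
          rw [sub_neg_eq_add, sub_neg_eq_add, add_comm, add_comm w']
      _ ≤ _ := this
      _ = _ := by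
          rw [← ENNReal.ofReal_mul (by positivity), mul_comm, neg_sub_neg, abs_sub_comm]
  have t2 : ∫⁻ u, ‖q (X w - u) - q (X w' - u)‖ₑ ≤ ENNReal.ofReal (2 * N q' * |w - w'|) := by
    have := lintegral_translate_sub_le (schwartz_hasDerivAt q) q'.continuous (-X w) (-X w')
    rw [hN q'] at this
    have e := lintegral_neg_eq_self (μ := volume) fun y => ‖q (X w + y) - q (X w' + y)‖ₑ
    calc ∫⁻ y, ‖q (X w - y) - q (X w' - y)‖ₑ = ∫⁻ y, ‖q (X w + y) - q (X w' + y)‖ₑ := by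
          rw [← e]; rfl
      _ = ∫⁻ y, ‖q (y - -X w) - q (y - -X w')‖ₑ := by
          refine lintegral_congr fun y => ?_
          rw [sub_neg_eq_add, sub_neg_eq_add, add_comm, add_comm (X w')]
      _ ≤ _ := this
      _ ≤ _ := by
          rw [← ENNReal.ofReal_mul (by positivity), neg_sub_neg, abs_sub_comm]
          refine ENNReal.ofReal_le_ofReal ?_
          have := h.antilipschitz w w'
          have h2 := h.inv_le
          have : |X w - X w'| ≤ 2 * |w - w'| := this.trans (by
            gcongr; linarith [h.le])
          calc _ ≤ 2 * |w - w'| * N q' := by gcongr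
            _ = _ := by ring
  have m2 : Measurable (Function.uncurry fun y u =>
      ‖q (X w - u) - q (X w' - u)‖ₑ * ‖a (Φ u - y)‖ₑ) := by
    simp only [Function.uncurry_def]
    have c1 : Continuous fun p : ℝ × ℝ => q (X w - p.2) - q (X w' - p.2) :=
      (q.continuous.comp (by fun_prop)).sub (q.continuous.comp (by fun_prop))
    have c2 : Continuous fun p : ℝ × ℝ => a (Φ p.2 - p.1) := a.continuous.comp (by fun_prop)
    exact c1.measurable.enorm.mul c2.measurable.enorm
  have m1 : Measurable fun y => ‖a (w - y) - a (w' - y)‖ₑ :=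
    ((a.continuous.comp (by fun_prop)).sub (a.continuous.comp (by fun_prop))).measurable.enorm
  calc _ ≤ ∫⁻ y, (‖a (w - y) - a (w' - y)‖ₑ +
        ∫⁻ u, ‖q (X w - u) - q (X w' - u)‖ₑ * ‖a (Φ u - y)‖ₑ) := lintegral_mono point
    _ = (∫⁻ y, ‖a (w - y) - a (w' - y)‖ₑ) +
        ∫⁻ u, ∫⁻ y, ‖q (X w - u) - q (X w' - u)‖ₑ * ‖a (Φ u - y)‖ₑ := by
        rw [lintegral_add_left m1, lintegral_lintegral_swap m2.aemeasurable]
    _ = (∫⁻ y, ‖a (w - y) - a (w' - y)‖ₑ) +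
        (∫⁻ u, ‖q (X w - u) - q (X w' - u)‖ₑ) * ENNReal.ofReal (N a) := by
        congr 1
        rw [← lintegral_mul_const' _ _ ENNReal.ofReal_ne_top]
        refine lintegral_congr fun u => ?_
        rw [lintegral_const_mul' _ _ (by simp), lintegral_sub_left_eq_self (fun y => ‖a y‖ₑ), hN a]
    _ ≤ ENNReal.ofReal (N a' * |w - w'|) +
        ENNReal.ofReal (2 * N q' * |w - w'|) * ENNReal.ofReal (N a) := by gcongr
    _ = _ := by
        rw [← ENNReal.ofReal_mul (by positivity), ← ENNReal.ofReal_add (by positivity)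
          (by positivity)]
        congr 1; ring

lemma exists_commKernel_lipschitz_right :
    ∃ D : ℝ, 0 ≤ D ∧ ∀ σ Φ X, IsNearId σ Φ X → ∀ y y',
      ∫⁻ w, ‖commKernel a q Φ X 0 w y - commKernel a q Φ X 0 w y'‖ₑ ≤
        ENNReal.ofReal (D * |y - y'|) := by
  set a' := SchwartzMap.derivCLM ℝ ℂ a
  set N : 𝓢(ℝ, ℂ) → ℝ := fun f => ∫ x, ‖f x‖
  have hN : ∀ f : 𝓢(ℝ, ℂ), ∫⁻ x, ‖f x‖ₑ = ENNReal.ofReal (N f) := fun f =>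
    (ofReal_integral_norm_eq_lintegral_enorm f.integrable).symm
  have hN0 : ∀ f, 0 ≤ N f := fun f => integral_nonneg fun x => norm_nonneg _
  have hNq := hN0 q
  have hNa' := hN0 a'
  refine ⟨N a' + 4 * N q * N a', by positivity, fun σ Φ X h y y' => ?_⟩
  have hΦ := h.continuous
  have hX := h.continuous_inv
  obtain ⟨C, hC⟩ := schwartz_bounded a
  have i1 : ∀ w y, Integrable fun u => q (X w - u) * a (Φ u - y) := fun w y =>
    (q.integrable.comp_sub_left (X w)).mul_bdd
      (a.continuous.comp (by fun_prop)).aestronglyMeasurable (ae_of_all _ fun u => hC _)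
  have point : ∀ w, ‖commKernel a q Φ X 0 w y - commKernel a q Φ X 0 w y'‖ₑ ≤
      ‖a (w - y) - a (w - y')‖ₑ +
        ∫⁻ u, ‖q (X w - u)‖ₑ * ‖a (Φ u - y) - a (Φ u - y')‖ₑ := by
    intro w
    simp only [commKernel, dil_zero]
    rw [sub_sub_sub_comm, ← integral_sub (i1 w y) (i1 w y')]
    refine enorm_sub_le.trans ?_
    gcongr
    refine (enorm_integral_le_lintegral_enorm _).trans (le_of_eq (lintegral_congr fun u => ?_))
    rw [← mul_sub, enorm_mul]
  have t1 : ∫⁻ w, ‖a (w - y) - a (w - y')‖ₑ ≤ ENNReal.ofReal (N a' * |y - y'|) := by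
    have := lintegral_translate_sub_le (schwartz_hasDerivAt a) a'.continuous y y'
    rwa [hN a', ← ENNReal.ofReal_mul (by positivity), mul_comm] at this
  have mA : Measurable fun w => ‖a (w - y) - a (w - y')‖ₑ :=
    ((a.continuous.comp (by fun_prop)).sub (a.continuous.comp (by fun_prop))).measurable.enorm
  have t2 : ∫⁻ u, ‖a (Φ u - y) - a (Φ u - y')‖ₑ ≤ 2 * ENNReal.ofReal (N a' * |y - y'|) :=
    (h.lintegral_comp_le mA).trans (by gcongr)
  have m2 : Measurable (Function.uncurry fun w u =>
      ‖q (X w - u)‖ₑ * ‖a (Φ u - y) - a (Φ u - y')‖ₑ) := by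
    simp only [Function.uncurry_def]
    have c1 : Continuous fun p : ℝ × ℝ => q (X p.1 - p.2) := q.continuous.comp (by fun_prop)
    have c2 : Continuous fun p : ℝ × ℝ => a (Φ p.2 - y) - a (Φ p.2 - y') :=
      (a.continuous.comp (by fun_prop)).sub (a.continuous.comp (by fun_prop))
    exact c1.measurable.enorm.mul c2.measurable.enorm
  have t3 : ∀ u, ∫⁻ w, ‖q (X w - u)‖ₑ ≤ 2 * ENNReal.ofReal (N q) := fun u => by
    have mq : Measurable fun x => ‖q (x - u)‖ₑ :=
      (q.continuous.comp (by fun_prop)).measurable.enorm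
    refine (h.lintegral_comp_inv_le mq).trans ?_
    rw [lintegral_sub_right_eq_self (fun x => ‖q x‖ₑ), hN q]
  calc _ ≤ ∫⁻ w, (‖a (w - y) - a (w - y')‖ₑ +
        ∫⁻ u, ‖q (X w - u)‖ₑ * ‖a (Φ u - y) - a (Φ u - y')‖ₑ) := lintegral_mono point
    _ = (∫⁻ w, ‖a (w - y) - a (w - y')‖ₑ) +
        ∫⁻ u, ∫⁻ w, ‖q (X w - u)‖ₑ * ‖a (Φ u - y) - a (Φ u - y')‖ₑ := by
        rw [lintegral_add_left mA, lintegral_lintegral_swap m2.aemeasurable]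
    _ ≤ (∫⁻ w, ‖a (w - y) - a (w - y')‖ₑ) +
        ∫⁻ u, 2 * ENNReal.ofReal (N q) * ‖a (Φ u - y) - a (Φ u - y')‖ₑ := by
        gcongr with u
        rw [lintegral_mul_const' _ _ (by simp)]
        gcongr
        exact t3 u
    _ ≤ ENNReal.ofReal (N a' * |y - y'|) +
        2 * ENNReal.ofReal (N q) * (2 * ENNReal.ofReal (N a' * |y - y'|)) := by
        rw [lintegral_const_mul' _ _ (by finiteness)]
        gcongr
    _ = _ := by
        rw [show (2 : ℝ≥0∞) = ENNReal.ofReal 2 by simp, ← ENNReal.ofReal_mul (by positivity),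
          ← ENNReal.ofReal_mul (by positivity), ← ENNReal.ofReal_mul (by positivity),
          ← ENNReal.ofReal_add (by positivity) (by positivity)]
        congr 1; ring

end Bounds

lemma IsScaleKernel.mono {A A' : ℝ≥0} {k : ℤ} {M : ℝ → ℝ → ℂ} (h : IsScaleKernel A k M)
    (hle : A ≤ A') : IsScaleKernel A' k M := by
  have hle' : (A : ℝ≥0∞) ≤ A' := by exact_mod_cast hle
  exact ⟨⟨h.meas, fun y => (h.row y).trans hle', fun x => (h.col x).trans hle'⟩,
    fun y => (h.moment y).trans hle', fun x x' => (h.holder x x').trans (by gcongr)⟩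

/-- The kernels `commKernel` are small scale kernels in both variables. -/
theorem exists_commKernel_isScaleKernel (a q : 𝓢(ℝ, ℂ))
    (hqa : ∀ r, ∫ z, q z * a (r - z) = a r) :
    ∃ A : ℝ≥0, 0 < A ∧ ∀ (σ : ℝ) (Φ X : ℝ → ℝ), IsNearId σ Φ X → ∀ k : ℤ,
      IsScaleKernel (A * (√σ).toNNReal) k (commKernel a q Φ X k) ∧
      IsScaleKernel (A * (√σ).toNNReal) k (fun y w => commKernel a q Φ X k w y) := by
  obtain ⟨C, hC, hsize⟩ := exists_commKernel_size a q hqa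
  obtain ⟨D, hD, hleft⟩ := exists_commKernel_lipschitz_left a q
  obtain ⟨D', hD', hright⟩ := exists_commKernel_lipschitz_right a q
  have hdc := decayConst_nonneg
  set A₁ : ℝ := C * decayConst + √(2 * C * decayConst) * √D
  set A₂ : ℝ := C * decayConst + √(2 * C * decayConst) * √D'
  have hA₁ : 0 ≤ A₁ := by positivity
  have hA₂ : 0 ≤ A₂ := by positivity
  refine ⟨(A₁ + A₂ + 1).toNNReal, Real.toNNReal_pos.2 (by positivity), fun σ Φ X h k => ?_⟩
  have hσ := h.nonneg
  have hσ1 : σ ≤ 1 := by linarith [h.le]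
  have hle : ∀ A' : ℝ, 0 ≤ A' → A' ≤ A₁ + A₂ + 1 →
      (A' * √σ).toNNReal ≤ (A₁ + A₂ + 1).toNNReal * (√σ).toNNReal := fun A' h0 h1 => by
    rw [Real.toNNReal_mul h0]
    gcongr
  obtain ⟨Φ', hΦ'⟩ : ∃ Φ' : ℝ → ℝ, Φ' = fun x => (2 : ℝ) ^ k * Φ (((2 : ℝ) ^ k)⁻¹ * x) := ⟨_, rfl⟩
  obtain ⟨X', hX'⟩ : ∃ X' : ℝ → ℝ, X' = fun x => (2 : ℝ) ^ k * X (((2 : ℝ) ^ k)⁻¹ * x) := ⟨_, rfl⟩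
  have hh : IsNearId σ Φ' X' := by
    rw [hΦ', hX']
    exact h.dilate (by positivity)
  have hm := measurable_commKernel a q hh
  have e : ∀ w y, commKernel a q Φ X k w y = (((2 : ℝ) ^ k : ℝ) : ℂ) *
      commKernel a q Φ' X' 0 ((2 : ℝ) ^ k * w) ((2 : ℝ) ^ k * y) := fun w y => by
    rw [hΦ', hX']
    exact commKernel_eq_dilate a q Φ X k w y
  constructor
  · have s1 := isScaleKernel_of_decay (M := commKernel a q Φ' X' 0) hm hC.le hD' hσ hσ1
      (hsize σ Φ' X' hh) (hright σ Φ' X' hh)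
    have e1 : commKernel a q Φ X k = fun w y => (((2 : ℝ) ^ k : ℝ) : ℂ) *
      commKernel a q Φ' X' 0 ((2 : ℝ) ^ k * w) ((2 : ℝ) ^ k * y) := funext₂ e
    rw [e1]
    exact (s1.mono (hle A₂ hA₂ (by linarith))).dilate k
  · have hsz : ∀ y w, ‖commKernel a q Φ' X' 0 w y‖ ≤ C * σ / (1 + |y - w|) ^ 3 := fun y w => by
      rw [abs_sub_comm]
      exact hsize σ Φ' X' hh w y
    have hms : Measurable (Function.uncurry fun y w => commKernel a q Φ' X' 0 w y) := by
      have := hm.comp measurable_swap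
      simpa only [Function.comp_def, Function.uncurry_def, Prod.fst_swap, Prod.snd_swap] using this
    have s2 := isScaleKernel_of_decay (M := fun y w => commKernel a q Φ' X' 0 w y)
      hms hC.le hD hσ hσ1 hsz (hleft σ Φ' X' hh)
    have e2 : (fun y w => commKernel a q Φ X k w y) = fun y w => (((2 : ℝ) ^ k : ℝ) : ℂ) *
      commKernel a q Φ' X' 0 ((2 : ℝ) ^ k * w) ((2 : ℝ) ^ k * y) := funext₂ fun y w => e w y
    have s3 := IsScaleKernel.dilate (M := fun y w => commKernel a q Φ' X' 0 w y)
      (s2.mono (hle A₁ hA₁ (by linarith))) k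
    rw [e2]
    exact s3

lemma continuous_dil (k : ℤ) {a : ℝ → ℂ} (ha : Continuous a) : Continuous (dil k a) := by
  unfold dil
  fun_prop

lemma integral_dil (k : ℤ) (a : ℝ → ℂ) : ∫ r, dil k a r = ∫ r, a r := by
  have hp : (0 : ℝ) < 2 ^ k := by positivity
  simp only [dil]
  rw [integral_const_mul, Measure.integral_comp_mul_left a, abs_of_pos (by positivity),
    Complex.real_smul, ← mul_assoc, ← Complex.ofReal_mul, mul_inv_cancel₀ hp.ne']
  simp

lemma isTame_dil (k : ℤ) (a : 𝓢(ℝ, ℂ)) : IsTame (dil k a) := by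
  obtain ⟨C, hC⟩ := schwartz_bounded a
  have hp : (0 : ℝ) < 2 ^ k := by positivity
  refine ⟨(continuous_dil k a.continuous).measurable, ?_, (2 : ℝ) ^ k * C, fun r => ?_⟩
  · exact (a.integrable.comp_mul_left' hp.ne').const_mul _
  · rw [dil, norm_mul, Complex.norm_real, Real.norm_of_nonneg hp.le]
    gcongr
    exact hC _

lemma integral_dil_mul_dil {a q : ℝ → ℂ} (hqa : ∀ r, ∫ z, q z * a (r - z) = a r) (k : ℤ) (r : ℝ) :
    ∫ z, dil k q z * dil k a (r - z) = dil k a r := by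
  have hp : (0 : ℝ) < 2 ^ k := by positivity
  have e := integral_dil k fun z => q z * a ((2 : ℝ) ^ k * r - z)
  rw [hqa] at e
  simp only [dil] at e ⊢
  rw [← e, ← integral_const_mul]
  congr 1
  ext z
  rw [mul_sub]
  ring

/-- Convolution with `a` at scale `2 ^ (-k)`, as an integral operator. -/
noncomputable def convAt (k : ℤ) (a : ℝ → ℂ) : (ℝ → ℂ) → ℝ → ℂ :=
  kernelOp fun y x => dil k a (y - x)

section Factor

variable {a q : 𝓢(ℝ, ℂ)} {f : ℝ → ℂ} {σ : ℝ} {Φ X : ℝ → ℝ}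

lemma isTame_convAt (k : ℤ) (a : 𝓢(ℝ, ℂ)) (hf : IsTame f) : IsTame (convAt k a f) := by
  obtain ⟨A, -, hA⟩ := exists_isScaleKernel_conv a
  exact (hA k).kernelOp_tame hf

lemma convAt_convAt (hqa : ∀ r, ∫ z, q z * a (r - z) = a r) (k : ℤ) (hf : IsTame f) (w : ℝ) :
    convAt k a (convAt k q f) w = convAt k a f w := by
  obtain ⟨A, -, hA⟩ := exists_isScaleKernel_conv q
  obtain ⟨C, hC⟩ := (isTame_dil k a).bdd
  have hi := (hA k).integrable_prod hf (g := fun y => dil k a (w - y))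
    ((continuous_dil k a.continuous).measurable.comp (by fun_prop)) (fun x => hC _)
  calc convAt k a (convAt k q f) w
      = ∫ y, ∫ x, dil k q (y - x) * f x * dil k a (w - y) := by
        simp only [convAt, kernelOp, ← integral_const_mul]
        congr! 4
        ring
    _ = ∫ x, ∫ y, dil k q (y - x) * f x * dil k a (w - y) := integral_integral_swap hi
    _ = ∫ x, dil k a (w - x) * f x := by
        congr 1
        ext x
        rw [← integral_dil_mul_dil hqa k (w - x), ← integral_mul_const,
          ← integral_sub_right_eq_self (fun z => dil k q z * dil k a (w - x - z) * f x) x]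
        congr 1
        ext y
        rw [show w - x - (y - x) = w - y by ring]
        ring

lemma kernelOp_commKernel (h : IsNearId σ Φ X) (k : ℤ) (hf : IsTame f) (w : ℝ) :
    kernelOp (commKernel a q Φ X k) f w =
      convAt k a f w - ∫ u, dil k q (X w - u) * convAt k a f (Φ u) := by
  obtain ⟨C, hC⟩ := (isTame_dil k a).bdd
  obtain ⟨A, -, hA⟩ := exists_isScaleKernel_conv a
  have hΦ := h.continuous
  have ca := continuous_dil k a.continuous
  obtain ⟨N, hN⟩ := hf.bdd
  have i0 : Integrable (Function.uncurry fun y u => f y * dil k q (X w - u))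
      (volume.prod volume) :=
    hf.integrable.mul_prod ((isTame_dil k q).integrable.comp_sub_left (X w))
  have i1 : Integrable (Function.uncurry fun y u =>
      f y * dil k q (X w - u) * dil k a (Φ u - y)) (volume.prod volume) := by
    refine i0.mul_bdd (c := C) ?_ (ae_of_all _ fun p => hC _)
    have : Continuous fun p : ℝ × ℝ => dil k a (Φ p.2 - p.1) := ca.comp (by fun_prop)
    exact this.aestronglyMeasurable
  have i2 : Integrable fun y => dil k a (w - y) * f y := (hA k).integrable_row_mul w hf.meas hN
  have i3 : Integrable fun y => (∫ u, dil k q (X w - u) * dil k a (Φ u - y)) * f y := by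
    have := i1.integral_prod_left
    refine this.congr (ae_of_all _ fun y => ?_)
    simp only [Function.uncurry]
    rw [← integral_mul_const]
    congr 1; ext u; ring
  simp only [kernelOp, commKernel, convAt, sub_mul]
  rw [integral_sub i2 i3]
  congr 1
  calc ∫ y, (∫ u, dil k q (X w - u) * dil k a (Φ u - y)) * f y
      = ∫ y, ∫ u, f y * dil k q (X w - u) * dil k a (Φ u - y) := by
        simp only [← integral_mul_const]
        congr! 4
        ring
    _ = ∫ u, ∫ y, f y * dil k q (X w - u) * dil k a (Φ u - y) := integral_integral_swap i1
    _ = _ := by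
        simp only [← integral_const_mul]
        congr! 4
        ring

lemma kernelOp_commKernel_convAt (hqa : ∀ r, ∫ z, q z * a (r - z) = a r) (h : IsNearId σ Φ X)
    (k : ℤ) (hf : IsTame f) :
    kernelOp (commKernel a q Φ X k) (convAt k q f) = kernelOp (commKernel a q Φ X k) f := by
  ext w
  rw [kernelOp_commKernel h k hf, kernelOp_commKernel h k (isTame_convAt k q hf)]
  simp only [convAt_convAt hqa k hf]

lemma integral_density {m : ℝ → ℝ} (h : IsNearId σ Φ X) (hm : Measurable m) (hm0 : ∀ x, 0 ≤ m x)
    (hmap : Measure.map Φ volume = volume.withDensity fun x => ENNReal.ofReal (m x))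
    {g : ℝ → ℂ} (hg : Measurable g) : ∫ w, g w * m w = ∫ x, g (Φ x) := by
  rw [← integral_map (φ := Φ) h.continuous.aemeasurable hg.aestronglyMeasurable, hmap,
    integral_withDensity_eq_integral_toReal_smul (by fun_prop) (by simp)]
  congr 1
  ext w
  rw [ENNReal.toReal_ofReal (hm0 w), Complex.real_smul, mul_comm]

lemma integral_commKernel_density (ha0 : ∫ r, a r = 0) (hq0 : ∫ r, q r = 0)
    (hqa : ∀ r, ∫ z, q z * a (r - z) = a r)
    {m : ℝ → ℝ} (h : IsNearId σ Φ X) (hm : Measurable m) (hm1 : ∀ x, |m x - 1| ≤ 2 * σ)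
    (hmap : Measure.map Φ volume = volume.withDensity fun x => ENNReal.ofReal (m x))
    (k : ℤ) (y : ℝ) : ∫ w, commKernel a q Φ X k w y * m w =
      ∫ w, dil k a (w - y) * ((m w - 1 : ℝ) : ℂ) := by
  have hσ := h.nonneg
  have hm0 : ∀ x, 0 ≤ m x := fun x => by
    have := abs_le.1 (hm1 x); linarith [h.le]
  obtain ⟨A, -, hA⟩ := exists_commKernel_isScaleKernel a q hqa
  have hmK : Measurable fun w => commKernel a q Φ X k w y := (hA σ Φ X h k).1.meas_col y
  rw [integral_density h hm hm0 hmap hmK]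
  have ta := isTame_dil k a
  have ca := continuous_dil k a.continuous
  have hΦ := h.continuous
  set b : ℝ → ℂ := fun u => dil k a (Φ u - y) with hb
  have hbm : Measurable b := (ca.comp (by fun_prop)).measurable
  have tb : IsTame b := by
    obtain ⟨C, hC⟩ := ta.bdd
    refine ⟨hbm, ⟨hbm.aestronglyMeasurable, ?_⟩, C, fun u => hC _⟩
    have mm : Measurable fun x => ‖dil k a (x - y)‖ₑ :=
      (ca.comp (by fun_prop)).measurable.enorm
    refine (h.lintegral_comp_le mm).trans_lt ?_
    rw [lintegral_sub_right_eq_self (fun x => ‖dil k a x‖ₑ)]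
    exact ENNReal.mul_lt_top (by simp) ta.lintegral_lt_top
  obtain ⟨B, -, hB⟩ := exists_isScaleKernel_conv q
  have tqb : IsTame (convAt k q b) := isTame_convAt k q tb
  have e1 : ∀ x, commKernel a q Φ X k (Φ x) y = b x - convAt k q b x := fun x => by
    simp only [commKernel, h.left_inv, convAt, kernelOp, hb]
  simp only [e1]
  rw [integral_sub tb.integrable tqb.integrable]
  have e2 : ∫ x, convAt k q b x = 0 := by
    have hi := (hB k).integrable_prod tb (g := fun _ => 1) measurable_const (N := 1) (by simp)
    simp only [mul_one] at hi
    simp only [convAt, kernelOp]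
    rw [integral_integral_swap hi]
    have : ∀ u, ∫ x, dil k q (x - u) * b u = 0 := fun u => by
      rw [integral_mul_const, integral_sub_right_eq_self (dil k q), integral_dil, hq0, zero_mul]
    simp [this]
  have mdil : Measurable fun w => dil k a (w - y) := (ca.comp (by fun_prop)).measurable
  have e3 := integral_density h hm hm0 hmap mdil
  have i1 : Integrable fun w => dil k a (w - y) := ta.integrable.comp_sub_right y
  have i2 : Integrable fun w => dil k a (w - y) * m w :=
    i1.mul_bdd (c := 1 + 2 * σ) (by fun_prop) (ae_of_all _ fun w => by
      rw [Complex.norm_real, Real.norm_of_nonneg (hm0 w)]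
      linarith [(abs_le.1 (hm1 w)).2])
  rw [e2, sub_zero, hb, ← e3]
  simp only [Complex.ofReal_sub, Complex.ofReal_one, mul_sub, mul_one]
  rw [integral_sub i2 i1, integral_sub_right_eq_self (dil k a), integral_dil, ha0, sub_zero]

end Factor

lemma dil_comp_neg (a : 𝓢(ℝ, ℂ)) :
    ∃ a' : 𝓢(ℝ, ℂ), ∀ k r, dil k a' r = dil k a (-r) := by
  refine ⟨SchwartzMap.compCLMOfContinuousLinearEquiv ℝ (ContinuousLinearEquiv.neg ℝ) a,
    fun k r => ?_⟩
  simp [dil]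

/-- The `L²` bound for the sum of the `commKernel` operators, with a gain in `σ`. -/
theorem exists_commKernel_L2 (a q : 𝓢(ℝ, ℂ)) (ha0 : ∫ r, a r = 0) (hq0 : ∫ r, q r = 0)
    (hqa : ∀ r, ∫ z, q z * a (r - z) = a r) :
    ∃ C : ℝ, 0 < C ∧ ∀ (σ : ℝ) (Φ X : ℝ → ℝ), IsNearId σ Φ X → 0 < σ → ∀ f : ℝ → ℂ, IsTame f →
      ∀ F : Finset ℤ, ∫ w, ‖∑ k ∈ F, kernelOp (commKernel a q Φ X k) f w‖ ^ 2 ≤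
        C * σ * ∫ x, ‖f x‖ ^ 2 := by
  obtain ⟨B, E, hE⟩ := exists_isAveraging
  obtain ⟨A₀, hA₀, hK⟩ := exists_commKernel_isScaleKernel a q hqa
  obtain ⟨a', ha'⟩ := dil_comp_neg a
  obtain ⟨A₁, hA₁, hP⟩ := exists_isScaleKernel_conv a'
  obtain ⟨A₂, hA₂, hQ⟩ := exists_isScaleKernel_conv q
  set C₁ : ℝ := 16 * geomConst * A₂ ^ 2 with hC₁
  set C₂ : ℝ := 32 * geomConst * (1 + 4 * B) ^ 2 * A₀ ^ 2 + 512 * carlesonConst A₁ B with hC₂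
  have hg := geomConst_pos
  have hcc := carlesonConst_nonneg A₁ B
  have hC₁p : 0 < C₁ := by positivity
  have hC₂p : 0 < C₂ := by positivity
  refine ⟨4 * C₁ * C₂, by positivity, fun σ Φ X h hσ f hf F => ?_⟩
  obtain ⟨m, hm, hm1, hmap⟩ := h.exists_density
  have hσ4 := h.le
  have hmlo : ∀ x, 1 / 2 ≤ m x := fun x => by have := abs_le.1 (hm1 x); linarith
  have hmhi : ∀ x, m x ≤ 2 := fun x => by have := abs_le.1 (hm1 x); linarith
  have hmc : Measurable fun x => (m x : ℂ) := by fun_prop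
  have hmc2 : ∀ x, ‖(m x : ℂ)‖ ≤ 2 := fun x => by
    simpa [abs_of_nonneg (by linarith [hmlo x] : 0 ≤ m x)] using hmhi x
  have hsq : 0 < √σ := Real.sqrt_pos.2 hσ
  set K : ℤ → ℝ → ℝ → ℂ := commKernel a q Φ X with hKdef
  have hKs : ∀ k, IsSchurKernel (A₀ * (√σ).toNNReal) (K k) := fun k =>
    (hK σ Φ X h k).1.toIsSchurKernel
  set g : ℝ → ℂ := fun w => ∑ k ∈ F, kernelOp (K k) f w with hgdef
  have tg : IsTame g := IsTame.sum F fun k _ => (hKs k).kernelOp_tame hf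
  set hh : ℝ → ℂ := fun w => (starRingEnd ℂ) (g w) with hhdef
  have th : IsTame hh := tg.conj
  have thm := th.mul_bdd hmc hmc2
  set fk : ℤ → ℝ → ℂ := fun k => convAt k q f with hfk
  have tfk : ∀ k, IsTame (fk k) := fun k => isTame_convAt k q hf
  set θ : ℤ → ℝ → ℂ := fun k => kernelOp (fun y w => K k w y) (fun w => hh w * m w) with hθ
  have tθ : ∀ k, IsTame (θ k) := fun k => (hKs k).flip.kernelOp_tame thm
  have b1 : ∑ k ∈ F, ∫ y, ‖fk k y‖ ^ 2 ≤ C₁ * ∫ x, ‖f x‖ ^ 2 := by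
    have := IsScaleKernel.square_function_le hA₂ hQ (m := fun _ => 1) measurable_const
      (fun _ => zero_le_one) (fun _ => one_le_two) (fun k y => by
        simp only [Complex.ofReal_one, mul_one]
        rw [integral_sub_left_eq_self (dil k q), integral_dil, hq0]) hf F
    simp only [Complex.ofReal_one, mul_one] at this
    exact this
  have b2 : ∑ k ∈ F, ∫ y, ‖θ k y‖ ^ 2 ≤ C₂ * σ * ∫ x, ‖hh x‖ ^ 2 := by
    have := hE.square_function_le (A := A₀ * (√σ).toNNReal)
      (mul_pos hA₀ (Real.toNNReal_pos.2 hsq)) hA₁ (P := fun k y x => dil k a' (y - x)) hP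
      (fun k y => by
        rw [integral_sub_left_eq_self (dil k a')]
        simp only [ha']
        rw [integral_neg_eq_self (dil k a), integral_dil, ha0])
      (M := fun k y w => K k w y) (fun k => (hK σ Φ X h k).2) hm (ε := 2 * σ) (by positivity)
      (by linarith) hm1 (fun k y => by
        simp only [ha', neg_sub]
        exact integral_commKernel_density ha0 hq0 hqa h hm hm1 hmap k y) th F
    refine this.trans ?_
    gcongr
    push_cast
    rw [Real.coe_toNNReal _ hsq.le, mul_pow (A₀ : ℝ), Real.sq_sqrt hσ.le, hC₂]
    have : 128 * carlesonConst A₁ B * (2 * σ) ^ 2 ≤ 512 * carlesonConst A₁ B * σ := by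
      have : (2 * σ) ^ 2 ≤ 4 * σ := by nlinarith
      calc _ ≤ 128 * carlesonConst A₁ B * (4 * σ) := by gcongr
        _ = _ := by ring
    linarith
  set S : ℝ := ∫ w, m w * ‖g w‖ ^ 2 with hS
  have iS : Integrable fun w => m w * ‖g w‖ ^ 2 :=
    tg.integrable_sq.bdd_mul hm.aestronglyMeasurable (c := 2) (ae_of_all _ fun x => by
      simpa using hmc2 x)
  have hgS : ∫ w, ‖g w‖ ^ 2 ≤ 2 * S := by
    rw [hS, ← integral_const_mul]
    refine integral_mono tg.integrable_sq (iS.const_mul 2) fun w => ?_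
    have := hmlo w
    nlinarith [sq_nonneg ‖g w‖]
  have e1 : (S : ℂ) = ∑ k ∈ F, ∫ y, fk k y * θ k y := by
    have p : ∀ w, ((m w * ‖g w‖ ^ 2 : ℝ) : ℂ) =
        ∑ k ∈ F, kernelOp (K k) (fk k) w * (hh w * m w) := fun w => by
      have : ∀ k, kernelOp (K k) (fk k) w = kernelOp (K k) f w := fun k => by
        rw [hfk, hKdef, kernelOp_commKernel_convAt hqa h k hf]
      simp only [this, ← Finset.sum_mul]
      push_cast
      rw [← Complex.mul_conj']
      simp only [hhdef, hgdef]
      ring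
    rw [hS, ← integral_complex_ofReal]
    simp only [p]
    rw [integral_finsetSum _ fun k _ => (((hKs k).kernelOp_tame (tfk k)).mul thm).integrable]
    exact Finset.sum_congr rfl fun k _ => (hKs k).kernelOp_dual (tfk k) thm
  set c : ℝ := 2 * C₂ * σ with hc
  have hcp : 0 < c := by positivity
  have e2 : S ≤ ∑ k ∈ F, (c / 2 * (∫ y, ‖fk k y‖ ^ 2) + (2 * c)⁻¹ * ∫ y, ‖θ k y‖ ^ 2) := by
    calc S ≤ ‖(S : ℂ)‖ := by rw [Complex.norm_real]; exact le_abs_self _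
      _ ≤ ∑ k ∈ F, ‖∫ y, fk k y * θ k y‖ := by rw [e1]; exact norm_sum_le _ _
      _ ≤ _ := by
        refine Finset.sum_le_sum fun k _ => ?_
        rw [← integral_const_mul, ← integral_const_mul, ← integral_add
          ((tfk k).integrable_sq.const_mul _) ((tθ k).integrable_sq.const_mul _)]
        refine norm_integral_le_of_norm_le (((tfk k).integrable_sq.const_mul _).add
          ((tθ k).integrable_sq.const_mul _)) (ae_of_all _ fun y => ?_)
        rw [norm_mul]
        have := sq_nonneg (c * ‖fk k y‖ - ‖θ k y‖)
        have e : c / 2 * ‖fk k y‖ ^ 2 + (2 * c)⁻¹ * ‖θ k y‖ ^ 2 =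
          ((c * ‖fk k y‖) ^ 2 + ‖θ k y‖ ^ 2) / (2 * c) := by field_simp
        rw [e, le_div_iff₀ (by positivity)]
        nlinarith
  have hh2 : ∫ x, ‖hh x‖ ^ 2 ≤ 2 * S := by
    refine le_trans (le_of_eq ?_) hgS
    simp [hhdef]
  have e3 : S ≤ c / 2 * (C₁ * ∫ x, ‖f x‖ ^ 2) + (2 * c)⁻¹ * (C₂ * σ * (2 * S)) := by
    rw [Finset.sum_add_distrib, ← Finset.mul_sum, ← Finset.mul_sum] at e2
    refine e2.trans ?_
    gcongr
    exact b2.trans (by gcongr)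
  have e4 : (2 * c)⁻¹ * (C₂ * σ * (2 * S)) = S / 2 := by rw [hc]; field_simp
  rw [e4] at e3
  calc _ ≤ 2 * S := hgS
    _ ≤ 2 * (2 * (c / 2 * (C₁ * ∫ x, ‖f x‖ ^ 2))) := by linarith
    _ = _ := by rw [hc]; ring

/-- The dyadic interval `[n 2⁻ᵏ, (n + 1) 2⁻ᵏ)`. -/
def dyadic (k n : ℤ) : Set ℝ := {x | ⌊(2 : ℝ) ^ k * x⌋ = n}

lemma dyadic_eq_Ico (k n : ℤ) : dyadic k n =
    Ico ((n + 1 / 2) * ((2 : ℝ) ^ k)⁻¹ - ((2 : ℝ) ^ k)⁻¹ / 2)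
      ((n + 1 / 2) * ((2 : ℝ) ^ k)⁻¹ + ((2 : ℝ) ^ k)⁻¹ / 2) := by
  ext x
  have hp : (0 : ℝ) < 2 ^ k := by positivity
  have e1 : (n + 1 / 2) * ((2 : ℝ) ^ k)⁻¹ - ((2 : ℝ) ^ k)⁻¹ / 2 = n / (2 : ℝ) ^ k := by
    field_simp; ring
  have e2 : (n + 1 / 2) * ((2 : ℝ) ^ k)⁻¹ + ((2 : ℝ) ^ k)⁻¹ / 2 = (n + 1) / (2 : ℝ) ^ k := by
    field_simp; ring
  rw [e1, e2, dyadic, mem_ofPred_eq, Int.floor_eq_iff, mem_Ico, div_le_iff₀ hp, lt_div_iff₀ hp,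
    mul_comm x]

lemma measurableSet_dyadic (k n : ℤ) : MeasurableSet (dyadic k n) := by
  rw [dyadic_eq_Ico]; exact measurableSet_Ico

lemma volume_dyadic (k n : ℤ) : volume (dyadic k n) = ENNReal.ofReal ((2 : ℝ) ^ k)⁻¹ := by
  rw [dyadic_eq_Ico, Real.volume_Ico]
  congr 1; ring

lemma floor_dyadic_eq {j k : ℤ} (hjk : j ≤ k) {x x' : ℝ}
    (h : ⌊(2 : ℝ) ^ k * x⌋ = ⌊(2 : ℝ) ^ k * x'⌋) : ⌊(2 : ℝ) ^ j * x⌋ = ⌊(2 : ℝ) ^ j * x'⌋ := by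
  have key : ∀ x : ℝ, ⌊(2 : ℝ) ^ j * x⌋ = ⌊(2 : ℝ) ^ k * x⌋ / ((2 ^ (k - j).toNat : ℕ) : ℤ) := by
    intro x
    rw [← Int.floor_div_natCast]
    congr 1
    have : (2 : ℝ) ^ k = 2 ^ j * ((2 ^ (k - j).toNat : ℕ) : ℝ) := by
      push_cast
      rw [← zpow_natCast, ← zpow_add₀ (by norm_num), Int.toNat_of_nonneg (by lia)]
      congr 1; ring
    rw [this]
    field_simp
  rw [key, key, h]

/-- Calderón–Zygmund stopping intervals for a nonnegative continuous integrable function. -/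
lemma exists_stopping_intervals {g : ℝ → ℝ} (hg : Continuous g) (hi : Integrable g)
    (h0 : ∀ x, 0 ≤ g x) {l : ℝ} (hl : 0 < l) :
    ∃ (S : Set (ℤ × ℤ)), (S.PairwiseDisjoint fun i => dyadic i.1 i.2) ∧
      (∀ i ∈ S, l * ((2 : ℝ) ^ i.1)⁻¹ < ∫ x in dyadic i.1 i.2, g x) ∧
      (∀ i ∈ S, ∫ x in dyadic i.1 i.2, g x ≤ 2 * l * ((2 : ℝ) ^ i.1)⁻¹) ∧
      ∀ x, (∀ i ∈ S, x ∉ dyadic i.1 i.2) → g x ≤ l := by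
  set A : ℤ → ℝ → ℝ := fun k x => (2 : ℝ) ^ k * ∫ z in dyadic k ⌊(2 : ℝ) ^ k * x⌋, g z with hA
  set S : Set (ℤ × ℤ) := {i | ∃ x, ⌊(2 : ℝ) ^ i.1 * x⌋ = i.2 ∧ l < A i.1 x ∧
    ∀ j < i.1, A j x ≤ l} with hS
  have hAeq : ∀ {j k : ℤ}, j ≤ k → ∀ {x x' : ℝ}, ⌊(2 : ℝ) ^ k * x⌋ = ⌊(2 : ℝ) ^ k * x'⌋ →
      A j x = A j x' := fun hjk x x' h => by simp only [hA, floor_dyadic_eq hjk h]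
  refine ⟨S, ?_, ?_, ?_, ?_⟩
  · rintro ⟨k, n⟩ ⟨x, hx, hx1, hx2⟩ ⟨k', n'⟩ ⟨x', hx', hx1', hx2'⟩ hne
    simp only at hx hx1 hx2 hx' hx1' hx2'
    rw [Function.onFun, Set.disjoint_left]
    intro z hz hz'
    simp only [dyadic, mem_ofPred_eq] at hz hz'
    have hxz : ⌊(2 : ℝ) ^ k * x⌋ = ⌊(2 : ℝ) ^ k * z⌋ := hx.trans hz.symm
    have hxz' : ⌊(2 : ℝ) ^ k' * x'⌋ = ⌊(2 : ℝ) ^ k' * z⌋ := hx'.trans hz'.symm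
    rcases lt_trichotomy k k' with h | h | h
    · have := hx2' k h
      rw [hAeq h.le hxz', ← hAeq le_rfl hxz] at this
      linarith
    · subst h
      exact hne (by rw [← hz, ← hz'])
    · have := hx2 k' h
      rw [hAeq h.le hxz, ← hAeq le_rfl hxz'] at this
      linarith
  · rintro ⟨k, n⟩ ⟨x, hx, hx1, hx2⟩
    simp only [hA] at hx hx1 ⊢
    rw [hx] at hx1
    have hp : (0 : ℝ) < 2 ^ k := by positivity
    rw [← div_eq_mul_inv, div_lt_iff₀ hp]
    linarith
  · rintro ⟨k, n⟩ ⟨x, hx, hx1, hx2⟩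
    simp only at hx hx1 hx2 ⊢
    have h := hx2 (k - 1) (by lia)
    have hp : (0 : ℝ) < 2 ^ k := by positivity
    have hsub : dyadic k n ⊆ dyadic (k - 1) ⌊(2 : ℝ) ^ (k - 1) * x⌋ := fun z hz =>
      floor_dyadic_eq (by lia : k - 1 ≤ k) (hz.trans hx.symm)
    have hmono : ∫ x in dyadic k n, g x ≤ ∫ z in dyadic (k - 1) ⌊(2 : ℝ) ^ (k - 1) * x⌋, g z :=
      setIntegral_mono_set hi.integrableOn (ae_of_all _ h0) hsub.eventuallyLE
    have h2 : (2 : ℝ) ^ (k - 1) = 2 ^ k / 2 := by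
      rw [zpow_sub_one₀ (by norm_num)]; ring
    simp only [hA, h2] at h hmono
    rw [← div_eq_mul_inv, le_div_iff₀ hp]
    nlinarith
  · intro x hx
    have hle : ∀ k, A k x ≤ l := by
      by_contra! hcon
      have hb : ∃ b : ℤ, ∀ k, l < A k x → b ≤ k := by
        have ht : Tendsto (fun n : ℕ => (∫ z, g z) * ((1 / 2 : ℝ)) ^ n) atTop (𝓝 0) := by
          simpa using (tendsto_pow_atTop_nhds_zero_of_lt_one (r := (1 / 2 : ℝ)) (by norm_num)
            (by norm_num)).const_mul (∫ z, g z)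
        obtain ⟨n, hn⟩ := (ht.eventually (gt_mem_nhds hl)).exists
        refine ⟨-n, fun k hk => ?_⟩
        by_contra! hkn
        have h1 : A k x ≤ (2 : ℝ) ^ k * ∫ z, g z := by
          simp only [hA]
          exact mul_le_mul_of_nonneg_left (setIntegral_le_integral hi (ae_of_all _ h0))
            (by positivity)
        have h2 : (2 : ℝ) ^ k ≤ (1 / 2 : ℝ) ^ n := by
          calc (2 : ℝ) ^ k ≤ 2 ^ (-n : ℤ) := zpow_le_zpow_right₀ (by norm_num) hkn.le
            _ = _ := by rw [zpow_neg, zpow_natCast, one_div, inv_pow]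
        have h3 : 0 ≤ ∫ z, g z := integral_nonneg h0
        nlinarith
      obtain ⟨k, hk1, hk2⟩ := Int.exists_least_of_bdd hb hcon
      refine hx (k, ⌊(2 : ℝ) ^ k * x⌋) ⟨x, rfl, hk1, fun j hj => ?_⟩ rfl
      by_contra! h
      exact absurd (hk2 j h) (by lia)
    by_contra! hlt
    obtain ⟨l', hl1, hl2⟩ := exists_between hlt
    obtain ⟨δ, hδ, hball⟩ := Metric.eventually_nhds_iff.1
      (hg.continuousAt.eventually (lt_mem_nhds hl2) : ∀ᶠ z in 𝓝 x, l' < g z)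
    obtain ⟨n, hn⟩ := exists_pow_lt_of_lt_one hδ (by norm_num : (1 / 2 : ℝ) < 1)
    have hp : (0 : ℝ) < 2 ^ (n : ℤ) := by positivity
    have hin : ∀ z ∈ dyadic n ⌊(2 : ℝ) ^ (n : ℤ) * x⌋, l' ≤ g z := by
      intro z hz
      refine (hball ?_).le
      simp only [dyadic, mem_ofPred_eq] at hz
      have h1 := Int.abs_sub_lt_one_of_floor_eq_floor hz
      rw [← mul_sub, abs_mul, abs_of_pos hp] at h1
      rw [Real.dist_eq]
      refine lt_trans ?_ hn
      rw [one_div, inv_pow, ← one_div, lt_div_iff₀' (by positivity), ← zpow_natCast]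
      exact h1
    have h1 : l' * ((2 : ℝ) ^ (n : ℤ))⁻¹ ≤ ∫ z in dyadic n ⌊(2 : ℝ) ^ (n : ℤ) * x⌋, g z := by
      have := setIntegral_mono_on (μ := volume) (f := fun _ => l') (g := g)
        (s := dyadic n ⌊(2 : ℝ) ^ (n : ℤ) * x⌋)
        (integrableOn_const (by rw [volume_dyadic]; exact ENNReal.ofReal_ne_top)) hi.integrableOn
        (measurableSet_dyadic _ _) hin
      rw [setIntegral_const, measureReal_def, volume_dyadic,
        ENNReal.toReal_ofReal (by positivity), smul_eq_mul, mul_comm] at this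
      exact this
    have h2 := hle n
    simp only [hA] at h2
    rw [← div_eq_mul_inv, div_le_iff₀ hp] at h1
    linarith

/-- Hörmander's condition (with constant one) in the input variable. -/
def IsHormander (K : ℝ → ℝ → ℂ) : Prop :=
  ∀ (c r y : ℝ), 0 < r → |y - c| ≤ r →
    ∫⁻ w in {w | 2 * r ≤ |w - c|}, ‖K w y - K w c‖ₑ ≤ 1

/-- The center of a dyadic interval. -/
noncomputable def dyadicCenter (i : ℤ × ℤ) : ℝ := (i.2 + 1 / 2) * ((2 : ℝ) ^ i.1)⁻¹

/-- The half-length of a dyadic interval. -/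
noncomputable def dyadicRadius (i : ℤ × ℤ) : ℝ := ((2 : ℝ) ^ i.1)⁻¹ / 2

lemma dyadicRadius_pos (i : ℤ × ℤ) : 0 < dyadicRadius i := by
  unfold dyadicRadius; positivity

lemma abs_sub_dyadicCenter_le {i : ℤ × ℤ} {y : ℝ} (hy : y ∈ dyadic i.1 i.2) :
    |y - dyadicCenter i| ≤ dyadicRadius i := by
  rw [dyadic_eq_Ico] at hy
  rw [abs_le]
  constructor
  · have := hy.1; simp only [dyadicCenter, dyadicRadius]; linarith
  · have := hy.2; simp only [dyadicCenter, dyadicRadius]; linarith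

section Decomposition

variable {f : ℝ → ℂ} {l : ℝ} {S : Set (ℤ × ℤ)}

open Classical in
/-- The bad part of a function with respect to a family of disjoint dyadic intervals. -/
noncomputable def badPart (f : ℝ → ℂ) (S : Set (ℤ × ℤ)) (x : ℝ) : ℂ :=
  if h : ∃ i : ℤ × ℤ, i ∈ S ∧ x ∈ dyadic i.1 i.2 then
    f x - (((2 : ℝ) ^ h.choose.1 : ℝ) : ℂ) * ∫ z in dyadic h.choose.1 h.choose.2, f z
  else 0

lemma badPart_of_mem (hS : S.PairwiseDisjoint fun i => dyadic i.1 i.2) {i : ℤ × ℤ} (hi : i ∈ S)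
    {x : ℝ} (hx : x ∈ dyadic i.1 i.2) :
    badPart f S x = f x - (((2 : ℝ) ^ i.1 : ℝ) : ℂ) * ∫ z in dyadic i.1 i.2, f z := by
  have h : ∃ i : ℤ × ℤ, i ∈ S ∧ x ∈ dyadic i.1 i.2 := ⟨i, hi, hx⟩
  have he : h.choose = i := by
    by_contra hne
    exact Set.disjoint_left.1 (hS h.choose_spec.1 hi hne) h.choose_spec.2 hx
  rw [badPart, dif_pos h, he]

lemma badPart_of_notMem {x : ℝ} (hx : ∀ i ∈ S, x ∉ dyadic i.1 i.2) : badPart f S x = 0 := by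
  rw [badPart, dif_neg]
  rintro ⟨i, hi, hxi⟩
  exact hx i hi hxi

/-- The union of a family of dyadic intervals. -/
def stopSet (S : Set (ℤ × ℤ)) : Set ℝ := ⋃ i : S, dyadic i.1.1 i.1.2

lemma measurableSet_stopSet : MeasurableSet (stopSet S) :=
  MeasurableSet.iUnion fun _ => measurableSet_dyadic _ _

lemma mem_stopSet {x : ℝ} : x ∈ stopSet S ↔ ∃ i ∈ S, x ∈ dyadic i.1 i.2 := by
  simp [stopSet]

lemma pairwise_disjoint_stop (hS : S.PairwiseDisjoint fun i => dyadic i.1 i.2) :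
    Pairwise (Function.onFun Disjoint fun i : S => dyadic i.1.1 i.1.2) :=
  fun i j hij => hS i.2 j.2 fun h => hij (Subtype.ext h)

lemma measurable_badPart (hS : S.PairwiseDisjoint fun i => dyadic i.1 i.2) (hf : Measurable f) :
    Measurable (badPart f S) := by
  intro s hs
  have : badPart f S ⁻¹' s = ((stopSet S)ᶜ ∩ {_x | (0 : ℂ) ∈ s}) ∪ ⋃ i : S, (dyadic i.1.1 i.1.2 ∩
      (fun x => f x - (((2 : ℝ) ^ i.1.1 : ℝ) : ℂ) * ∫ z in dyadic i.1.1 i.1.2, f z) ⁻¹' s) := by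
    ext x
    by_cases hx : x ∈ stopSet S
    · obtain ⟨i, hi, hxi⟩ := mem_stopSet.1 hx
      simp only [mem_preimage, badPart_of_mem hS hi hxi, mem_union, mem_inter_iff,
        mem_compl_iff, hx,
        not_true_eq_false, false_and, false_or, mem_iUnion]
      constructor
      · intro h; exact ⟨⟨i, hi⟩, hxi, h⟩
      · rintro ⟨⟨j, hj⟩, hxj, h⟩
        simp only at hxj h
        rw [← badPart_of_mem hS hj hxj, badPart_of_mem hS hi hxi] at h
        exact h
    · have hx' : ∀ i ∈ S, x ∉ dyadic i.1 i.2 := fun i hi hxi => hx (mem_stopSet.2 ⟨i, hi, hxi⟩)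
      simp only [mem_preimage, badPart_of_notMem hx', mem_union, mem_inter_iff, mem_compl_iff, hx,
        not_false_eq_true, true_and, mem_iUnion, mem_ofPred_eq]
      constructor
      · intro h; exact Or.inl h
      · rintro (h | ⟨⟨j, hj⟩, hxj, -⟩)
        · exact h
        · exact absurd hxj (hx' j hj)
  rw [this]
  refine (measurableSet_stopSet.compl.inter (MeasurableSet.const _)).union
    (MeasurableSet.iUnion fun i => (measurableSet_dyadic _ _).inter ?_)
  exact (hf.sub_const _) hs

end Decomposition

/-- The facts about stopping intervals used in the Calderón–Zygmund decomposition. -/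
structure IsStopping (f : ℝ → ℂ) (l : ℝ) (S : Set (ℤ × ℤ)) : Prop where
  pos : 0 < l
  disj : S.PairwiseDisjoint fun i => dyadic i.1 i.2
  lower : ∀ i ∈ S, ENNReal.ofReal l * volume (dyadic i.1 i.2) ≤ ∫⁻ x in dyadic i.1 i.2, ‖f x‖ₑ
  upper : ∀ i ∈ S, ∫⁻ x in dyadic i.1 i.2, ‖f x‖ₑ ≤
    ENNReal.ofReal (2 * l) * volume (dyadic i.1 i.2)
  small : ∀ x ∉ stopSet S, ‖f x‖ ≤ l

lemma exists_isStopping {f : ℝ → ℂ} (hf : IsTame f) (hc : Continuous f) {l : ℝ} (hl : 0 < l) :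
    ∃ S, IsStopping f l S := by
  obtain ⟨S, h1, h2, h3, h4⟩ := exists_stopping_intervals hc.norm hf.integrable.norm
    (fun x => norm_nonneg _) hl
  have e : ∀ i : ℤ × ℤ, ∫⁻ x in dyadic i.1 i.2, ‖f x‖ₑ =
      ENNReal.ofReal (∫ x in dyadic i.1 i.2, ‖f x‖) := fun i =>
    (ofReal_integral_norm_eq_lintegral_enorm hf.integrable.integrableOn).symm
  refine ⟨S, hl, h1, fun i hi => ?_, fun i hi => ?_, fun x hx => h4 x fun i hi hxi =>
    hx (mem_stopSet.2 ⟨i, hi, hxi⟩)⟩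
  · rw [e, volume_dyadic, ← ENNReal.ofReal_mul hl.le]
    exact ENNReal.ofReal_le_ofReal (h2 i hi).le
  · rw [e, volume_dyadic, ← ENNReal.ofReal_mul (by positivity)]
    exact ENNReal.ofReal_le_ofReal (h3 i hi)

namespace IsStopping

variable {f : ℝ → ℂ} {l : ℝ} {S : Set (ℤ × ℤ)}

lemma lintegral_stopSet (h : IsStopping f l S) (F : ℝ → ℝ≥0∞) :
    ∫⁻ x in stopSet S, F x = ∑' i : S, ∫⁻ x in dyadic i.1.1 i.1.2, F x :=
  lintegral_iUnion (fun _ => measurableSet_dyadic _ _) (pairwise_disjoint_stop h.disj) F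

lemma volume_stopSet (h : IsStopping f l S) :
    volume (stopSet S) = ∑' i : S, volume (dyadic i.1.1 i.1.2) :=
  measure_iUnion (pairwise_disjoint_stop h.disj) fun _ => measurableSet_dyadic _ _

lemma lintegral_stopSet_le (h : IsStopping f l S) :
    ∫⁻ x in stopSet S, ‖f x‖ₑ ≤ ENNReal.ofReal (2 * l) * volume (stopSet S) := by
  rw [h.lintegral_stopSet, h.volume_stopSet, ← ENNReal.tsum_mul_left]
  exact ENNReal.tsum_le_tsum fun i => h.upper i.1 i.2

lemma volume_stopSet_le (h : IsStopping f l S) (hf : Measurable f) :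
    volume (stopSet S) ≤ ENNReal.ofReal (2 / l) * ∫⁻ x in {x | l / 2 < ‖f x‖}, ‖f x‖ₑ := by
  have hl := h.pos
  have hm : MeasurableSet {x | l / 2 < ‖f x‖} := measurableSet_lt measurable_const hf.norm
  have key : ∀ i ∈ S, volume (dyadic i.1 i.2) ≤ ENNReal.ofReal (2 / l) *
      ∫⁻ x in dyadic i.1 i.2, {x | l / 2 < ‖f x‖}.indicator (fun x => ‖f x‖ₑ) x := by
    intro i hi
    set V := volume (dyadic i.1 i.2) with hV
    have hVfin : V ≠ ⊤ := by rw [hV, volume_dyadic]; exact ENNReal.ofReal_ne_top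
    have h1 : ENNReal.ofReal l * V ≤ (∫⁻ x in dyadic i.1 i.2,
        {x | l / 2 < ‖f x‖}.indicator (fun x => ‖f x‖ₑ) x) + ENNReal.ofReal (l / 2) * V := by
      refine (h.lower i hi).trans ?_
      rw [← setLIntegral_const, ← lintegral_add_left (hf.enorm.indicator hm)]
      refine lintegral_mono fun x => ?_
      by_cases hx : l / 2 < ‖f x‖
      · rw [indicator_of_mem (by exact hx)]; exact le_self_add
      · rw [indicator_of_notMem (by exact hx), zero_add, ← ofReal_norm]
        exact ENNReal.ofReal_le_ofReal (not_lt.1 hx)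
    have h2 : ENNReal.ofReal l * V = ENNReal.ofReal (l / 2) * V + ENNReal.ofReal (l / 2) * V := by
      rw [← add_mul, ← ENNReal.ofReal_add (by positivity) (by positivity), add_halves]
    rw [h2] at h1
    have h3 := (ENNReal.add_le_add_iff_right
      (ENNReal.mul_ne_top ENNReal.ofReal_ne_top hVfin)).1 h1
    calc V = ENNReal.ofReal (2 / l) * (ENNReal.ofReal (l / 2) * V) := by
          rw [← mul_assoc, ← ENNReal.ofReal_mul (by positivity),
            show 2 / l * (l / 2) = 1 by field_simp]
          simp
      _ ≤ _ := by gcongr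
  rw [h.volume_stopSet]
  calc _ ≤ ∑' i : S, ENNReal.ofReal (2 / l) * ∫⁻ x in dyadic i.1.1 i.1.2,
        {x | l / 2 < ‖f x‖}.indicator (fun x => ‖f x‖ₑ) x :=
        ENNReal.tsum_le_tsum fun i => key i.1 i.2
    _ = ENNReal.ofReal (2 / l) * ∫⁻ x in stopSet S,
        {x | l / 2 < ‖f x‖}.indicator (fun x => ‖f x‖ₑ) x := by
        rw [ENNReal.tsum_mul_left, ← h.lintegral_stopSet]
    _ ≤ ENNReal.ofReal (2 / l) * ∫⁻ x, {x | l / 2 < ‖f x‖}.indicator (fun x => ‖f x‖ₑ) x := by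
        exact mul_le_mul' le_rfl (setLIntegral_le_lintegral _ _)
    _ = _ := by rw [lintegral_indicator hm]

lemma volume_stopSet_lt_top (h : IsStopping f l S) (hf : IsTame f) : volume (stopSet S) < ⊤ := by
  refine (h.volume_stopSet_le hf.meas).trans_lt (ENNReal.mul_lt_top ENNReal.ofReal_lt_top ?_)
  exact (setLIntegral_le_lintegral _ _).trans_lt hf.lintegral_lt_top

lemma norm_mean_le (h : IsStopping f l S) {i : ℤ × ℤ} (hi : i ∈ S) :
    ‖(((2 : ℝ) ^ i.1 : ℝ) : ℂ) * ∫ z in dyadic i.1 i.2, f z‖ₑ ≤ ENNReal.ofReal (2 * l) := by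
  have hl := h.pos
  have hp : (0 : ℝ) < 2 ^ i.1 := by positivity
  rw [enorm_mul, ← ofReal_norm (((2 : ℝ) ^ i.1 : ℝ) : ℂ), Complex.norm_real,
    Real.norm_of_nonneg hp.le]
  calc _ ≤ ENNReal.ofReal (2 ^ i.1) * (ENNReal.ofReal (2 * l) * volume (dyadic i.1 i.2)) := by
        gcongr
        exact (enorm_integral_le_lintegral_enorm _).trans (h.upper i hi)
    _ = _ := by
        rw [volume_dyadic, ← ENNReal.ofReal_mul (by positivity),
          ← ENNReal.ofReal_mul (by positivity)]
        congr 1; field_simp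

lemma enorm_good_le (h : IsStopping f l S) {x : ℝ} (hx : x ∈ stopSet S) :
    ‖f x - badPart f S x‖ₑ ≤ ENNReal.ofReal (2 * l) := by
  obtain ⟨i, hi, hxi⟩ := mem_stopSet.1 hx
  rw [badPart_of_mem h.disj hi hxi, sub_sub_cancel]
  exact h.norm_mean_le hi

lemma badPart_eq_zero {x : ℝ} (hx : x ∉ stopSet S) : badPart f S x = 0 :=
  badPart_of_notMem fun i hi hxi => hx (mem_stopSet.2 ⟨i, hi, hxi⟩)

lemma lintegral_badPart_le (h : IsStopping f l S) (hf : Measurable f) :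
    ∫⁻ x in stopSet S, ‖badPart f S x‖ₑ ≤ ENNReal.ofReal (4 * l) * volume (stopSet S) := by
  have hl := h.pos
  calc ∫⁻ x in stopSet S, ‖badPart f S x‖ₑ
      ≤ ∫⁻ x in stopSet S, (‖f x‖ₑ + ENNReal.ofReal (2 * l)) := by
        refine setLIntegral_mono' measurableSet_stopSet fun x hx => ?_
        have e : badPart f S x = f x - (f x - badPart f S x) := by ring
        rw [e]
        refine enorm_sub_le.trans ?_
        gcongr
        exact h.enorm_good_le hx
    _ = (∫⁻ x in stopSet S, ‖f x‖ₑ) + ENNReal.ofReal (2 * l) * volume (stopSet S) := by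
        rw [lintegral_add_left hf.enorm, setLIntegral_const]
    _ ≤ ENNReal.ofReal (2 * l) * volume (stopSet S) +
        ENNReal.ofReal (2 * l) * volume (stopSet S) := by
        gcongr; exact h.lintegral_stopSet_le
    _ = _ := by
        rw [← add_mul, ← ENNReal.ofReal_add (by positivity) (by positivity)]
        congr 2; ring

lemma isTame_badPart (h : IsStopping f l S) (hf : IsTame f) : IsTame (badPart f S) := by
  have hl := h.pos
  obtain ⟨M, hM⟩ := hf.exists_bound_nonneg
  refine IsTame.of_enorm_le (M := M + (2 * l).toNNReal) (measurable_badPart h.disj hf.meas) ?_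
    fun x => ?_
  · have : ∫⁻ x, ‖badPart f S x‖ₑ = ∫⁻ x in stopSet S, ‖badPart f S x‖ₑ := by
      rw [← lintegral_indicator measurableSet_stopSet]
      refine lintegral_congr fun x => ?_
      by_cases hx : x ∈ stopSet S
      · rw [indicator_of_mem hx]
      · rw [indicator_of_notMem hx, badPart_eq_zero hx, enorm_zero]
    rw [this]
    exact (h.lintegral_badPart_le hf.meas).trans_lt
      (ENNReal.mul_lt_top ENNReal.ofReal_lt_top (h.volume_stopSet_lt_top hf))
  · by_cases hx : x ∈ stopSet S
    · have e : badPart f S x = f x - (f x - badPart f S x) := by ring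
      rw [e]
      refine enorm_sub_le.trans ?_
      push_cast
      exact add_le_add (hM x) (h.enorm_good_le hx)
    · rw [badPart_eq_zero hx, enorm_zero]; exact zero_le

lemma isTame_goodPart (h : IsStopping f l S) (hf : IsTame f) :
    IsTame fun x => f x - badPart f S x := by
  have := hf.add ((h.isTame_badPart hf).mul_bdd (g := fun _ => -1) measurable_const (N := 1)
    (by simp))
  convert this using 1
  ext x; ring

lemma lintegral_goodPart_sq_le (h : IsStopping f l S) (hf : IsTame f) :
    ∫⁻ x, ‖f x - badPart f S x‖ₑ ^ 2 ≤ (∫⁻ x in {x | ‖f x‖ ≤ l}, ‖f x‖ₑ ^ 2) +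
      ENNReal.ofReal (4 * l ^ 2) * volume (stopSet S) := by
  have hl := h.pos
  have hm : MeasurableSet {x | ‖f x‖ ≤ l} := measurableSet_le hf.meas.norm measurable_const
  rw [← lintegral_add_compl _ (measurableSet_stopSet (S := S)), add_comm]
  refine add_le_add ?_ ?_
  · calc ∫⁻ x in (stopSet S)ᶜ, ‖f x - badPart f S x‖ₑ ^ 2 = ∫⁻ x in (stopSet S)ᶜ, ‖f x‖ₑ ^ 2 := by
          refine setLIntegral_congr_fun measurableSet_stopSet.compl fun x hx => ?_
          simp only [badPart_eq_zero hx, sub_zero]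
      _ ≤ _ := lintegral_mono_set fun x hx => h.small x hx
  · calc ∫⁻ x in stopSet S, ‖f x - badPart f S x‖ₑ ^ 2
        ≤ ∫⁻ x in stopSet S, ENNReal.ofReal (4 * l ^ 2) := by
          refine setLIntegral_mono' measurableSet_stopSet fun x hx => ?_
          calc _ ≤ (ENNReal.ofReal (2 * l)) ^ 2 := by gcongr; exact h.enorm_good_le hx
            _ = _ := by rw [← ENNReal.ofReal_pow (by positivity)]; congr 1; ring
      _ = _ := setLIntegral_const _ _

lemma integral_badPart (h : IsStopping f l S) (hf : IsTame f) {i : ℤ × ℤ} (hi : i ∈ S) :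
    ∫ x in dyadic i.1 i.2, badPart f S x = 0 := by
  have hp : (0 : ℝ) < 2 ^ i.1 := by positivity
  have hfin : volume (dyadic i.1 i.2) ≠ ⊤ := by rw [volume_dyadic]; exact ENNReal.ofReal_ne_top
  have e : ∫ x in dyadic i.1 i.2, badPart f S x = ∫ x in dyadic i.1 i.2,
      (f x - (((2 : ℝ) ^ i.1 : ℝ) : ℂ) * ∫ z in dyadic i.1 i.2, f z) :=
    setIntegral_congr_fun (measurableSet_dyadic _ _) fun x hx => badPart_of_mem h.disj hi hx
  rw [e, integral_sub hf.integrable.integrableOn (integrableOn_const hfin), setIntegral_const,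
    measureReal_def, volume_dyadic, ENNReal.toReal_ofReal (by positivity), Complex.real_smul,
    ← mul_assoc, ← Complex.ofReal_mul, inv_mul_cancel₀ hp.ne', Complex.ofReal_one, one_mul,
    sub_self]

/-- The enlarged stopping set. -/
def _root_.stopSetStar (S : Set (ℤ × ℤ)) : Set ℝ :=
  ⋃ i : S, {w | |w - dyadicCenter i.1| < 2 * dyadicRadius i.1}

lemma volume_stopSetStar_le (h : IsStopping f l S) :
    volume (stopSetStar S) ≤ 2 * volume (stopSet S) := by
  rw [h.volume_stopSet, ← ENNReal.tsum_mul_left]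
  refine (measure_iUnion_le _).trans (ENNReal.tsum_le_tsum fun i => ?_)
  have : {w : ℝ | |w - dyadicCenter i.1| < 2 * dyadicRadius i.1} =
      Metric.ball (dyadicCenter i.1) (2 * dyadicRadius i.1) := by
    ext w; simp [Real.dist_eq]
  rw [this, Real.volume_ball, volume_dyadic, show (2 : ℝ≥0∞) = ENNReal.ofReal 2 by simp,
    ← ENNReal.ofReal_mul (by norm_num)]
  refine ENNReal.ofReal_le_ofReal ?_
  simp only [dyadicRadius]
  linarith

lemma lintegral_kernelOp_badPart_le (h : IsStopping f l S) (hf : IsTame f) {A : ℝ≥0}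
    {K : ℝ → ℝ → ℂ} (hK : IsSchurKernel A K) (hH : IsHormander K) :
    ∫⁻ w in (stopSetStar S)ᶜ, ‖kernelOp K (badPart f S) w‖ₑ ≤
      ENNReal.ofReal (4 * l) * volume (stopSet S) := by
  have tb := h.isTame_badPart hf
  obtain ⟨N, hN⟩ := tb.bdd
  have point : ∀ w, ‖kernelOp K (badPart f S) w‖ₑ ≤ ∑' i : S, ∫⁻ y in dyadic i.1.1 i.1.2,
      ‖K w y - K w (dyadicCenter i.1)‖ₑ * ‖badPart f S y‖ₑ := by
    intro w
    have hi := hK.integrable_row_mul w tb.meas hN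
    have e1 : kernelOp K (badPart f S) w = ∫ y in stopSet S, K w y * badPart f S y := by
      rw [kernelOp, setIntegral_eq_integral_of_forall_compl_eq_zero]
      intro y hy
      rw [badPart_eq_zero hy, mul_zero]
    rw [e1, stopSet, integral_iUnion (fun _ => measurableSet_dyadic _ _)
      (pairwise_disjoint_stop h.disj) hi.integrableOn]
    refine enorm_tsum_le_tsum_enorm.trans (ENNReal.tsum_le_tsum fun i => ?_)
    have e2 : ∫ y in dyadic i.1.1 i.1.2, K w y * badPart f S y =
        ∫ y in dyadic i.1.1 i.1.2, (K w y - K w (dyadicCenter i.1)) * badPart f S y := by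
      simp only [sub_mul]
      rw [integral_sub hi.integrableOn (tb.integrable.integrableOn.const_mul _),
        integral_const_mul, h.integral_badPart hf i.2, mul_zero, sub_zero]
    rw [e2]
    refine (enorm_integral_le_lintegral_enorm _).trans (le_of_eq ?_)
    simp only [enorm_mul]
  have hm : ∀ i : S, Measurable (Function.uncurry fun w y =>
      ‖K w y - K w (dyadicCenter i.1)‖ₑ * ‖badPart f S y‖ₑ) := fun i => by
    refine Measurable.mul ?_ (tb.meas.comp measurable_snd).enorm
    exact (hK.meas.sub ((hK.meas_col (dyadicCenter i.1)).comp measurable_fst)).enorm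
  calc _ ≤ ∫⁻ w in (stopSetStar S)ᶜ, ∑' i : S, ∫⁻ y in dyadic i.1.1 i.1.2,
        ‖K w y - K w (dyadicCenter i.1)‖ₑ * ‖badPart f S y‖ₑ := lintegral_mono point
    _ = ∑' i : S, ∫⁻ w in (stopSetStar S)ᶜ, ∫⁻ y in dyadic i.1.1 i.1.2,
        ‖K w y - K w (dyadicCenter i.1)‖ₑ * ‖badPart f S y‖ₑ :=
        lintegral_tsum fun i => (hm i).lintegral_prod_right'.aemeasurable
    _ ≤ ∑' i : S, ∫⁻ y in dyadic i.1.1 i.1.2, ‖badPart f S y‖ₑ := by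
        refine ENNReal.tsum_le_tsum fun i => ?_
        rw [lintegral_lintegral_swap (hm i).aemeasurable]
        refine setLIntegral_mono' (measurableSet_dyadic _ _) fun y hy => ?_
        rw [lintegral_mul_const' _ _ (by simp)]
        refine (mul_le_mul_left ?_ _).trans (one_mul _).le
        refine le_trans (lintegral_mono_set fun w hw => ?_)
          (hH (dyadicCenter i.1) (dyadicRadius i.1) y (dyadicRadius_pos _)
            (abs_sub_dyadicCenter_le hy))
        by_contra hlt
        have hlt' : |w - dyadicCenter i.1| < 2 * dyadicRadius i.1 := not_le.1 hlt
        exact hw (mem_iUnion.2 ⟨i, hlt'⟩)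
    _ = ∫⁻ y in stopSet S, ‖badPart f S y‖ₑ := (h.lintegral_stopSet _).symm
    _ ≤ _ := h.lintegral_badPart_le hf.meas

end IsStopping

/-- The level set estimate behind the weak type bound for singular integrals. -/
lemma volume_level_le {A : ℝ≥0} {K : ℝ → ℝ → ℂ} (hK : IsSchurKernel A K) (hH : IsHormander K)
    (hL : ∀ f, IsTame f → ∫⁻ w, ‖kernelOp K f w‖ₑ ^ 2 ≤ ∫⁻ x, ‖f x‖ₑ ^ 2) {f : ℝ → ℂ}
    (hf : IsTame f) (hc : Continuous f) {l : ℝ} (hl : 0 < l) :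
    volume {w | l < ‖kernelOp K f w‖} ≤
      ENNReal.ofReal (52 / l) * (∫⁻ x in {x | l / 2 < ‖f x‖}, ‖f x‖ₑ) +
      ENNReal.ofReal (4 / l ^ 2) * ∫⁻ x in {x | ‖f x‖ ≤ l}, ‖f x‖ₑ ^ 2 := by
  obtain ⟨S, h⟩ := exists_isStopping hf hc hl
  have tb := h.isTame_badPart hf
  have tg := h.isTame_goodPart hf
  set g : ℝ → ℂ := fun x => f x - badPart f S x with hg
  have hsplit : ∀ w, kernelOp K f w = kernelOp K g w + kernelOp K (badPart f S) w := fun w => by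
    obtain ⟨N, hN⟩ := tb.bdd
    obtain ⟨N', hN'⟩ := tg.bdd
    simp only [kernelOp]
    rw [← integral_add (hK.integrable_row_mul w tg.meas hN') (hK.integrable_row_mul w tb.meas hN)]
    congr 1; ext y; simp only [hg]; ring
  have mg := IsSchurKernel.measurable_kernelOp hK.meas tg.meas
  have mb := IsSchurKernel.measurable_kernelOp hK.meas tb.meas
  set V := volume (stopSet S) with hV
  set Q := ∫⁻ x in {x | ‖f x‖ ≤ l}, ‖f x‖ₑ ^ 2 with hQ
  have hsub : {w | l < ‖kernelOp K f w‖} ⊆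
      {w | ENNReal.ofReal (l / 2) ^ 2 ≤ ‖kernelOp K g w‖ₑ ^ 2} ∪
      (stopSetStar S ∪ ({w | ENNReal.ofReal (l / 2) ≤ ‖kernelOp K (badPart f S) w‖ₑ} ∩
        (stopSetStar S)ᶜ)) := by
    intro w hw
    by_cases hw1 : l / 2 ≤ ‖kernelOp K g w‖
    · left
      rw [mem_ofPred_eq, ← ofReal_norm]
      gcongr
    · right
      by_cases hw2 : w ∈ stopSetStar S
      · left; exact hw2
      · right
        refine ⟨?_, hw2⟩
        rw [mem_ofPred_eq, ← ofReal_norm]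
        refine ENNReal.ofReal_le_ofReal ?_
        have hw' : l < ‖kernelOp K f w‖ := hw
        rw [hsplit] at hw'
        have := norm_add_le (kernelOp K g w) (kernelOp K (badPart f S) w)
        linarith
  have a1 : volume {w | ENNReal.ofReal (l / 2) ^ 2 ≤ ‖kernelOp K g w‖ₑ ^ 2} ≤
      ENNReal.ofReal (4 / l ^ 2) * (Q + ENNReal.ofReal (4 * l ^ 2) * V) := by
    have h1 := mul_meas_ge_le_lintegral (μ := volume) (mg.enorm.pow_const 2)
      (ENNReal.ofReal (l / 2) ^ 2)
    have h2 := h1.trans ((hL g tg).trans (h.lintegral_goodPart_sq_le hf))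
    calc _ = ENNReal.ofReal (4 / l ^ 2) * (ENNReal.ofReal (l / 2) ^ 2 *
          volume {w | ENNReal.ofReal (l / 2) ^ 2 ≤ ‖kernelOp K g w‖ₑ ^ 2}) := by
          rw [← mul_assoc, ← ENNReal.ofReal_pow (by positivity),
            ← ENNReal.ofReal_mul (by positivity),
            show 4 / l ^ 2 * (l / 2) ^ 2 = 1 by field_simp; norm_num]
          simp
      _ ≤ _ := mul_le_mul' le_rfl h2
  have a2 : volume ({w | ENNReal.ofReal (l / 2) ≤ ‖kernelOp K (badPart f S) w‖ₑ} ∩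
        (stopSetStar S)ᶜ) ≤ ENNReal.ofReal (2 / l) * (ENNReal.ofReal (4 * l) * V) := by
    have h1 := mul_meas_ge_le_lintegral (μ := volume.restrict (stopSetStar S)ᶜ) mb.enorm
      (ENNReal.ofReal (l / 2))
    rw [Measure.restrict_apply (measurableSet_le measurable_const mb.enorm)] at h1
    have h2 := h1.trans (h.lintegral_kernelOp_badPart_le hf hK hH)
    calc _ = ENNReal.ofReal (2 / l) * (ENNReal.ofReal (l / 2) *
          volume ({w | ENNReal.ofReal (l / 2) ≤ ‖kernelOp K (badPart f S) w‖ₑ} ∩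
          (stopSetStar S)ᶜ)) := by
          rw [← mul_assoc, ← ENNReal.ofReal_mul (by positivity),
            show 2 / l * (l / 2) = 1 by field_simp]
          simp
      _ ≤ _ := mul_le_mul' le_rfl h2
  calc _ ≤ ENNReal.ofReal (4 / l ^ 2) * (Q + ENNReal.ofReal (4 * l ^ 2) * V) +
        (2 * V + ENNReal.ofReal (2 / l) * (ENNReal.ofReal (4 * l) * V)) := by
        refine (measure_mono hsub).trans ((measure_union_le _ _).trans (add_le_add a1 ?_))
        exact (measure_union_le _ _).trans (add_le_add h.volume_stopSetStar_le a2)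
    _ = 26 * V + ENNReal.ofReal (4 / l ^ 2) * Q := by
        have e1 : ENNReal.ofReal (4 / l ^ 2) * ENNReal.ofReal (4 * l ^ 2) = 16 := by
          rw [← ENNReal.ofReal_mul (by positivity),
            show 4 / l ^ 2 * (4 * l ^ 2) = 16 by field_simp; norm_num]
          simp
        have e2 : ENNReal.ofReal (2 / l) * ENNReal.ofReal (4 * l) = 8 := by
          rw [← ENNReal.ofReal_mul (by positivity),
            show 2 / l * (4 * l) = 8 by field_simp; norm_num]
          simp
        rw [mul_add, ← mul_assoc, ← mul_assoc, e1, e2]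
        ring
    _ ≤ 26 * (ENNReal.ofReal (2 / l) * ∫⁻ x in {x | l / 2 < ‖f x‖}, ‖f x‖ₑ) +
        ENNReal.ofReal (4 / l ^ 2) * Q := by
        gcongr; exact h.volume_stopSet_le hf.meas
    _ = _ := by
        rw [← mul_assoc]
        congr 2
        rw [show (26 : ℝ≥0∞) = ENNReal.ofReal 26 by simp, ← ENNReal.ofReal_mul (by norm_num)]
        congr 1; ring

lemma setLIntegral_Iio_rpow_le {p b : ℝ} (hp : 1 < p) (hb : 0 ≤ b) :
    ∫⁻ l in Ioi 0, (Iio (2 * b)).indicator (fun l => ENNReal.ofReal (l ^ (p - 2) * b)) l ≤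
      ENNReal.ofReal (2 ^ (p - 1) / (p - 1) * b ^ p) := by
  rcases hb.eq_or_lt with rfl | hb
  · simp
  rw [setLIntegral_indicator measurableSet_Iio, inter_comm, Ioi_inter_Iio,
    ← ofReal_integral_eq_lintegral_ofReal]
  · refine ENNReal.ofReal_le_ofReal (le_of_eq ?_)
    rw [integral_mul_const, ← integral_Ioc_eq_integral_Ioo,
      ← intervalIntegral.integral_of_le (by positivity), integral_rpow (Or.inl (by linarith)),
      show p - 2 + 1 = p - 1 by ring, Real.zero_rpow (by linarith), sub_zero,
      Real.mul_rpow (by norm_num) hb.le,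
      show b ^ p = b ^ (p - 1) * b by
        rw [← Real.rpow_add_one hb.ne']; congr 1; ring]
    ring
  · refine Integrable.mul_const ?_ _
    exact (intervalIntegral.integrableOn_Ioo_rpow_iff (by positivity)).2 (by linarith)
  · refine (ae_restrict_iff' measurableSet_Ioo).2 (ae_of_all _ fun l hl => ?_)
    have := hl.1
    positivity

lemma setLIntegral_Ici_rpow_le {p b : ℝ} (hp : p < 2) (hb : 0 ≤ b) :
    ∫⁻ l in Ioi 0, (Ici b).indicator (fun l => ENNReal.ofReal (l ^ (p - 3) * b ^ 2)) l ≤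
      ENNReal.ofReal (1 / (2 - p) * b ^ p) := by
  rcases hb.eq_or_lt with rfl | hb
  · simp
  rw [setLIntegral_indicator measurableSet_Ici,
    inter_eq_left.2 (show Ici b ⊆ Ioi 0 from fun x hx => hb.trans_le hx),
    setLIntegral_congr Ioi_ae_eq_Ici.symm, ← ofReal_integral_eq_lintegral_ofReal]
  · refine ENNReal.ofReal_le_ofReal (le_of_eq ?_)
    rw [integral_mul_const, integral_Ioi_rpow_of_lt (by linarith) hb,
      show p - 3 + 1 = p - 2 by ring,
      show b ^ p = b ^ (p - 2) * b ^ 2 by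
        rw [← Real.rpow_natCast b 2, ← Real.rpow_add hb]; congr 1; push_cast; ring]
    have : p - 2 ≠ 0 := by linarith
    have : 2 - p ≠ 0 := by linarith
    field_simp
    ring
  · exact (integrableOn_Ioi_rpow_of_lt (by linarith) hb).mul_const _
  · refine (ae_restrict_iff' measurableSet_Ioi).2 (ae_of_all _ fun l hl => ?_)
    have := hb.trans hl
    positivity

/-- Calderón–Zygmund bound for exponents below two. -/
lemma lintegral_kernelOp_rpow_le {p : ℝ} (hp1 : 1 < p) (hp2 : p < 2) {A : ℝ≥0} {K : ℝ → ℝ → ℂ}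
    (hK : IsSchurKernel A K) (hH : IsHormander K)
    (hL : ∀ f, IsTame f → ∫⁻ w, ‖kernelOp K f w‖ₑ ^ 2 ≤ ∫⁻ x, ‖f x‖ₑ ^ 2) {f : ℝ → ℂ}
    (hf : IsTame f) (hc : Continuous f) :
    ∫⁻ w, ‖kernelOp K f w‖ₑ ^ p ≤
      ENNReal.ofReal (p * (52 * (2 ^ (p - 1) / (p - 1)) + 4 * (1 / (2 - p)))) *
        ∫⁻ x, ‖f x‖ₑ ^ p := by
  have hp0 : 0 < p := by linarith
  have mT := IsSchurKernel.measurable_kernelOp hK.meas hf.meas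
  have e1 : ∀ z : ℂ, ‖z‖ₑ ^ p = ENNReal.ofReal (‖z‖ ^ p) := fun z => by
    rw [← ofReal_norm, ENNReal.ofReal_rpow_of_nonneg (norm_nonneg _) hp0.le]
  simp only [e1]
  rw [lintegral_rpow_eq_lintegral_meas_lt_mul _ (ae_of_all _ fun w => norm_nonneg _)
    mT.norm.aemeasurable hp0]
  set G1 : ℝ → ℝ → ℝ≥0∞ := fun l x =>
    (Iio (2 * ‖f x‖)).indicator (fun l => ENNReal.ofReal (l ^ (p - 2) * ‖f x‖)) l with hG1
  set G2 : ℝ → ℝ → ℝ≥0∞ := fun l x =>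
    (Ici ‖f x‖).indicator (fun l => ENNReal.ofReal (l ^ (p - 3) * ‖f x‖ ^ 2)) l with hG2
  have hmf := hf.meas
  have m1 : Measurable (Function.uncurry G1) := by
    have : Function.uncurry G1 = {z : ℝ × ℝ | z.1 < 2 * ‖f z.2‖}.indicator
        (fun z => ENNReal.ofReal (z.1 ^ (p - 2) * ‖f z.2‖)) := by
      ext ⟨l, x⟩; simp only [hG1, Function.uncurry, indicator, mem_Iio, mem_ofPred_eq]
    rw [this]
    exact Measurable.indicator (by fun_prop) (measurableSet_lt (by fun_prop) (by fun_prop))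
  have m2 : Measurable (Function.uncurry G2) := by
    have : Function.uncurry G2 = {z : ℝ × ℝ | ‖f z.2‖ ≤ z.1}.indicator
        (fun z => ENNReal.ofReal (z.1 ^ (p - 3) * ‖f z.2‖ ^ 2)) := by
      ext ⟨l, x⟩; simp only [hG2, Function.uncurry, indicator, mem_Ici, mem_ofPred_eq]
    rw [this]
    exact Measurable.indicator (by fun_prop) (measurableSet_le (by fun_prop) (by fun_prop))
  have m1l : ∀ l, Measurable fun x => G1 l x := fun l => m1.comp measurable_prodMk_left
  have m1x : ∀ x, Measurable fun l => G1 l x := fun x => m1.comp measurable_prodMk_right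
  have m2x : ∀ x, Measurable fun l => G2 l x := fun x => m2.comp measurable_prodMk_right
  have hlev : ∀ l ∈ Ioi (0 : ℝ), volume {w | l < ‖kernelOp K f w‖} * ENNReal.ofReal (l ^ (p - 1)) ≤
      ∫⁻ x, (52 * G1 l x + 4 * G2 l x) := by
    intro l hl
    have hl : 0 < l := hl
    have s1 : MeasurableSet {x | l / 2 < ‖f x‖} := measurableSet_lt measurable_const hmf.norm
    have s2 : MeasurableSet {x | ‖f x‖ ≤ l} := measurableSet_le hmf.norm measurable_const
    have q1 : ENNReal.ofReal (52 / l) * (∫⁻ x in {x | l / 2 < ‖f x‖}, ‖f x‖ₑ) *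
        ENNReal.ofReal (l ^ (p - 1)) = ∫⁻ x, 52 * G1 l x := by
      rw [mul_right_comm, ← lintegral_indicator s1, ← ENNReal.ofReal_mul (by positivity),
        ← lintegral_const_mul' _ _ ENNReal.ofReal_ne_top]
      refine lintegral_congr fun x => ?_
      by_cases hx : l / 2 < ‖f x‖
      · have hx' : l < 2 * ‖f x‖ := by linarith
        rw [indicator_of_mem (by exact hx), hG1]
        simp only
        rw [indicator_of_mem (by exact hx'), ← ofReal_norm, ← ENNReal.ofReal_mul (by positivity),
          show (52 : ℝ≥0∞) = ENNReal.ofReal 52 by simp, ← ENNReal.ofReal_mul (by norm_num)]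
        congr 1
        rw [show p - 1 = p - 2 + 1 by ring, Real.rpow_add_one hl.ne']
        field_simp
      · have hx' : ¬ l < 2 * ‖f x‖ := by linarith
        rw [indicator_of_notMem (by exact hx), hG1]
        simp only
        rw [indicator_of_notMem (by exact hx')]
        simp
    have q2 : ENNReal.ofReal (4 / l ^ 2) * (∫⁻ x in {x | ‖f x‖ ≤ l}, ‖f x‖ₑ ^ 2) *
        ENNReal.ofReal (l ^ (p - 1)) = ∫⁻ x, 4 * G2 l x := by
      rw [mul_right_comm, ← lintegral_indicator s2, ← ENNReal.ofReal_mul (by positivity),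
        ← lintegral_const_mul' _ _ ENNReal.ofReal_ne_top]
      refine lintegral_congr fun x => ?_
      by_cases hx : ‖f x‖ ≤ l
      · rw [indicator_of_mem (by exact hx), hG2]
        simp only
        rw [indicator_of_mem (by exact hx), ← ofReal_norm, ← ENNReal.ofReal_pow (norm_nonneg _),
          ← ENNReal.ofReal_mul (by positivity),
          show (4 : ℝ≥0∞) = ENNReal.ofReal 4 by simp, ← ENNReal.ofReal_mul (by norm_num)]
        congr 1
        rw [show p - 1 = p - 3 + 2 by ring, Real.rpow_add hl]
        norm_num
        field_simp
      · rw [indicator_of_notMem (by exact hx), hG2]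
        simp only
        rw [indicator_of_notMem (by exact hx)]
        simp
    rw [lintegral_add_left ((m1l l).const_mul _), ← q1, ← q2, ← add_mul]
    exact mul_le_mul' (volume_level_le hK hH hL hf hc hl) le_rfl
  have mG : Measurable (Function.uncurry fun l x => 52 * G1 l x + 4 * G2 l x) :=
    (m1.const_mul _).add (m2.const_mul _)
  calc _ ≤ ENNReal.ofReal p * ∫⁻ l in Ioi 0, ∫⁻ x, (52 * G1 l x + 4 * G2 l x) :=
        mul_le_mul' le_rfl (setLIntegral_mono' measurableSet_Ioi hlev)
    _ = ENNReal.ofReal p * ∫⁻ x, ∫⁻ l in Ioi 0, (52 * G1 l x + 4 * G2 l x) := by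
        rw [lintegral_lintegral_swap mG.aemeasurable]
    _ ≤ ENNReal.ofReal p * ∫⁻ x, ENNReal.ofReal
        (52 * (2 ^ (p - 1) / (p - 1)) + 4 * (1 / (2 - p))) * ENNReal.ofReal (‖f x‖ ^ p) := by
        refine mul_le_mul' le_rfl (lintegral_mono fun x => ?_)
        have hpm : 0 < p - 1 := by linarith
        have hpm' : 0 < 2 - p := by linarith
        rw [lintegral_add_left ((m1x x).const_mul _), lintegral_const_mul _ (m1x x),
          lintegral_const_mul _ (m2x x)]
        refine (add_le_add
          (mul_le_mul' le_rfl (setLIntegral_Iio_rpow_le hp1 (norm_nonneg (f x))))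
          (mul_le_mul' le_rfl (setLIntegral_Ici_rpow_le hp2 (norm_nonneg (f x))))).trans
          (le_of_eq ?_)
        rw [show (52 : ℝ≥0∞) = ENNReal.ofReal 52 by simp,
          show (4 : ℝ≥0∞) = ENNReal.ofReal 4 by simp,
          ← ENNReal.ofReal_mul (by norm_num), ← ENNReal.ofReal_mul (by norm_num),
          ← ENNReal.ofReal_add (by positivity) (by positivity),
          ← ENNReal.ofReal_mul (by positivity)]
        congr 1
        ring
    _ = _ := by
        rw [lintegral_const_mul' _ _ ENNReal.ofReal_ne_top, ← mul_assoc,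
          ← ENNReal.ofReal_mul hp0.le]

/-- Bounds for the transposed operator carry over by duality. -/
lemma lintegral_kernelOp_rpow_le_of_dual {p q : ℝ} (hpq : p.HolderConjugate q) (hp2 : 2 ≤ p)
    {A : ℝ≥0} {K : ℝ → ℝ → ℂ} (hK : IsSchurKernel A K) {f : ℝ → ℂ} (hf : IsTame f) {C : ℝ≥0∞}
    (hd : ∀ g, IsTame g → (Continuous (kernelOp K f) → Continuous g) →
      ∫⁻ x, ‖kernelOp (fun x y => K y x) g x‖ₑ ^ q ≤ C * ∫⁻ y, ‖g y‖ₑ ^ q) :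
    ∫⁻ w, ‖kernelOp K f w‖ₑ ^ p ≤ C ^ (p / q) * ∫⁻ x, ‖f x‖ₑ ^ p := by
  have hp0 := hpq.pos
  have hq0 := hpq.symm.pos
  set h := kernelOp K f with hh
  have th : IsTame h := hK.kernelOp_tame hf
  set m : ℝ → ℂ := fun w => ((‖h w‖ ^ (p - 2) : ℝ) : ℂ) with hm
  have hcm : Continuous fun r : ℝ => r ^ (p - 2) := Real.continuous_rpow_const (by linarith)
  have mm : Measurable m := by
    have := th.meas
    have := hcm.measurable.comp this.norm
    exact Complex.measurable_ofReal.comp this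
  obtain ⟨M, hM⟩ := th.bdd
  have bm : ∀ w, ‖m w‖ ≤ M ^ (p - 2) := fun w => by
    rw [hm, Complex.norm_real, Real.norm_of_nonneg (by positivity)]
    exact Real.rpow_le_rpow (norm_nonneg _) (hM w) (by linarith)
  set g : ℝ → ℂ := fun w => (starRingEnd ℂ) (h w) * m w with hg
  have tg : IsTame g := th.conj.mul_bdd mm bm
  have cg : Continuous h → Continuous g := fun hc => by
    have := hcm.comp hc.norm
    exact (Complex.continuous_conj.comp hc).mul (Complex.continuous_ofReal.comp this)
  have ng : ∀ w, ‖g w‖ = ‖h w‖ ^ (p - 1) := fun w => by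
    rw [hg, norm_mul, hm, Complex.norm_real, Real.norm_of_nonneg (by positivity)]
    simp only [RCLike.norm_conj]
    rcases (norm_nonneg (h w)).eq_or_lt with h0 | h0
    · rw [← h0, Real.zero_rpow (by linarith : p - 1 ≠ 0), zero_mul]
    · rw [mul_comm, ← Real.rpow_add_one h0.ne']; congr 1; ring
  have eg : ∀ w, ‖g w‖ₑ ^ q = ‖h w‖ₑ ^ p := fun w => by
    rw [← ofReal_norm, ng, ← ofReal_norm, ENNReal.ofReal_rpow_of_nonneg (by positivity) hq0.le,
      ENNReal.ofReal_rpow_of_nonneg (by positivity) hp0.le, ← Real.rpow_mul (norm_nonneg _)]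
    congr 2
    have := hpq.sub_one_mul_conj
    exact this
  have ehg : ∀ w, h w * g w = ((‖h w‖ ^ p : ℝ) : ℂ) := fun w => by
    rw [hg, hm]
    simp only
    rw [← mul_assoc, Complex.mul_conj, Complex.normSq_eq_norm_sq, ← Complex.ofReal_mul]
    congr 1
    rcases (norm_nonneg (h w)).eq_or_lt with h0 | h0
    · rw [← h0, Real.zero_rpow hp0.ne']; simp
    · rw [← Real.rpow_natCast ‖h w‖ 2, ← Real.rpow_add h0]; congr 1; push_cast; ring
  set N := ∫⁻ w, ‖h w‖ₑ ^ p with hN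
  have eN : ∀ w, ‖h w‖ₑ ^ p = ENNReal.ofReal (‖h w‖ ^ p) := fun w => by
    rw [← ofReal_norm, ENNReal.ofReal_rpow_of_nonneg (norm_nonneg _) hp0.le]
  have ihg : Integrable fun w => ‖h w‖ ^ p := by
    have := (th.mul tg).integrable.norm
    refine this.congr (ae_of_all _ fun w => ?_)
    simp only [ehg]
    rw [Complex.norm_real, Real.norm_of_nonneg (by positivity)]
  have hNi : N = ENNReal.ofReal (∫ w, ‖h w‖ ^ p) := by
    rw [ofReal_integral_eq_lintegral_ofReal ihg (ae_of_all _ fun w => by positivity), hN]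
    exact lintegral_congr eN
  have hNt : N ≠ ⊤ := by rw [hNi]; exact ENNReal.ofReal_ne_top
  have hdual : N ≤ ∫⁻ x, ‖f x‖ₑ * ‖kernelOp (fun x y => K y x) g x‖ₑ := by
    have := hK.kernelOp_dual hf tg
    rw [← hh] at this
    simp only [ehg] at this
    rw [integral_complex_ofReal] at this
    calc N = ‖((∫ w, ‖h w‖ ^ p : ℝ) : ℂ)‖ₑ := by
          rw [hNi, ← ofReal_norm, Complex.norm_real, Real.norm_of_nonneg
            (integral_nonneg fun w => by positivity)]
      _ ≤ _ := by
          rw [this]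
          refine (enorm_integral_le_lintegral_enorm _).trans (le_of_eq ?_)
          simp [enorm_mul]
  have hHol := ENNReal.lintegral_mul_le_Lp_mul_Lq (μ := volume) hpq
    (f := fun x => ‖f x‖ₑ) (g := fun x => ‖kernelOp (fun x y => K y x) g x‖ₑ)
    hf.meas.enorm.aemeasurable
    (IsSchurKernel.measurable_kernelOp hK.flip.meas tg.meas).enorm.aemeasurable
  have hd' := hd g tg cg
  simp only [eg] at hd'
  rw [← hN] at hd'
  set F := ∫⁻ x, ‖f x‖ₑ ^ p with hF
  have key : N ≤ F ^ (1 / p) * (C * N) ^ (1 / q) :=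
    (hdual.trans hHol).trans (mul_le_mul' le_rfl (ENNReal.rpow_le_rpow hd' (by positivity)))
  rcases eq_or_ne N 0 with hN0 | hN0
  · rw [hN0]; exact zero_le
  rw [ENNReal.mul_rpow_of_nonneg _ _ (by positivity), ← mul_assoc] at key
  have e3 : N = N ^ (1 / p) * N ^ (1 / q) := by
    rw [← ENNReal.rpow_add _ _ hN0 hNt, one_div, one_div, hpq.inv_add_inv_eq_one, ENNReal.rpow_one]
  have key2 : N ^ (1 / p) ≤ F ^ (1 / p) * C ^ (1 / q) := by
    have key : N ^ (1 / p) * N ^ (1 / q) ≤ F ^ (1 / p) * C ^ (1 / q) * N ^ (1 / q) :=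
      e3.symm.trans_le key
    refine (ENNReal.mul_le_mul_iff_left ?_ ?_).1 key
    · exact (ENNReal.rpow_pos (pos_iff_ne_zero.2 hN0) hNt).ne'
    · exact ENNReal.rpow_ne_top_of_nonneg (by positivity) hNt
  have key3 := ENNReal.rpow_le_rpow key2 hp0.le
  rw [ENNReal.mul_rpow_of_nonneg _ _ hp0.le, ← ENNReal.rpow_mul, ← ENNReal.rpow_mul,
    ← ENNReal.rpow_mul, one_div_mul_cancel hp0.ne', ENNReal.rpow_one, ENNReal.rpow_one] at key3
  rw [mul_comm]
  convert key3 using 3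
  ring

/-- Calderón–Zygmund: an operator bounded on `L²` whose kernel satisfies Hörmander's condition in
both variables is bounded on `L^p`. -/
lemma exists_lintegral_kernelOp_rpow_le {p : ℝ} (hp : 1 < p) :
    ∃ C : ℝ, 0 < C ∧ ∀ (A : ℝ≥0) (K : ℝ → ℝ → ℂ), IsSchurKernel A K → IsHormander K →
      IsHormander (fun x y => K y x) →
      (∀ f, IsTame f → ∫⁻ w, ‖kernelOp K f w‖ₑ ^ 2 ≤ ∫⁻ x, ‖f x‖ₑ ^ 2) →
      ∀ f, IsTame f → Continuous f → Continuous (kernelOp K f) →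
        ∫⁻ w, ‖kernelOp K f w‖ₑ ^ p ≤ ENNReal.ofReal C * ∫⁻ x, ‖f x‖ₑ ^ p := by
  rcases lt_trichotomy p 2 with hp2 | rfl | hp2
  · have h1 : 0 < p - 1 := by linarith
    have h2 : 0 < 2 - p := by linarith
    exact ⟨p * (52 * (2 ^ (p - 1) / (p - 1)) + 4 * (1 / (2 - p))), by positivity,
      fun A K hK hH _ hL f hf hc _ => lintegral_kernelOp_rpow_le hp hp2 hK hH hL hf hc⟩
  · refine ⟨1, one_pos, fun A K hK hH _ hL f hf hc _ => ?_⟩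
    simpa using hL f hf
  · have hpq := Real.HolderConjugate.conjExponent hp
    set q := p.conjExponent with hq
    have hq1 : 1 < q := hpq.symm.lt
    have hq2 : q < 2 := by
      rw [hq, Real.conjExponent, div_lt_iff₀ (by linarith)]; linarith
    have h1 : 0 < q - 1 := by linarith
    have h2 : 0 < 2 - q := by linarith
    set c := q * (52 * (2 ^ (q - 1) / (q - 1)) + 4 * (1 / (2 - q))) with hcdef
    have hc0 : 0 < c := by positivity
    refine ⟨c ^ (p / q), by positivity, fun A K hK hH hH' hL f hf hc hTc => ?_⟩
    rw [← ENNReal.ofReal_rpow_of_pos hc0]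
    refine lintegral_kernelOp_rpow_le_of_dual hpq hp2.le hK hf fun g hg hgc => ?_
    refine lintegral_kernelOp_rpow_le hq1 hq2 hK.flip hH' (fun h hh => ?_) hg (hgc hTc)
    have := lintegral_kernelOp_rpow_le_of_dual (C := 1) Real.HolderConjugate.two_two le_rfl hK.flip
      hh fun g hg _ => by simpa using hL g hg
    simpa using this

lemma sqrt_zpow_mul_le (d : ℤ) {v : ℝ} (h1 : 1 ≤ v) (h2 : v ≤ 2) :
    min √((2 : ℝ) ^ d * v) (2 / √((2 : ℝ) ^ d * v)) ≤
      2 * ((2 : ℝ) ^ (-(1 / 4) : ℝ)) ^ d.natAbs := by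
  set ρ : ℝ := (2 : ℝ) ^ (-(1 / 4) : ℝ) with hρ
  have hρ0 : 0 < ρ := by positivity
  have hρ1 : ρ ≤ 1 := geomRatio_lt_one.le
  have hρ4 : ρ ^ 4 = 2⁻¹ := by
    rw [hρ, ← Real.rpow_natCast, ← Real.rpow_mul (by norm_num)]
    norm_num
  set n := d.natAbs with hn
  have e4 : (ρ ^ (2 * n)) ^ 2 = ((2 : ℝ) ^ n)⁻¹ := by
    rw [← pow_mul, show 2 * n * 2 = 4 * n by ring, pow_mul, hρ4, inv_pow]
  have hle : ρ ^ (2 * n) ≤ ρ ^ n := pow_le_pow_of_le_one hρ0.le hρ1 (by omega)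
  rcases le_total 0 d with hd | hd
  · refine (min_le_right _ _).trans ?_
    have e : (2 : ℝ) ^ d = 2 ^ n := by
      rw [← zpow_natCast, hn, Int.natAbs_of_nonneg hd]
    have hs : (ρ ^ (2 * n))⁻¹ ≤ √((2 : ℝ) ^ d * v) := by
      refine Real.le_sqrt_of_sq_le ?_
      rw [inv_pow, e4, inv_inv, e]
      have : (0 : ℝ) < 2 ^ n := by positivity
      nlinarith
    have hp : 0 < (ρ ^ (2 * n))⁻¹ := by positivity
    calc 2 / √((2 : ℝ) ^ d * v) ≤ 2 / (ρ ^ (2 * n))⁻¹ := by gcongr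
      _ = 2 * ρ ^ (2 * n) := by rw [div_inv_eq_mul]
      _ ≤ _ := by gcongr
  · refine (min_le_left _ _).trans ?_
    have e : (2 : ℝ) ^ d = ((2 : ℝ) ^ n)⁻¹ := by
      rw [← zpow_natCast, hn, ← zpow_neg]; congr 1; omega
    refine Real.sqrt_le_iff.2 ⟨by positivity, ?_⟩
    calc (2 : ℝ) ^ d * v ≤ (ρ ^ (2 * n)) ^ 2 * 2 := by rw [e, e4]; gcongr
      _ ≤ (ρ ^ n) ^ 2 * 4 := by gcongr; norm_num
      _ = _ := by ring

section Sums

variable {A : ℝ≥0} {K : ℤ → ℝ → ℝ → ℂ}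

lemma IsScaleKernel.setLIntegral_sub_le {k k₀ : ℤ} {M : ℝ → ℝ → ℂ} (h : IsScaleKernel A k M)
    (h' : IsScaleKernel A k fun y w => M w y) {c r y : ℝ} (hr : 0 < r) (hy : |y - c| ≤ r)
    (h1 : 1 ≤ (2 : ℝ) ^ k₀ * r) (h2 : (2 : ℝ) ^ k₀ * r ≤ 2) :
    ∫⁻ w in {w | 2 * r ≤ |w - c|}, ‖M w y - M w c‖ₑ ≤
      ENNReal.ofReal (2 * A * ((2 : ℝ) ^ (-(1 / 4) : ℝ)) ^ (k - k₀).natAbs) := by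
  have hs := sqrt_zpow_mul_le (k - k₀) h1 h2
  have e : (2 : ℝ) ^ (k - k₀) * ((2 : ℝ) ^ k₀ * r) = (2 : ℝ) ^ k * r := by
    rw [← mul_assoc, ← zpow_add₀ (by norm_num)]; congr 2; ring
  rw [e] at hs
  set s := √((2 : ℝ) ^ k * r) with hsdef
  have hs0 : 0 < s := by positivity
  have b1 : ∫⁻ w in {w | 2 * r ≤ |w - c|}, ‖M w y - M w c‖ₑ ≤ ENNReal.ofReal (A * s) := by
    refine (setLIntegral_le_lintegral _ _).trans ((h.holder y c).trans ?_)
    rw [ENNReal.ofReal_mul A.coe_nonneg, ENNReal.ofReal_coe_nnreal]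
    refine mul_le_mul' le_rfl (ENNReal.ofReal_le_ofReal ?_)
    rw [hsdef]
    gcongr
  have far : ∀ z, (∀ w, 2 * r ≤ |w - c| → r ≤ |w - z|) →
      ∫⁻ w in {w | 2 * r ≤ |w - c|}, ‖M w z‖ₑ ≤ ENNReal.ofReal (A * s⁻¹) := by
    intro z hz
    have hm : MeasurableSet {w | 2 * r ≤ |w - c|} :=
      measurableSet_le measurable_const (by fun_prop)
    calc ∫⁻ w in {w | 2 * r ≤ |w - c|}, ‖M w z‖ₑ
        ≤ ∫⁻ w in {w | 2 * r ≤ |w - c|}, ENNReal.ofReal s⁻¹ *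
          (‖M w z‖ₑ * ENNReal.ofReal √((2 : ℝ) ^ k * |w - z|)) := by
          refine setLIntegral_mono' hm fun w hw => ?_
          have : 1 ≤ ENNReal.ofReal s⁻¹ * ENNReal.ofReal √((2 : ℝ) ^ k * |w - z|) := by
            rw [← ENNReal.ofReal_mul (by positivity), ENNReal.one_le_ofReal]
            rw [inv_mul_eq_div, one_le_div hs0, hsdef]
            have := hz w hw
            gcongr
          calc ‖M w z‖ₑ = ‖M w z‖ₑ * 1 := (mul_one _).symm
            _ ≤ ‖M w z‖ₑ * (ENNReal.ofReal s⁻¹ * ENNReal.ofReal √((2 : ℝ) ^ k * |w - z|)) :=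
              mul_le_mul' le_rfl this
            _ = _ := by ring
      _ ≤ ENNReal.ofReal s⁻¹ * ∫⁻ w, ‖M w z‖ₑ * ENNReal.ofReal √((2 : ℝ) ^ k * |w - z|) := by
          rw [lintegral_const_mul' _ _ ENNReal.ofReal_ne_top]
          exact mul_le_mul' le_rfl (setLIntegral_le_lintegral _ _)
      _ ≤ ENNReal.ofReal s⁻¹ * A := mul_le_mul' le_rfl (h'.moment z)
      _ = _ := by
          rw [mul_comm, ENNReal.ofReal_mul A.coe_nonneg, ENNReal.ofReal_coe_nnreal]
  have b2 : ∫⁻ w in {w | 2 * r ≤ |w - c|}, ‖M w y - M w c‖ₑ ≤ ENNReal.ofReal (A * (2 / s)) := by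
    calc _ ≤ ∫⁻ w in {w | 2 * r ≤ |w - c|}, (‖M w y‖ₑ + ‖M w c‖ₑ) :=
          lintegral_mono fun w => enorm_sub_le
      _ = (∫⁻ w in {w | 2 * r ≤ |w - c|}, ‖M w y‖ₑ) + ∫⁻ w in {w | 2 * r ≤ |w - c|}, ‖M w c‖ₑ :=
          lintegral_add_left (h.meas_col y).enorm _
      _ ≤ ENNReal.ofReal (A * s⁻¹) + ENNReal.ofReal (A * s⁻¹) := by
          refine add_le_add (far y fun w hw => ?_) (far c fun w hw => by linarith)
          have := abs_sub_le w y c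
          linarith
      _ = _ := by
          rw [← ENNReal.ofReal_add (by positivity) (by positivity)]
          congr 1
          rw [div_eq_mul_inv]; ring
  refine (le_min b1 b2).trans ?_
  rw [← ENNReal.ofReal_min, ← mul_min_of_nonneg _ _ A.coe_nonneg]
  refine ENNReal.ofReal_le_ofReal ?_
  calc (A : ℝ) * min s (2 / s) ≤ A * (2 * ((2 : ℝ) ^ (-(1 / 4) : ℝ)) ^ (k - k₀).natAbs) := by gcongr
    _ = _ := by ring

lemma isHormander_sum (h : ∀ k, IsScaleKernel A k (K k))
    (h' : ∀ k, IsScaleKernel A k fun y w => K k w y) {N : ℝ} (hN : 0 < N)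
    (hAN : 2 * A * geomConst ≤ N) (F : Finset ℤ) :
    IsHormander fun w y => ((N⁻¹ : ℝ) : ℂ) * ∑ k ∈ F, K k w y := by
  intro c r y hr hy
  obtain ⟨n, hn1, hn2⟩ := exists_mem_Ico_zpow (x := r⁻¹) (y := (2 : ℝ)) (by positivity)
    (by norm_num)
  have g1 : 1 ≤ (2 : ℝ) ^ (n + 1) * r := by
    rw [← inv_le_iff_one_le_mul₀ hr]; exact hn2.le
  have g2 : (2 : ℝ) ^ (n + 1) * r ≤ 2 := by
    rw [zpow_add_one₀ (by norm_num)]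
    have : (2 : ℝ) ^ n * r ≤ r⁻¹ * r := by gcongr
    rw [inv_mul_cancel₀ hr.ne'] at this
    linarith
  calc ∫⁻ w in {w | 2 * r ≤ |w - c|},
        ‖((N⁻¹ : ℝ) : ℂ) * ∑ k ∈ F, K k w y - ((N⁻¹ : ℝ) : ℂ) * ∑ k ∈ F, K k w c‖ₑ
      ≤ ∫⁻ w in {w | 2 * r ≤ |w - c|}, ENNReal.ofReal N⁻¹ * ∑ k ∈ F, ‖K k w y - K k w c‖ₑ := by
        refine lintegral_mono fun w => ?_
        simp only
        rw [← mul_sub, ← Finset.sum_sub_distrib, enorm_mul]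
        refine mul_le_mul' (le_of_eq ?_) (enorm_sum_le _ _)
        rw [← ofReal_norm, Complex.norm_real, Real.norm_of_nonneg (by positivity)]
    _ = ENNReal.ofReal N⁻¹ * ∑ k ∈ F, ∫⁻ w in {w | 2 * r ≤ |w - c|}, ‖K k w y - K k w c‖ₑ := by
        rw [lintegral_const_mul' _ _ ENNReal.ofReal_ne_top, lintegral_finsetSum]
        intro k _
        exact (((h k).meas_col y).sub ((h k).meas_col c)).enorm
    _ ≤ ENNReal.ofReal N⁻¹ * ∑ k ∈ F, ENNReal.ofReal
          (2 * A * ((2 : ℝ) ^ (-(1 / 4) : ℝ)) ^ (k - (n + 1)).natAbs) :=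
        mul_le_mul' le_rfl (Finset.sum_le_sum fun k _ =>
          (h k).setLIntegral_sub_le (h' k) hr hy g1 g2)
    _ ≤ 1 := by
        rw [← ENNReal.ofReal_sum_of_nonneg (fun k _ => by positivity),
          ← ENNReal.ofReal_mul (by positivity), ENNReal.ofReal_le_one, ← Finset.mul_sum]
        have := sum_pow_natAbs_le F (n + 1)
        calc _ ≤ N⁻¹ * (2 * A * geomConst) := by gcongr
          _ ≤ N⁻¹ * N := by gcongr
          _ = 1 := inv_mul_cancel₀ hN.ne'

lemma exists_isSchurKernel_sum (h : ∀ k, IsSchurKernel A (K k)) (c : ℂ) (F : Finset ℤ) :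
    ∃ B : ℝ≥0, IsSchurKernel B fun w y => c * ∑ k ∈ F, K k w y := by
  refine ⟨‖c‖₊ * ∑ k ∈ F, A, ?_, fun w => ?_, fun y => ?_⟩
  · simp only [Function.uncurry_def]
    exact (Finset.measurable_fun_sum _ fun k _ => (h k).meas).const_mul _
  · calc _ ≤ ∫⁻ y, ‖c‖ₑ * ∑ k ∈ F, ‖K k w y‖ₑ := lintegral_mono fun y => by
          rw [enorm_mul]; exact mul_le_mul' le_rfl (enorm_sum_le _ _)
      _ = ‖c‖ₑ * ∑ k ∈ F, ∫⁻ y, ‖K k w y‖ₑ := by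
          rw [lintegral_const_mul' _ _ enorm_ne_top, lintegral_finsetSum]
          exact fun k _ => ((h k).meas_row w).enorm
      _ ≤ _ := by
          push_cast
          exact mul_le_mul' le_rfl (Finset.sum_le_sum fun k _ => (h k).row w)
  · calc _ ≤ ∫⁻ w, ‖c‖ₑ * ∑ k ∈ F, ‖K k w y‖ₑ := lintegral_mono fun w => by
          rw [enorm_mul]; exact mul_le_mul' le_rfl (enorm_sum_le _ _)
      _ = ‖c‖ₑ * ∑ k ∈ F, ∫⁻ w, ‖K k w y‖ₑ := by
          rw [lintegral_const_mul' _ _ enorm_ne_top, lintegral_finsetSum]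
          exact fun k _ => ((h k).meas_col y).enorm
      _ ≤ _ := by
          push_cast
          exact mul_le_mul' le_rfl (Finset.sum_le_sum fun k _ => (h k).col y)

lemma kernelOp_sum (h : ∀ k, IsSchurKernel A (K k)) (c : ℂ) (F : Finset ℤ) {f : ℝ → ℂ}
    (hf : IsTame f) (w : ℝ) :
    kernelOp (fun w y => c * ∑ k ∈ F, K k w y) f w = c * ∑ k ∈ F, kernelOp (K k) f w := by
  obtain ⟨M, hM⟩ := hf.bdd
  simp only [kernelOp, mul_assoc, Finset.sum_mul]
  rw [integral_const_mul, integral_finsetSum]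
  exact fun k _ => (h k).integrable_row_mul w hf.meas hM

end Sums

lemma continuous_convAt (k : ℤ) (a : 𝓢(ℝ, ℂ)) {f : ℝ → ℂ} (hf : IsTame f) :
    Continuous (convAt k a f) := by
  obtain ⟨C, hC⟩ := (isTame_dil k a).bdd
  have hd := continuous_dil k a.continuous
  unfold convAt kernelOp
  refine continuous_of_dominated (bound := fun x => C * ‖f x‖) (fun y => ?_) (fun y => ?_)
    (hf.integrable.norm.const_mul C) (ae_of_all _ fun x => by fun_prop)
  · exact ((hd.comp (by fun_prop)).aestronglyMeasurable).mul hf.integrable.aestronglyMeasurable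
  · refine ae_of_all _ fun x => ?_
    rw [norm_mul]
    gcongr
    exact hC _

lemma IsTame.comp_nearId {σ : ℝ} {Φ X : ℝ → ℝ} (h : IsNearId σ Φ X) {f : ℝ → ℂ} (hf : IsTame f) :
    IsTame fun x => f (Φ x) := by
  obtain ⟨M, hM⟩ := hf.exists_bound_nonneg
  refine IsTame.of_enorm_le (hf.meas.comp h.continuous.measurable) ?_ fun x => hM _
  exact (h.lintegral_comp_le hf.meas.enorm).trans_lt
    (ENNReal.mul_lt_top (by simp) hf.lintegral_lt_top)

/-- The commutator of a near-identity change of variables with the frequency projections, summed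
over scales, is bounded on `L^p` with a gain. -/
theorem exists_comm_Lp {p : ℝ} (hp : 1 < p) (a q : 𝓢(ℝ, ℂ)) (ha0 : ∫ r, a r = 0)
    (hq0 : ∫ r, q r = 0) (hqa : ∀ r, ∫ z, q z * a (r - z) = a r) :
    ∃ C : ℝ, 0 < C ∧ ∀ (σ : ℝ) (Φ X : ℝ → ℝ), IsNearId σ Φ X → 0 < σ → ∀ f : ℝ → ℂ, IsTame f →
      Continuous f → ∀ F : Finset ℤ,
      ∫⁻ x, ‖∑ k ∈ F, (convAt k a f (Φ x) - ∫ u, dil k q (x - u) * convAt k a f (Φ u))‖ₑ ^ p ≤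
        ENNReal.ofReal (C * √σ ^ p) * ∫⁻ x, ‖f x‖ₑ ^ p := by
  obtain ⟨A, hA, hK⟩ := exists_commKernel_isScaleKernel a q hqa
  obtain ⟨C₂, hC₂, hL2⟩ := exists_commKernel_L2 a q ha0 hq0 hqa
  obtain ⟨C, hC, hCZ⟩ := exists_lintegral_kernelOp_rpow_le hp
  have hg := geomConst_pos
  set B : ℝ := 2 * A * geomConst + √C₂ with hB
  have hB0 : 0 < B := by positivity
  refine ⟨2 * (B ^ p * C), by positivity, fun σ Φ X h hσ f hf hfc F => ?_⟩
  have hp0 : 0 < p := by linarith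
  set N : ℝ := B * √σ with hN
  have hN0 : 0 < N := by positivity
  have hAN : 2 * ((A * (√σ).toNNReal : ℝ≥0) : ℝ) * geomConst ≤ N := by
    push_cast
    rw [Real.coe_toNNReal _ (Real.sqrt_nonneg _), hN, hB]
    have : 0 ≤ √C₂ * √σ := by positivity
    nlinarith
  set K : ℤ → ℝ → ℝ → ℂ := commKernel a q Φ X with hKdef
  have hK1 : ∀ k, IsScaleKernel (A * (√σ).toNNReal) k (K k) := fun k => (hK σ Φ X h k).1
  have hK2 : ∀ k, IsScaleKernel (A * (√σ).toNNReal) k (fun y w => K k w y) :=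
    fun k => (hK σ Φ X h k).2
  have hS : ∀ k, IsSchurKernel (A * (√σ).toNNReal) (K k) := fun k => (hK1 k).toIsSchurKernel
  obtain ⟨B', hB'⟩ := exists_isSchurKernel_sum hS ((N⁻¹ : ℝ) : ℂ) F
  have hop := fun (g : ℝ → ℂ) (hg : IsTame g) => kernelOp_sum hS ((N⁻¹ : ℝ) : ℂ) F hg
  set M : ℝ → ℝ → ℂ := fun w y => ((N⁻¹ : ℝ) : ℂ) * ∑ k ∈ F, K k w y with hM
  have nN : ‖((N⁻¹ : ℝ) : ℂ)‖ = N⁻¹ := by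
    rw [Complex.norm_real, Real.norm_of_nonneg (by positivity)]
  have hL : ∀ g, IsTame g → ∫⁻ w, ‖kernelOp M g w‖ₑ ^ 2 ≤ ∫⁻ x, ‖g x‖ₑ ^ 2 := fun g hg => by
    rw [(hB'.kernelOp_tame hg).lintegral_sq, hg.lintegral_sq]
    refine ENNReal.ofReal_le_ofReal ?_
    simp only [hop g hg, norm_mul, mul_pow, nN]
    rw [integral_const_mul, inv_pow, inv_mul_le_iff₀ (by positivity)]
    refine (hL2 σ Φ X h hσ g hg F).trans ?_
    have hi : 0 ≤ ∫ x, ‖g x‖ ^ 2 := integral_nonneg fun x => by positivity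
    refine mul_le_mul_of_nonneg_right ?_ hi
    rw [hN, mul_pow, Real.sq_sqrt hσ.le]
    refine mul_le_mul_of_nonneg_right ?_ hσ.le
    calc C₂ = √C₂ ^ 2 := (Real.sq_sqrt hC₂.le).symm
      _ ≤ B ^ 2 := by
        have : 0 ≤ 2 * A * geomConst := by positivity
        gcongr; rw [hB]; linarith
  have hcK : ∀ k, Continuous (kernelOp (K k) f) := fun k => by
    have e : kernelOp (K k) f = fun w => convAt k a f w -
        convAt k q (fun u => convAt k a f (Φ u)) (X w) :=
      funext fun w => kernelOp_commKernel h k hf w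
    rw [e]
    exact (continuous_convAt k a hf).sub ((continuous_convAt k q
      ((isTame_convAt k a hf).comp_nearId h)).comp h.continuous_inv)
  have hcM : Continuous (kernelOp M f) := by
    rw [show kernelOp M f = fun w => ((N⁻¹ : ℝ) : ℂ) * ∑ k ∈ F, kernelOp (K k) f w from
      funext (hop f hf)]
    exact continuous_const.mul (continuous_finsetSum _ fun k _ => hcK k)
  have main := hCZ B' M hB' (isHormander_sum hK1 hK2 hN0 hAN F)
    (isHormander_sum hK2 hK1 hN0 hAN F) hL f hf hfc hcM
  have e1 : ∀ x, ∑ k ∈ F, (convAt k a f (Φ x) - ∫ u, dil k q (x - u) * convAt k a f (Φ u)) =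
      (N : ℂ) * kernelOp M f (Φ x) := fun x => by
    rw [hop f hf, ← mul_assoc, ← Complex.ofReal_mul, mul_inv_cancel₀ hN0.ne', Complex.ofReal_one,
      one_mul]
    refine Finset.sum_congr rfl fun k _ => ?_
    rw [hKdef, kernelOp_commKernel h k hf, h.left_inv]
  have eN : ‖(N : ℂ)‖ₑ = ENNReal.ofReal N := by
    rw [← ofReal_norm, Complex.norm_real, Real.norm_of_nonneg hN0.le]
  calc _ = ∫⁻ x, ENNReal.ofReal N ^ p * ‖kernelOp M f (Φ x)‖ₑ ^ p := by
        simp only [e1, enorm_mul, eN, ENNReal.mul_rpow_of_nonneg _ _ hp0.le]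
    _ = ENNReal.ofReal N ^ p * ∫⁻ x, ‖kernelOp M f (Φ x)‖ₑ ^ p :=
        lintegral_const_mul' _ _ (ENNReal.rpow_ne_top_of_nonneg hp0.le ENNReal.ofReal_ne_top)
    _ ≤ ENNReal.ofReal N ^ p * (2 * (ENNReal.ofReal C * ∫⁻ x, ‖f x‖ₑ ^ p)) := by
        refine mul_le_mul' le_rfl ((h.lintegral_comp_le (f := fun w => ‖kernelOp M f w‖ₑ ^ p)
          (hcM.measurable.enorm.pow_const p)).trans (mul_le_mul' le_rfl main))
    _ = _ := by
        rw [ENNReal.ofReal_rpow_of_pos hN0, show (2 : ℝ≥0∞) = ENNReal.ofReal 2 by simp,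
          ← mul_assoc, ← mul_assoc, ← ENNReal.ofReal_mul (by positivity),
          ← ENNReal.ofReal_mul (by positivity), hN, Real.mul_rpow hB0.le (Real.sqrt_nonneg _)]
        congr 2
        ring

section Plancherel

variable {V : Type*} [NormedAddCommGroup V] [InnerProductSpace ℝ V] [FiniteDimensional ℝ V]
  [MeasurableSpace V] [BorelSpace V]

lemma integral_fourier_mul_eq {f g : V → ℂ} (hf : Integrable f) (hg : Integrable g) :
    ∫ ξ, 𝓕 f ξ * g ξ = ∫ x, f x * 𝓕 g x := by
  have := VectorFourier.integral_fourierIntegral_smul_eq_flip (μ := volume) (ν := volume)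
    (L := innerₗ V) Real.continuous_fourierChar continuous_inner hf hg
  simp only [flip_innerₗ, smul_eq_mul] at this
  exact this

lemma continuous_fourier {f : V → ℂ} (hf : Integrable f) : Continuous (𝓕 f) :=
  VectorFourier.fourierIntegral_continuous Real.continuous_fourierChar continuous_inner hf

lemma lintegral_fourier_sq {f : V → ℂ} (hf : Integrable f) (hf2 : MemLp f 2) :
    ∫⁻ ξ, ‖𝓕 f ξ‖ₑ ^ 2 = ∫⁻ x, ‖f x‖ₑ ^ 2 := by
  set f₂ := hf2.toLp f with hf₂
  have hae : ∀ᵐ ξ, (𝓕 f₂ : Lp ℂ 2 (volume : Measure V)) ξ = 𝓕 f ξ := by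
    refine ae_eq_of_integral_contDiff_smul_eq ?_ (continuous_fourier hf).locallyIntegrable ?_
    · exact (Lp.memLp _).locallyIntegrable (by norm_num)
    · intro g hg hgc
      have hg₁ : HasCompactSupport (Complex.ofRealCLM ∘ g) := hgc.comp_left rfl
      have hg₂ : ContDiff ℝ ∞ (Complex.ofRealCLM ∘ g) := by fun_prop
      set h := hg₁.toSchwartzMap hg₂ with hh
      have hhv : ∀ x, h x = ((g x : ℝ) : ℂ) := fun x => rfl
      have e1 := congrArg (fun T => T h) (Lp.fourier_toTemperedDistribution_eq f₂)
      simp only [TemperedDistribution.fourier_apply, Lp.toTemperedDistribution_apply] at e1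
      calc ∫ x, g x • (𝓕 f₂ : Lp ℂ 2 (volume : Measure V)) x
          = ∫ x, h x • (𝓕 f₂ : Lp ℂ 2 (volume : Measure V)) x := by
            refine integral_congr_ae (ae_of_all _ fun x => ?_)
            simp only [hhv, Complex.real_smul, smul_eq_mul]
        _ = ∫ x, (𝓕 h) x • f₂ x := e1.symm
        _ = ∫ x, f x * 𝓕 h x := by
            refine integral_congr_ae ?_
            filter_upwards [hf2.coeFn_toLp] with x hx
            rw [hx, smul_eq_mul, mul_comm]
        _ = ∫ ξ, 𝓕 f ξ * h ξ := by
            rw [SchwartzMap.fourier_coe]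
            exact (integral_fourier_mul_eq hf h.integrable).symm
        _ = ∫ x, g x • 𝓕 f x := by
            refine integral_congr_ae (ae_of_all _ fun x => ?_)
            simp only [hhv, Complex.real_smul]
            ring
  have e : ∀ g : Lp ℂ 2 (volume : Measure V), ∫⁻ x, ‖g x‖ₑ ^ 2 = ‖g‖ₑ ^ 2 := fun g => by
    rw [Lp.enorm_def, eLpNorm_eq_lintegral_rpow_enorm_toReal (by norm_num) (by norm_num)]
    simp only [ENNReal.toReal_ofNat, ENNReal.rpow_ofNat]
    rw [← ENNReal.rpow_natCast, ← ENNReal.rpow_mul]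
    norm_num
  calc ∫⁻ ξ, ‖𝓕 f ξ‖ₑ ^ 2 = ∫⁻ ξ, ‖(𝓕 f₂ : Lp ℂ 2 (volume : Measure V)) ξ‖ₑ ^ 2 := by
        refine lintegral_congr_ae ?_
        filter_upwards [hae] with x hx
        rw [hx]
    _ = ∫⁻ x, ‖f₂ x‖ₑ ^ 2 := by
        rw [e, e, ← ofReal_norm, ← ofReal_norm, Lp.norm_fourier_eq]
    _ = _ := by
        refine lintegral_congr_ae ?_
        filter_upwards [hf2.coeFn_toLp] with x hx
        rw [hx]

end Plancherel

section Line

lemma exists_schwartz_fourier_eq {χ : ℝ → ℂ} (h1 : ContDiff ℝ ∞ χ) (h2 : HasCompactSupport χ) :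
    ∃ b : 𝓢(ℝ, ℂ), ∀ ξ, 𝓕 b ξ = χ ξ := by
  refine ⟨𝓕⁻ (h2.toSchwartzMap h1), fun ξ => ?_⟩
  rw [FourierTransform.fourier_fourierInv_eq]
  rfl

lemma integral_schwartz_eq_zero {b : 𝓢(ℝ, ℂ)} (h : 𝓕 b 0 = 0) : ∫ r, b r = 0 := by
  rw [SchwartzMap.fourier_coe, Real.fourier_eq] at h
  simpa using h

lemma integral_mul_eq_of_fourier_mul_eq {a q : 𝓢(ℝ, ℂ)} (h : ∀ ξ, 𝓕 q ξ * 𝓕 a ξ = 𝓕 a ξ) (r : ℝ) :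
    ∫ z, q z * a (r - z) = a r := by
  have e : SchwartzMap.convolution (ContinuousLinearMap.mul ℂ ℂ) q a = a := by
    have e' : 𝓕 (SchwartzMap.convolution (ContinuousLinearMap.mul ℂ ℂ) q a) = 𝓕 a := by
      rw [SchwartzMap.fourier_convolution]
      ext ξ
      simpa using h ξ
    have := congrArg (fun T : 𝓢(ℝ, ℂ) => 𝓕⁻ T) e'
    simpa using this
  have := SchwartzMap.convolution_apply (ContinuousLinearMap.mul ℂ ℂ) q a r
  rw [e] at this
  rw [this]
  rfl

end Line

section Plane

lemma continuous_point : Continuous fun z : ℝ × ℝ => (!₂[z.1, z.2] : Plane) := by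
  refine (PiLp.continuous_toLp 2 _).comp ?_
  refine continuous_pi fun i => ?_
  fin_cases i
  · exact continuous_fst
  · exact continuous_snd

lemma lintegral_plane {h : Plane → ℝ≥0∞} (hh : Measurable h) :
    ∫⁻ x, h x = ∫⁻ a, ∫⁻ b, h !₂[a, b] := by
  have e1 := (EuclideanSpace.volume_preserving_symm_measurableEquiv_toLp (Fin 2)).symm
  have e2 := (volume_preserving_finTwoArrow ℝ).symm
  have e3 := e1.comp e2
  rw [← e3.lintegral_comp hh, Measure.volume_eq_prod, lintegral_prod]
  · rfl
  · exact (hh.comp e3.measurable).aemeasurable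

lemma measurable_coord (i : Fin 2) : Measurable fun x : Plane => x i :=
  (EuclideanSpace.proj (𝕜 := ℝ) i).continuous.measurable

lemma continuous_coord (i : Fin 2) : Continuous fun x : Plane => x i :=
  (EuclideanSpace.proj (𝕜 := ℝ) i).continuous

/-- Convolution in the second variable with the dilate of `b` to scale `2 ^ (-k)`. -/
noncomputable def partialConv (k : ℤ) (b : ℝ → ℂ) (F : Plane → ℂ) (x : Plane) : ℂ :=
  ∫ z, dil k b z * F !₂[x 0, x 1 - z]

lemma point_sub_eq (x : Plane) (z : ℝ) :
    (!₂[x 0, x 1 - z] : Plane) = x + (-z) • EuclideanSpace.single 1 1 := by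
  ext i
  fin_cases i <;> simp [sub_eq_add_neg]

variable {b : 𝓢(ℝ, ℂ)} {F : Plane → ℂ} {k : ℤ}

lemma continuous_shift : Continuous fun y : Plane × ℝ => (!₂[y.1 0, y.1 1 - y.2] : Plane) :=
  continuous_point.comp (((continuous_coord 0).comp continuous_fst).prodMk
    (((continuous_coord 1).comp continuous_fst).sub continuous_snd))

lemma integrable_partialConv_prod (hF : Integrable F) (hc : Continuous F) :
    Integrable (fun y : Plane × ℝ => dil k b y.2 * F !₂[y.1 0, y.1 1 - y.2])
      (volume.prod volume) := by
  have hcont : Continuous fun y : Plane × ℝ => dil k b y.2 * F !₂[y.1 0, y.1 1 - y.2] :=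
    ((continuous_dil k b.continuous).comp continuous_snd).mul (hc.comp continuous_shift)
  refine (integrable_prod_iff' hcont.aestronglyMeasurable).2 ⟨ae_of_all _ fun z => ?_, ?_⟩
  · simp only [point_sub_eq]
    exact (hF.comp_add_right _).const_mul _
  · simp only [norm_mul, point_sub_eq]
    have e : ∀ z : ℝ, ∫ x : Plane, ‖dil k b z‖ * ‖F (x + (-z) • EuclideanSpace.single 1 1)‖ =
        ‖dil k b z‖ * ∫ x, ‖F x‖ := fun z => by
      rw [integral_const_mul, integral_add_right_eq_self (fun x => ‖F x‖)]
    simp only [e]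
    exact (isTame_dil k b).integrable.norm.mul_const _

lemma integrable_partialConv (hF : Integrable F) (hc : Continuous F) :
    Integrable (partialConv k b F) :=
  (integrable_partialConv_prod hF hc).integral_prod_left

lemma continuous_partialConv (hc : Continuous F) {M : ℝ} (hM : ∀ x, ‖F x‖ ≤ M) :
    Continuous (partialConv k b F) := by
  have hd := continuous_dil k b.continuous
  refine continuous_of_dominated (bound := fun z => ‖dil k b z‖ * M) (fun x => ?_) (fun x => ?_)
    ((isTame_dil k b).integrable.norm.mul_const _) (ae_of_all _ fun z => ?_)
  · exact (hd.mul (hc.comp (continuous_shift.comp (by fun_prop : Continuous fun z : ℝ =>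
      (x, z))))).aestronglyMeasurable
  · refine ae_of_all _ fun z => ?_
    rw [norm_mul]
    gcongr
    exact hM _
  · exact continuous_const.mul (hc.comp (continuous_shift.comp (by fun_prop : Continuous
      fun x : Plane => (x, z))))

lemma fourier_dil (k : ℤ) (b : ℝ → ℂ) (s : ℝ) : 𝓕 (dil k b) s = 𝓕 b ((2 : ℝ) ^ (-k) * s) := by
  have e := integral_dil k fun z => Real.fourierChar (-(z * ((2 : ℝ) ^ (-k) * s))) • b z
  rw [Real.fourier_real_eq, Real.fourier_real_eq, ← e]
  congr 1
  ext v
  simp only [dil, Circle.smul_def, smul_eq_mul]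
  rw [show (2 : ℝ) ^ k * v * ((2 : ℝ) ^ (-k) * s) = v * s by
    rw [zpow_neg]; field_simp]
  ring

lemma fourier_partialConv (hF : Integrable F) (hc : Continuous F) (ξ : Plane) :
    𝓕 (partialConv k b F) ξ = 𝓕 b ((2 : ℝ) ^ (-k) * ξ 1) * 𝓕 F ξ := by
  have hi := integrable_partialConv_prod (k := k) (b := b) hF hc
  have hi2 : Integrable (fun y : Plane × ℝ => (Real.fourierChar (-inner ℝ y.1 ξ) : ℂ) *
      (dil k b y.2 * F !₂[y.1 0, y.1 1 - y.2])) (volume.prod volume) := by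
    refine hi.bdd_mul (c := 1) ?_ (ae_of_all _ fun y => (Circle.norm_coe _).le)
    have : Continuous fun y : Plane × ℝ => (Real.fourierChar (-inner ℝ y.1 ξ) : ℂ) := by
      have := Real.continuous_fourierChar
      fun_prop
    exact this.aestronglyMeasurable
  have shift : ∀ z : ℝ, ∫ x : Plane, (Real.fourierChar (-inner ℝ x ξ) : ℂ) *
      F !₂[x 0, x 1 - z] = (Real.fourierChar (-(z * ξ 1)) : ℂ) * 𝓕 F ξ := fun z => by
    have := congrFun (VectorFourier.fourierIntegral_comp_add_right Real.fourierChar volume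
      (innerₗ Plane) F ((-z) • EuclideanSpace.single 1 1)) ξ
    simp only [point_sub_eq]
    rw [Real.fourier_eq]
    simp only [VectorFourier.fourierIntegral, Function.comp_def, innerₗ_apply_apply,
      Circle.smul_def, smul_eq_mul, real_inner_smul_left, EuclideanSpace.inner_single_left,
      conj_trivial, one_mul] at this ⊢
    rw [this, neg_mul]
  rw [SchwartzMap.fourier_coe, ← fourier_dil, Real.fourier_eq, Real.fourier_real_eq]
  simp only [partialConv, Circle.smul_def, smul_eq_mul, ← integral_const_mul, ← integral_mul_const]
  rw [integral_integral_swap hi2]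
  refine integral_congr_ae (ae_of_all _ fun z => ?_)
  simp only
  rw [mul_right_comm, ← shift z, ← integral_mul_const]
  congr 1
  ext x
  ring

/-- Frequency projections in the second variable are convolutions. -/
lemma proj₂_eq_partialConv {χ : ℝ → ℂ} (hb : ∀ s, 𝓕 b s = χ s) (hF : Integrable F)
    (hc : Continuous F) {M : ℝ} (hM : ∀ x, ‖F x‖ ≤ M) (hi : Integrable (freqCut χ k F)) :
    proj₂ χ k F = partialConv k b F := by
  have e : freqCut χ k F = 𝓕 (partialConv k b F) := by
    ext ξ
    rw [fourier_partialConv hF hc, freqCut, ← hb]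
  rw [proj₂, e]
  refine Continuous.fourierInv_fourier_eq (continuous_partialConv hc hM)
    (integrable_partialConv hF hc) ?_
  rwa [← e]

end Plane

section SchwartzEstimates

variable {E F : Type*} [NormedAddCommGroup E] [NormedSpace ℝ E] [NormedAddCommGroup F]
  [NormedSpace ℝ F]

lemma schwartz_hasFDerivAt (g : 𝓢(E, F)) (x : E) :
    HasFDerivAt g (SchwartzMap.fderivCLM ℝ E F g x) x :=
  g.differentiableAt.hasFDerivAt

lemma schwartz_norm_sub_le (g : 𝓢(E, F)) (N : ℕ) :
    ∃ C : ℝ, 0 < C ∧ ∀ y y', ‖y - y'‖ ≤ 2 → ‖g y - g y'‖ ≤ C * ‖y - y'‖ / (1 + ‖y‖) ^ N := by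
  obtain ⟨C, hC, h⟩ := schwartz_norm_le (SchwartzMap.fderivCLM ℝ E F g) N
  refine ⟨C * 3 ^ N, by positivity, fun y y' hy => ?_⟩
  have hb : ∀ z ∈ Metric.closedBall y 2, ‖SchwartzMap.fderivCLM ℝ E F g z‖ ≤
      C * 3 ^ N / (1 + ‖y‖) ^ N := fun z hz => by
    refine (h z).trans ?_
    rw [div_le_div_iff₀ (by positivity) (by positivity), mul_assoc, ← mul_pow]
    have h1 : ‖y‖ ≤ ‖z‖ + 2 := by
      have := norm_sub_norm_le y z
      rw [Metric.mem_closedBall, dist_comm, dist_eq_norm] at hz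
      linarith
    have h2 : 0 ≤ ‖z‖ := norm_nonneg z
    gcongr
    linarith
  have := (convex_closedBall y 2).norm_image_sub_le_of_norm_hasFDerivWithin_le
    (fun z _ => (schwartz_hasFDerivAt g z).hasFDerivWithinAt) hb
    (x := y') (y := y) (by rwa [Metric.mem_closedBall, dist_comm, dist_eq_norm]) (by simp)
  calc _ ≤ _ := this
    _ = _ := by ring

lemma hasDerivAt_schwartz_line (g : 𝓢(E, F)) (x v : E) (s : ℝ) :
    HasDerivAt (fun s : ℝ => g (x - s • v)) (-(SchwartzMap.fderivCLM ℝ E F g (x - s • v) v)) s := by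
  have h1 : HasDerivAt (fun s : ℝ => x - s • v) (-v) s := by
    simpa using ((hasDerivAt_id s).smul_const v).const_sub x
  simpa [Function.comp_def] using (schwartz_hasFDerivAt g (x - s • v)).comp_hasDerivAt s h1

lemma norm_sub_le_of_line (g : 𝓢(E, F)) (x v : E) {K : ℝ}
    (hK : ∀ s ∈ Icc (0 : ℝ) 1, ‖SchwartzMap.fderivCLM ℝ E F g (x - s • v)‖ * ‖v‖ ≤ K) :
    ‖g (x - v) - g x‖ ≤ K := by
  have := norm_image_sub_le_of_norm_deriv_le_segment_01' (f := fun s : ℝ => g (x - s • v))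
    (fun s _ => (hasDerivAt_schwartz_line g x v s).hasDerivWithinAt) (C := K) fun s hs => by
      rw [norm_neg]
      exact (ContinuousLinearMap.le_opNorm _ _).trans (hK s ⟨hs.1, hs.2.le⟩)
  simpa using this

lemma norm_sub_sub_le_of_line (g : 𝓢(E, F)) (x v x' v' : E) {K : ℝ}
    (hK : ∀ s ∈ Icc (0 : ℝ) 1, ‖SchwartzMap.fderivCLM ℝ E F g (x - s • v) -
      SchwartzMap.fderivCLM ℝ E F g (x' - s • v')‖ * ‖v‖ +
      ‖SchwartzMap.fderivCLM ℝ E F g (x' - s • v')‖ * ‖v - v'‖ ≤ K) :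
    ‖(g (x - v) - g x) - (g (x' - v') - g x')‖ ≤ K := by
  have := norm_image_sub_le_of_norm_deriv_le_segment_01'
    (f := fun s : ℝ => g (x - s • v) - g (x' - s • v'))
    (fun s _ => ((hasDerivAt_schwartz_line g x v s).sub
      (hasDerivAt_schwartz_line g x' v' s)).hasDerivWithinAt) (C := K) fun s hs => by
      refine le_trans ?_ (hK s ⟨hs.1, hs.2.le⟩)
      set T := SchwartzMap.fderivCLM ℝ E F g (x - s • v)
      set T' := SchwartzMap.fderivCLM ℝ E F g (x' - s • v')
      have e : -T v - -T' v' = -((T - T') v + T' (v - v')) := by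
        simp only [sub_apply, map_sub]; abel
      rw [e, norm_neg]
      exact (norm_add_le _ _).trans (add_le_add (ContinuousLinearMap.le_opNorm _ _)
        (ContinuousLinearMap.le_opNorm _ _))
  convert this using 2
  simp only [one_smul, zero_smul, sub_zero]
  abel

end SchwartzEstimates

/-- The properties of the curve and the cutoff used in the plane: the curve grows at most linearly
and the cutoff is supported where the curve has small slope. -/
structure IsCutCurve (L B : ℝ) (γ φt : ℝ → ℝ) : Prop where
  pos_L : 0 < L
  pos_B : 0 < B
  cont : Continuous γ
  bound : ∀ t, |γ t| ≤ L * |t|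
  small : ∀ t, |γ t| ≤ 1 / 2
  cont_cut : Continuous φt
  bound_cut : ∀ t, |φt t| ≤ B
  near_cut : ∀ t, |φt t - 1| ≤ B * |t|
  supp_cut : ∀ t, φt t ≠ 0 → |t| ≤ 1 ∧ L * |t| ≤ 1 / 2

/-- The displacement `(t, u(x) γ(t))`. -/
noncomputable def disp (γ : ℝ → ℝ) (u : Plane → ℝ) (x : Plane) (t : ℝ) : Plane := !₂[t, u x * γ t]

/-- The integrand of the principal value, regularized at `t = 0`. -/
noncomputable def hilbertIntegrand (γ φt : ℝ → ℝ) (u : Plane → ℝ) (g : Plane → ℂ) (x : Plane)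
    (t : ℝ) : ℂ :=
  (g !₂[x 0 - t, x 1 - u x * γ t] * (φt t : ℂ) - g x) / t

section Integrand

variable {L B : ℝ} {γ φt : ℝ → ℝ} {u : Plane → ℝ}

lemma sub_disp (x : Plane) (t : ℝ) : x - disp γ u x t = !₂[x 0 - t, x 1 - u x * γ t] := by
  ext i
  fin_cases i <;> simp [disp]

lemma norm_point_le (a b : ℝ) : ‖(!₂[a, b] : Plane)‖ ≤ |a| + |b| := by
  rw [EuclideanSpace.norm_eq, Fin.sum_univ_two]
  refine Real.sqrt_le_iff.2 ⟨by positivity, ?_⟩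
  simp only [Real.norm_eq_abs, sq_abs, Matrix.cons_val_zero, Matrix.cons_val_one]
  have := mul_nonneg (abs_nonneg a) (abs_nonneg b)
  rw [add_sq, sq_abs, sq_abs]
  linarith

lemma abs_sub_le_of_lipschitz (hu : LipschitzWith (1 / 2) u) (x y : Plane) :
    |u x - u y| ≤ 1 / 2 * ‖x - y‖ := by
  have := hu.dist_le_mul x y
  rwa [Real.dist_eq, dist_eq_norm, show ((1 / 2 : ℝ≥0) : ℝ) = 1 / 2 by norm_num] at this

lemma abs_le_of_lipschitz (hu : LipschitzWith (1 / 2) u) (x : Plane) :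
    |u x| ≤ |u 0| + 1 / 2 * ‖x‖ := by
  have h1 := abs_sub_le_of_lipschitz hu x 0
  rw [sub_zero] at h1
  have h2 := abs_sub_abs_le_abs_sub (u x) (u 0)
  linarith

lemma norm_disp_sub_le (hu : LipschitzWith (1 / 2) u) (x x' : Plane) (t : ℝ) :
    ‖disp γ u x t - disp γ u x' t‖ ≤ 1 / 2 * ‖x - x'‖ * |γ t| := by
  have e : disp γ u x t - disp γ u x' t = !₂[0, (u x - u x') * γ t] := by
    ext i
    fin_cases i <;> simp [disp, sub_mul]
  rw [e]
  refine (norm_point_le _ _).trans ?_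
  rw [abs_zero, zero_add, abs_mul]
  gcongr
  exact abs_sub_le_of_lipschitz hu x x'

lemma norm_disp_le (h : IsCutCurve L B γ φt) (hu : LipschitzWith (1 / 2) u) (x : Plane) (t : ℝ) :
    ‖disp γ u x t‖ ≤ |t| * ((1 + L + L * |u 0|) * (1 + ‖x‖)) := by
  have h0 := h.pos_L
  have hx := norm_nonneg x
  calc ‖disp γ u x t‖ ≤ |t| + |u x| * |γ t| := (norm_point_le _ _).trans (by rw [abs_mul])
    _ ≤ |t| + (|u 0| + 1 / 2 * ‖x‖) * (L * |t|) := by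
        gcongr
        · exact abs_le_of_lipschitz hu x
        · exact h.bound t
    _ = |t| * (1 + L * |u 0| + 1 / 2 * (L * ‖x‖)) := by ring
    _ ≤ _ := by
        gcongr
        have : 0 ≤ L * |u 0| := by positivity
        have : 0 ≤ L * |u 0| * ‖x‖ := by positivity
        have : 0 ≤ L * ‖x‖ := by positivity
        nlinarith

lemma one_add_norm_le (h : IsCutCurve L B γ φt) (hu : LipschitzWith (1 / 2) u) (x : Plane) {s t : ℝ}
    (ht : |t| ≤ 1) (hs : s ∈ Icc (0 : ℝ) 1) :
    1 + ‖x‖ ≤ 2 * (2 + |u 0|) * (1 + ‖x - s • disp γ u x t‖) := by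
  have h1 : ‖disp γ u x t‖ ≤ 1 + (|u 0| + 1 / 2 * ‖x‖) * (1 / 2) := by
    refine (norm_point_le _ _).trans ?_
    rw [abs_mul]
    gcongr
    · exact abs_le_of_lipschitz hu x
    · exact h.small t
  have h2 : ‖s • disp γ u x t‖ ≤ ‖disp γ u x t‖ := by
    rw [norm_smul, Real.norm_of_nonneg hs.1]
    exact mul_le_of_le_one_left (norm_nonneg _) hs.2
  have h3 := norm_sub_norm_le x (s • disp γ u x t)
  set Y := ‖x - s • disp γ u x t‖
  have h4 : 0 ≤ Y := norm_nonneg _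
  have h5 := abs_nonneg (u 0)
  have h6 := mul_nonneg h5 h4
  nlinarith

lemma exists_hilbertIntegrand_le (h : IsCutCurve L B γ φt) (hu : LipschitzWith (1 / 2) u)
    (g : 𝓢(Plane, ℂ)) : ∃ C : ℝ, 0 < C ∧ ∀ t, |t| ≤ 1 →
      (∀ x, ‖hilbertIntegrand γ φt u g x t‖ ≤ C / (1 + ‖x‖) ^ 3) ∧
      ∀ x x', ‖x - x'‖ ≤ 1 → ‖hilbertIntegrand γ φt u g x t - hilbertIntegrand γ φt u g x' t‖ ≤
        C * ‖x - x'‖ / (1 + ‖x‖) ^ 3 := by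
  have hL := h.pos_L
  have hB := h.pos_B
  obtain ⟨C₁, hC₁, h1⟩ := schwartz_norm_sub_le (SchwartzMap.fderivCLM ℝ Plane ℂ g) 4
  obtain ⟨C₂, hC₂, h2⟩ := schwartz_norm_le (SchwartzMap.fderivCLM ℝ Plane ℂ g) 4
  obtain ⟨C₃, hC₃, h3⟩ := schwartz_norm_sub_le g 3
  obtain ⟨C₄, hC₄, h4⟩ := schwartz_norm_le g 3
  set U := 2 * (2 + |u 0|) with hU
  set E := 1 + L + L * |u 0| with hE
  have hU0 : 0 < U := by positivity
  have hE0 : 0 < E := by positivity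
  set K₁ := C₂ * U ^ 4 * E with hK₁
  set K₂ := C₁ * 2 * U ^ 4 * E + C₂ * U ^ 4 * 16 * L with hK₂
  have hK₁0 : 0 < K₁ := by positivity
  have hK₂0 : 0 < K₂ := by positivity
  have e : ∀ x t, hilbertIntegrand γ φt u g x t =
      ((φt t : ℂ) * (g (x - disp γ u x t) - g x) + ((φt t - 1 : ℝ) : ℂ) * g x) / t := fun x t => by
    rw [sub_disp, hilbertIntegrand]; push_cast; congr 1; ring
  have hcut : ∀ t, ‖(φt t : ℂ)‖ ≤ B := fun t => by
    rw [Complex.norm_real]; exact h.bound_cut t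
  have hcut' : ∀ t, ‖((φt t - 1 : ℝ) : ℂ)‖ ≤ B * |t| := fun t => by
    rw [Complex.norm_real]; exact h.near_cut t
  have low : ∀ (x : Plane) {s t : ℝ} {c : ℝ}, |t| ≤ 1 → s ∈ Icc (0 : ℝ) 1 → 0 ≤ c →
      c / (1 + ‖x - s • disp γ u x t‖) ^ 4 ≤ c * U ^ 4 / (1 + ‖x‖) ^ 4 := by
    intro x s t c ht hs hc
    have := one_add_norm_le h hu x ht hs
    rw [div_le_div_iff₀ (by positivity) (by positivity), mul_assoc, ← mul_pow]
    gcongr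
  refine ⟨B * K₁ + B * C₄ + (B * K₂ + B * C₃), by positivity, fun t ht => ?_⟩
  have fin : ∀ (z : ℂ) (M : ℝ), 0 ≤ M → ‖z‖ ≤ M * |t| → ‖z / (t : ℂ)‖ ≤ M := fun z M hM hz => by
    rw [norm_div, Complex.norm_real, Real.norm_eq_abs]
    exact div_le_of_le_mul₀ (abs_nonneg _) hM hz
  have part1 : ∀ x, ‖g (x - disp γ u x t) - g x‖ ≤ K₁ / (1 + ‖x‖) ^ 3 * |t| := fun x => by
    refine norm_sub_le_of_line g x _ fun s hs => ?_
    calc _ ≤ C₂ * U ^ 4 / (1 + ‖x‖) ^ 4 * (|t| * (E * (1 + ‖x‖))) := by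
          gcongr
          · exact (h2 _).trans (low x ht hs hC₂.le)
          · exact norm_disp_le h hu x t
      _ = _ := by rw [hK₁]; field_simp
  refine ⟨fun x => ?_, fun x x' hxx => ?_⟩
  · rw [e]
    refine (fin _ (B * (K₁ / (1 + ‖x‖) ^ 3) + B * (C₄ / (1 + ‖x‖) ^ 3)) (by positivity) ?_).trans ?_
    · refine (norm_add_le _ _).trans ?_
      rw [norm_mul, norm_mul, add_mul]
      refine add_le_add ?_ ?_
      · calc _ ≤ B * (K₁ / (1 + ‖x‖) ^ 3 * |t|) := by
              gcongr
              · exact hcut t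
              · exact part1 x
          _ = _ := by ring
      · calc _ ≤ B * |t| * (C₄ / (1 + ‖x‖) ^ 3) := by
              gcongr
              · exact hcut' t
              · exact h4 x
          _ = _ := by ring
    · rw [← mul_div_assoc, ← mul_div_assoc, ← add_div]
      refine div_le_div_of_nonneg_right ?_ (by positivity)
      have : 0 ≤ B * K₂ + B * C₃ := by positivity
      linarith
  · have hP : 1 + ‖x‖ ≤ 2 * (1 + ‖x'‖) := by
      have := norm_sub_norm_le x x'
      have := norm_nonneg x'
      linarith
    have part2 : ‖(g (x - disp γ u x t) - g x) - (g (x' - disp γ u x' t) - g x')‖ ≤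
        K₂ * ‖x - x'‖ / (1 + ‖x‖) ^ 3 * |t| := by
      refine norm_sub_sub_le_of_line g _ _ _ _ fun s hs => ?_
      set d := disp γ u x t
      set d' := disp γ u x' t
      have hd : ‖d - d'‖ ≤ 1 / 2 * ‖x - x'‖ * |γ t| := norm_disp_sub_le hu x x' t
      have hd1 : ‖d - d'‖ ≤ ‖x - x'‖ := by
        have := h.small t
        have h0 := norm_nonneg (x - x')
        calc _ ≤ 1 / 2 * ‖x - x'‖ * |γ t| := hd
          _ ≤ 1 / 2 * ‖x - x'‖ * (1 / 2) := by gcongr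
          _ ≤ _ := by linarith
      have hyy : ‖(x - s • d) - (x' - s • d')‖ ≤ 2 * ‖x - x'‖ := by
        have e1 : (x - s • d) - (x' - s • d') = (x - x') - s • (d - d') := by
          rw [smul_sub]; abel
        rw [e1]
        refine (norm_sub_le _ _).trans ?_
        rw [norm_smul, Real.norm_of_nonneg hs.1]
        have : s * ‖d - d'‖ ≤ 1 * ‖x - x'‖ :=
          mul_le_mul hs.2 hd1 (norm_nonneg _) zero_le_one
        linarith
      have t1 : ‖SchwartzMap.fderivCLM ℝ Plane ℂ g (x - s • d) -
          SchwartzMap.fderivCLM ℝ Plane ℂ g (x' - s • d')‖ * ‖d‖ ≤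
          C₁ * 2 * U ^ 4 * E * ‖x - x'‖ / (1 + ‖x‖) ^ 3 * |t| := by
        calc _ ≤ C₁ * (2 * ‖x - x'‖) * U ^ 4 / (1 + ‖x‖) ^ 4 * (|t| * (E * (1 + ‖x‖))) := by
              refine mul_le_mul ?_ (norm_disp_le h hu x t) (norm_nonneg _) (by positivity)
              refine (h1 _ _ (by linarith)).trans (le_trans ?_ (low x ht hs (by positivity)))
              gcongr
          _ = _ := by field_simp
      have t2 : ‖SchwartzMap.fderivCLM ℝ Plane ℂ g (x' - s • d')‖ * ‖d - d'‖ ≤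
          C₂ * U ^ 4 * 16 * L * ‖x - x'‖ / (1 + ‖x‖) ^ 3 * |t| := by
        calc _ ≤ C₂ * U ^ 4 / (1 + ‖x'‖) ^ 4 * (1 / 2 * ‖x - x'‖ * (L * |t|)) := by
              refine mul_le_mul ((h2 _).trans (low x' ht hs hC₂.le)) (hd.trans ?_)
                (norm_nonneg _) (by positivity)
              gcongr
              exact h.bound t
          _ ≤ C₂ * U ^ 4 * 16 / (1 + ‖x‖) ^ 3 * (1 * ‖x - x'‖ * (L * |t|)) := by
              gcongr ?_ * (?_ * _ * _)
              · rw [div_le_div_iff₀ (by positivity) (by positivity), mul_assoc _ (16 : ℝ)]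
                gcongr
                calc (1 + ‖x‖) ^ 3 ≤ (1 + ‖x‖) ^ 4 :=
                      pow_le_pow_right₀ (by linarith [norm_nonneg x]) (by norm_num)
                  _ ≤ (2 * (1 + ‖x'‖)) ^ 4 := by gcongr
                  _ = _ := by ring
              · norm_num
          _ = _ := by ring
      refine (add_le_add t1 t2).trans (le_of_eq ?_)
      rw [hK₂]; ring
    have e2 : hilbertIntegrand γ φt u g x t - hilbertIntegrand γ φt u g x' t =
        ((φt t : ℂ) * ((g (x - disp γ u x t) - g x) - (g (x' - disp γ u x' t) - g x')) +
          ((φt t - 1 : ℝ) : ℂ) * (g x - g x')) / t := by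
      rw [e, e, ← sub_div]; congr 1; ring
    rw [e2]
    refine (fin _ (B * (K₂ * ‖x - x'‖ / (1 + ‖x‖) ^ 3) + B * (C₃ * ‖x - x'‖ / (1 + ‖x‖) ^ 3))
      (by positivity) ?_).trans ?_
    · refine (norm_add_le _ _).trans ?_
      rw [norm_mul, norm_mul, add_mul]
      refine add_le_add ?_ ?_
      · calc _ ≤ B * (K₂ * ‖x - x'‖ / (1 + ‖x‖) ^ 3 * |t|) := by
              gcongr
              exact hcut t
          _ = _ := by ring
      · calc _ ≤ B * |t| * (C₃ * ‖x - x'‖ / (1 + ‖x‖) ^ 3) := by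
              gcongr
              · exact hcut' t
              · exact h3 x x' (by linarith)
          _ = _ := by ring
    · rw [← mul_div_assoc, ← mul_div_assoc, ← add_div]
      refine div_le_div_of_nonneg_right ?_ (by positivity)
      have : 0 ≤ (B * K₁ + B * C₄) * ‖x - x'‖ := by positivity
      linarith

end Integrand

/-- Functions on the plane with cubic decay which are Lipschitz with cubically decaying constant. -/
structure IsDecayLip (C : ℝ) (F : Plane → ℂ) : Prop where
  nonneg : 0 ≤ C
  decay : ∀ x, ‖F x‖ ≤ C / (1 + ‖x‖) ^ 3
  lip : ∀ x x', ‖x - x'‖ ≤ 1 → ‖F x - F x'‖ ≤ C * ‖x - x'‖ / (1 + ‖x‖) ^ 3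

namespace IsDecayLip

variable {C : ℝ} {F : Plane → ℂ}

lemma norm_le (h : IsDecayLip C F) (x : Plane) : ‖F x‖ ≤ C :=
  (h.decay x).trans (div_le_self h.nonneg (one_le_pow₀ (by linarith [norm_nonneg x])))

lemma continuous (h : IsDecayLip C F) : Continuous F := by
  refine continuous_iff_continuousAt.2 fun x => ?_
  refine tendsto_iff_norm_sub_tendsto_zero.2 ?_
  have h1 : Tendsto (fun y => C * ‖x - y‖) (𝓝 x) (𝓝 0) := by
    have : Continuous fun y : Plane => C * ‖x - y‖ := by fun_prop
    simpa using this.tendsto x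
  refine squeeze_zero' (Eventually.of_forall fun y => norm_nonneg _) ?_ h1
  filter_upwards [Metric.closedBall_mem_nhds x one_pos] with y hy
  rw [norm_sub_rev]
  refine (h.lip x y (by rwa [mem_closedBall_iff_norm, norm_sub_rev] at hy)).trans ?_
  have := h.nonneg
  exact div_le_self (by positivity) (one_le_pow₀ (by linarith [norm_nonneg x]))

lemma integrable_decay : Integrable fun x : Plane => ((1 + ‖x‖) ^ 3)⁻¹ := by
  have := integrable_one_add_norm (E := Plane) (μ := volume) (r := 3) (by simp; norm_num)
  refine this.congr (ae_of_all _ fun x => ?_)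
  simp only
  rw [Real.rpow_neg (by positivity)]
  norm_cast

lemma integrable (h : IsDecayLip C F) : Integrable F := by
  refine (integrable_decay.const_mul C).mono' h.continuous.aestronglyMeasurable
    (ae_of_all _ fun x => ?_)
  rw [← div_eq_mul_inv]
  exact h.decay x

/-- The integral of the cubic weight. -/
noncomputable def weightMass : ℝ≥0∞ := ∫⁻ x : Plane, ENNReal.ofReal (((1 + ‖x‖) ^ 3)⁻¹)

lemma weightMass_lt_top : weightMass < ⊤ := by
  have := integrable_decay.2
  refine lt_of_le_of_lt (lintegral_mono fun x => ?_) this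
  rw [← ofReal_norm]
  exact ENNReal.ofReal_le_ofReal (le_abs_self _)

lemma lintegral_sq_le (hF : ∀ x, ‖F x‖ ≤ C / (1 + ‖x‖) ^ 3) :
    ∫⁻ x, ‖F x‖ₑ ^ 2 ≤ ENNReal.ofReal (C ^ 2) * weightMass := by
  rw [weightMass, ← lintegral_const_mul' _ _ ENNReal.ofReal_ne_top]
  refine lintegral_mono fun x => ?_
  rw [← ofReal_norm, ← ENNReal.ofReal_pow (norm_nonneg _), ← ENNReal.ofReal_mul (by positivity)]
  refine ENNReal.ofReal_le_ofReal ?_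
  have h1 : (1 : ℝ) ≤ (1 + ‖x‖) ^ 3 := one_le_pow₀ (by linarith [norm_nonneg x])
  calc ‖F x‖ ^ 2 ≤ (C / (1 + ‖x‖) ^ 3) ^ 2 := by gcongr; exact hF x
    _ = C ^ 2 * (((1 + ‖x‖) ^ 3)⁻¹ * ((1 + ‖x‖) ^ 3)⁻¹) := by rw [div_eq_mul_inv]; ring
    _ ≤ C ^ 2 * (((1 + ‖x‖) ^ 3)⁻¹ * 1) := by gcongr; exact inv_le_one_of_one_le₀ h1
    _ = _ := by ring

lemma memLp_two (hF : ∀ x, ‖F x‖ ≤ C / (1 + ‖x‖) ^ 3) (hc : Continuous F) :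
    MemLp F 2 := by
  refine ⟨hc.aestronglyMeasurable, ?_⟩
  rw [eLpNorm_lt_top_iff_lintegral_rpow_enorm_lt_top (by norm_num) (by norm_num)]
  simp only [ENNReal.toReal_ofNat, ENNReal.rpow_ofNat]
  exact (lintegral_sq_le hF).trans_lt (ENNReal.mul_lt_top ENNReal.ofReal_lt_top weightMass_lt_top)

lemma fourier_shift (F : Plane → ℂ) (h : ℝ) (ξ : Plane) :
    𝓕 (fun x : Plane => F (x + h • EuclideanSpace.single 0 1)) ξ =
      (Real.fourierChar (h * ξ 0) : ℂ) * 𝓕 F ξ := by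
  have := congrFun (VectorFourier.fourierIntegral_comp_add_right Real.fourierChar volume
    (innerₗ Plane) F (h • EuclideanSpace.single 0 1)) ξ
  simp only [innerₗ_apply_apply, Circle.smul_def, smul_eq_mul, real_inner_smul_left,
    EuclideanSpace.inner_single_left, conj_trivial, one_mul] at this
  exact this

lemma lintegral_difference_le (hF : IsDecayLip C F) {h : ℝ} (h0 : 0 < h) (h1 : h ≤ 1) :
    ∫⁻ ξ : Plane, ‖((h⁻¹ : ℝ) : ℂ) * ((Real.fourierChar (h * ξ 0) : ℂ) - 1)‖ₑ ^ 2 * ‖𝓕 F ξ‖ₑ ^ 2 ≤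
      ENNReal.ofReal (C ^ 2) * weightMass := by
  set e0 : Plane := EuclideanSpace.single 0 1 with he0
  have ne0 : ‖h • e0‖ = h := by
    rw [norm_smul, Real.norm_of_nonneg h0.le, he0, PiLp.norm_single]; simp
  set G : Plane → ℂ := fun x => ((h⁻¹ : ℝ) : ℂ) * (F (x + h • e0) - F x) with hG
  have cF := hF.continuous
  have cG : Continuous G := by fun_prop
  have bG : ∀ x, ‖G x‖ ≤ C / (1 + ‖x‖) ^ 3 := fun x => by
    have e : x - (x + h • e0) = -(h • e0) := by abel
    have := hF.lip x (x + h • e0) (by rw [e, norm_neg, ne0]; exact h1)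
    rw [e, norm_neg, ne0] at this
    rw [hG]
    simp only
    rw [norm_mul, Complex.norm_real, Real.norm_of_nonneg (by positivity), norm_sub_rev,
      inv_mul_le_iff₀ h0]
    refine this.trans (le_of_eq ?_)
    ring
  have iG : Integrable G :=
    ((hF.integrable.comp_add_right _).sub hF.integrable).const_mul _
  have hGf : ∀ ξ, 𝓕 G ξ = ((h⁻¹ : ℝ) : ℂ) * ((Real.fourierChar (h * ξ 0) : ℂ) - 1) * 𝓕 F ξ :=
      fun ξ => by
    have e1 : 𝓕 G ξ = ((h⁻¹ : ℝ) : ℂ) * (𝓕 (fun x : Plane => F (x + h • e0)) ξ - 𝓕 F ξ) := by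
      simp only [Real.fourier_eq, Circle.smul_def, smul_eq_mul]
      have i1 : ∀ H : Plane → ℂ, Integrable H →
          Integrable fun v : Plane => (Real.fourierChar (-inner ℝ v ξ) : ℂ) * H v := fun H hH => by
        have := (Real.fourierIntegral_convergent_iff (μ := volume) ξ).2 hH
        simpa only [Circle.smul_def, smul_eq_mul] using this
      rw [← integral_sub (i1 _ (hF.integrable.comp_add_right _)) (i1 _ hF.integrable),
        ← integral_const_mul]
      congr 1
      ext v
      simp only [hG]
      ring
    rw [e1, fourier_shift]
    ring
  calc _ = ∫⁻ ξ, ‖𝓕 G ξ‖ₑ ^ 2 := by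
        simp only [hGf, enorm_mul, mul_pow]
    _ = ∫⁻ x, ‖G x‖ₑ ^ 2 := lintegral_fourier_sq iG (memLp_two bG cG)
    _ ≤ _ := lintegral_sq_le bG

lemma tendsto_difference (r : ℝ) :
    Tendsto (fun n : ℕ => (((((n : ℝ) + 1)⁻¹)⁻¹ : ℝ) : ℂ) *
      ((Real.fourierChar (((n : ℝ) + 1)⁻¹ * r) : ℂ) - 1)) atTop
      (𝓝 (2 * Real.pi * Complex.I * r)) := by
  have hd : HasDerivAt (fun t : ℝ => (Real.fourierChar (t * r) : ℂ)) (2 * Real.pi * Complex.I * r)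
      0 := by
    have h1 := Real.hasDerivAt_fourierChar (0 * r)
    have h2 : HasDerivAt (fun t : ℝ => t * r) r 0 := by
      simpa using (hasDerivAt_id (0 : ℝ)).mul_const r
    have := h1.scomp (0 : ℝ) h2
    simpa [Function.comp_def, mul_comm] using this
  have h3 := hd.tendsto_slope_zero
  have h4 : Tendsto (fun n : ℕ => ((n : ℝ) + 1)⁻¹) atTop (𝓝[≠] 0) := by
    refine tendsto_nhdsWithin_iff.2 ⟨?_, Eventually.of_forall fun n => ?_⟩
    · simpa using tendsto_one_div_add_atTop_nhds_zero_nat (𝕜 := ℝ)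
    · have : ((n : ℝ) + 1)⁻¹ ≠ 0 := by positivity
      exact this
  have := h3.comp h4
  simpa [Function.comp_def] using this

lemma lintegral_weighted_le (hF : IsDecayLip C F) :
    ∫⁻ ξ : Plane, ‖(2 * Real.pi * Complex.I * ξ 0 : ℂ)‖ₑ ^ 2 * ‖𝓕 F ξ‖ₑ ^ 2 ≤
      ENNReal.ofReal (C ^ 2) * weightMass := by
  have cF := continuous_fourier hF.integrable
  set Q : ℕ → Plane → ℝ≥0∞ := fun n ξ => ‖(((((n : ℝ) + 1)⁻¹)⁻¹ : ℝ) : ℂ) *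
      ((Real.fourierChar (((n : ℝ) + 1)⁻¹ * ξ 0) : ℂ) - 1)‖ₑ ^ 2 * ‖𝓕 F ξ‖ₑ ^ 2 with hQ
  have mQ : ∀ n, Measurable (Q n) := fun n => by
    have c1 := continuous_coord 0
    have c2 := Real.continuous_fourierChar
    have : Continuous fun ξ : Plane => (((((n : ℝ) + 1)⁻¹)⁻¹ : ℝ) : ℂ) *
      ((Real.fourierChar (((n : ℝ) + 1)⁻¹ * ξ 0) : ℂ) - 1) := by fun_prop
    exact (this.measurable.enorm.pow_const 2).mul (cF.measurable.enorm.pow_const 2)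
  have lQ : ∀ ξ, Tendsto (fun n => Q n ξ) atTop
      (𝓝 (‖(2 * Real.pi * Complex.I * ξ 0 : ℂ)‖ₑ ^ 2 * ‖𝓕 F ξ‖ₑ ^ 2)) := fun ξ => by
    refine ENNReal.Tendsto.mul_const ?_ (Or.inr (by finiteness))
    exact ((ENNReal.continuous_pow 2).tendsto _).comp
      ((continuous_enorm.tendsto _).comp (tendsto_difference (ξ 0)))
  calc _ = ∫⁻ ξ, liminf (fun n => Q n ξ) atTop :=
        lintegral_congr fun ξ => (lQ ξ).liminf_eq.symm
    _ ≤ liminf (fun n => ∫⁻ ξ, Q n ξ) atTop := lintegral_liminf_le mQ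
    _ ≤ liminf (fun _ : ℕ => ENNReal.ofReal (C ^ 2) * weightMass) atTop := by
        refine liminf_le_liminf (Eventually.of_forall fun n => ?_)
        refine hF.lintegral_difference_le (by positivity) (inv_le_one_of_one_le₀ ?_)
        have : (0 : ℝ) ≤ n := n.cast_nonneg
        linarith
    _ = _ := liminf_const _

lemma lintegral_strip_lt_top (R : ℝ) :
    ∫⁻ ξ : Plane, {ξ : Plane | |ξ 1| ≤ R}.indicator
      (fun ξ => ENNReal.ofReal ((1 + ξ 0 ^ 2)⁻¹)) ξ < ⊤ := by
  have c0 := measurable_coord 0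
  have c1 := measurable_coord 1
  have hm : MeasurableSet {ξ : Plane | |ξ 1| ≤ R} := measurableSet_le (by fun_prop) measurable_const
  rw [lintegral_plane (Measurable.indicator (by fun_prop) hm)]
  have e : ∀ a b : ℝ, {ξ : Plane | |ξ 1| ≤ R}.indicator
      (fun ξ => ENNReal.ofReal ((1 + ξ 0 ^ 2)⁻¹)) !₂[a, b] =
      ENNReal.ofReal ((1 + a ^ 2)⁻¹) * (Icc (-R) R).indicator 1 b := fun a b => by
    by_cases hb : |b| ≤ R
    · rw [indicator_of_mem (by exact hb), indicator_of_mem (by exact abs_le.1 hb)]; simp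
    · rw [indicator_of_notMem (by exact hb),
        indicator_of_notMem (show b ∉ Icc (-R) R from fun h => hb (abs_le.2 h))]
      simp
  simp only [e]
  simp_rw [lintegral_const_mul' _ _ ENNReal.ofReal_ne_top]
  rw [lintegral_mul_const _ (by fun_prop), lintegral_indicator_one measurableSet_Icc]
  refine ENNReal.mul_lt_top ?_ (by simp)
  have := integrable_inv_one_add_sq.2
  refine lt_of_le_of_lt (lintegral_mono fun x => ?_) this
  rw [← ofReal_norm]
  exact ENNReal.ofReal_le_ofReal (le_abs_self _)

/-- Localized to a strip, the Fourier transform of such a function is integrable. -/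
lemma integrable_freqCut (hF : IsDecayLip C F) {χ : ℝ → ℂ} (hχ : Continuous χ)
    (hs : HasCompactSupport χ) (k : ℤ) : Integrable (freqCut χ k F) := by
  obtain ⟨M, hM⟩ := hs.exists_bound_of_continuous hχ
  have hM0 : 0 ≤ M := (norm_nonneg _).trans (hM 0)
  obtain ⟨R, hR⟩ := hs.isCompact.isBounded.subset_closedBall 0
  have cF := continuous_fourier hF.integrable
  have c0 := continuous_coord 0
  have c1 := continuous_coord 1
  have hp : (0 : ℝ) < 2 ^ (-k) := by positivity
  have hc : Continuous (freqCut χ k F) := by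
    unfold freqCut
    fun_prop
  set S : Set Plane := {ξ : Plane | |ξ 1| ≤ R / 2 ^ (-k)} with hS
  refine ⟨hc.aestronglyMeasurable, ?_⟩
  have key : ∀ ξ, ‖freqCut χ k F ξ‖ₑ ≤ ENNReal.ofReal M *
      (S.indicator (fun ξ => ENNReal.ofReal ((1 + ξ 0 ^ 2)⁻¹)) ξ + (‖𝓕 F ξ‖ₑ ^ 2 +
        ‖(2 * Real.pi * Complex.I * ξ 0 : ℂ)‖ₑ ^ 2 * ‖𝓕 F ξ‖ₑ ^ 2)) := fun ξ => by
    by_cases hξ : ξ ∈ S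
    · rw [indicator_of_mem hξ, freqCut, enorm_mul]
      refine mul_le_mul' ?_ ?_
      · rw [← ofReal_norm]; exact ENNReal.ofReal_le_ofReal (hM _)
      · simp only [← ofReal_norm]
        rw [← ENNReal.ofReal_pow (norm_nonneg _), ← ENNReal.ofReal_pow (norm_nonneg _),
          ← ENNReal.ofReal_mul (by positivity),
          ← ENNReal.ofReal_add (by positivity) (by positivity),
          ← ENNReal.ofReal_add (by positivity) (by positivity)]
        refine ENNReal.ofReal_le_ofReal ?_
        have e : ‖(2 * Real.pi * Complex.I * ξ 0 : ℂ)‖ ^ 2 = (2 * Real.pi) ^ 2 * ξ 0 ^ 2 := by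
          simp only [norm_mul, Complex.norm_I, Complex.norm_real, Real.norm_eq_abs, mul_one,
            Complex.norm_ofNat, mul_pow, sq_abs]
        rw [e]
        have hpi : 1 ≤ (2 * Real.pi) ^ 2 := by
          have := Real.pi_gt_three
          nlinarith
        set y := ‖𝓕 F ξ‖
        set w := 1 + ξ 0 ^ 2 with hw
        have hw0 : 0 < w := by positivity
        have h1 : y ≤ w⁻¹ + w * y ^ 2 := by
          have h2 := sq_nonneg (w * y - 1)
          have h3 : 0 ≤ w * y := by positivity
          have h4 : w * y ≤ w * (w⁻¹ + w * y ^ 2) := by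
            rw [mul_add, mul_inv_cancel₀ hw0.ne']; nlinarith
          exact le_of_mul_le_mul_left h4 hw0
        have h5 : 0 ≤ ξ 0 ^ 2 * y ^ 2 := by positivity
        have h6 : w * y ^ 2 = y ^ 2 + ξ 0 ^ 2 * y ^ 2 := by rw [hw]; ring
        nlinarith
    · have : freqCut χ k F ξ = 0 := by
        have hz : (2 : ℝ) ^ (-k) * ξ 1 ∉ tsupport χ := fun hmem => ?_
        · rw [freqCut, image_eq_zero_of_notMem_tsupport hz, zero_mul]
        have := hR hmem
        rw [mem_closedBall_zero_iff, Real.norm_eq_abs, abs_mul, abs_of_pos hp] at this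
        refine hξ ?_
        change |ξ 1| ≤ R / 2 ^ (-k)
        rw [le_div_iff₀ hp, mul_comm]
        exact this
      rw [this, enorm_zero]
      exact zero_le
  refine (lintegral_mono key).trans_lt ?_
  rw [lintegral_const_mul' _ _ ENNReal.ofReal_ne_top]
  refine ENNReal.mul_lt_top ENNReal.ofReal_lt_top ?_
  have m1 : Measurable (S.indicator fun ξ : Plane => ENNReal.ofReal ((1 + ξ 0 ^ 2)⁻¹)) :=
    Measurable.indicator (by fun_prop) (measurableSet_le (by fun_prop) measurable_const)
  have m2 : Measurable fun ξ => ‖𝓕 F ξ‖ₑ ^ 2 := cF.measurable.enorm.pow_const 2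
  rw [lintegral_add_left m1, lintegral_add_left m2]
  refine ENNReal.add_lt_top.2 ⟨lintegral_strip_lt_top _, ENNReal.add_lt_top.2 ⟨?_, ?_⟩⟩
  · rw [lintegral_fourier_sq hF.integrable (memLp_two hF.decay hF.continuous)]
    exact (lintegral_sq_le hF.decay).trans_lt
      (ENNReal.mul_lt_top ENNReal.ofReal_lt_top weightMass_lt_top)
  · exact hF.lintegral_weighted_le.trans_lt
      (ENNReal.mul_lt_top ENNReal.ofReal_lt_top weightMass_lt_top)

end IsDecayLip

section PrincipalValue

variable {L B : ℝ} {γ φt : ℝ → ℝ} {u : Plane → ℝ} {g : 𝓢(Plane, ℂ)}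

lemma continuous_curve (h : IsCutCurve L B γ φt) (hu : Continuous u) :
    Continuous fun y : Plane × ℝ => (!₂[y.1 0 - y.2, y.1 1 - u y.1 * γ y.2] : Plane) := by
  have c0 := continuous_coord 0
  have c1 := continuous_coord 1
  have cg := h.cont
  exact continuous_point.comp (by fun_prop : Continuous fun y : Plane × ℝ =>
    (y.1 0 - y.2, y.1 1 - u y.1 * γ y.2))

lemma measurable_hilbertIntegrand (h : IsCutCurve L B γ φt) (hu : Continuous u) {G : Plane → ℂ}
    (hG : Continuous G) :
    Measurable fun y : Plane × ℝ => hilbertIntegrand γ φt u G y.1 y.2 := by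
  have c := hG.comp (continuous_curve h hu)
  have cφ := h.cont_cut
  have c' : Continuous fun y : Plane × ℝ =>
      G !₂[y.1 0 - y.2, y.1 1 - u y.1 * γ y.2] * (φt y.2 : ℂ) - G y.1 := by
    refine Continuous.sub (c.mul ?_) (hG.comp continuous_fst)
    fun_prop
  exact c'.measurable.div (by fun_prop)

lemma abs_le_one_of_mem {t : ℝ} (ht : t ∈ Icc (-1 : ℝ) 1) : |t| ≤ 1 := abs_le.2 ht

lemma integrableOn_hilbertIntegrand (h : IsCutCurve L B γ φt) (hu : LipschitzWith (1 / 2) u)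
    (x : Plane) : IntegrableOn (hilbertIntegrand γ φt u g x) (Icc (-1) 1) := by
  obtain ⟨C, -, hC⟩ := exists_hilbertIntegrand_le h hu g
  refine Measure.integrableOn_of_bounded (M := C / (1 + ‖x‖) ^ 3) (by simp) ?_ ?_
  · exact ((measurable_hilbertIntegrand h hu.continuous g.continuous).comp
      (measurable_prodMk_left (x := x))).aestronglyMeasurable
  · exact (ae_restrict_iff' measurableSet_Icc).2 (ae_of_all _ fun t ht =>
      (hC t (abs_le_one_of_mem ht)).1 x)

lemma setIntegral_inv_eq_zero (η : ℝ) :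
    ∫ t in Icc (-1 : ℝ) 1 ∩ {t | η < |t|}, ((t : ℂ))⁻¹ = 0 := by
  have hm : MeasurableSet (Icc (-1 : ℝ) 1 ∩ {t | η < |t|}) :=
    measurableSet_Icc.inter (measurableSet_lt measurable_const (by fun_prop))
  rw [← integral_indicator hm]
  set f := (Icc (-1 : ℝ) 1 ∩ {t | η < |t|}).indicator fun t : ℝ => ((t : ℂ))⁻¹ with hf
  have odd : ∀ t, f (-t) = -f t := fun t => by
    by_cases ht : t ∈ Icc (-1 : ℝ) 1 ∩ {t | η < |t|}
    · have ht' : -t ∈ Icc (-1 : ℝ) 1 ∩ {t | η < |t|} := by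
        refine ⟨⟨by linarith [ht.1.2], by linarith [ht.1.1]⟩, ?_⟩
        have := ht.2
        simpa using this
      rw [hf, indicator_of_mem ht, indicator_of_mem ht']
      push_cast
      exact inv_neg
    · have ht' : -t ∉ Icc (-1 : ℝ) 1 ∩ {t | η < |t|} := fun h' => ht <| by
        refine ⟨⟨by linarith [h'.1.2], by linarith [h'.1.1]⟩, ?_⟩
        have := h'.2
        simpa using this
      rw [hf, indicator_of_notMem ht, indicator_of_notMem ht', neg_zero]
  have := integral_neg_eq_self f volume
  simp only [odd, integral_neg] at this
  exact self_eq_neg.1 this.symm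

lemma truncHilbert_eq (h : IsCutCurve L B γ φt) (hu : LipschitzWith (1 / 2) u) (x : Plane) {η : ℝ}
    (hη : 0 < η) : truncHilbert γ φt u g x η =
      ∫ t in Icc (-1) 1, {t : ℝ | η < |t|}.indicator (hilbertIntegrand γ φt u g x) t := by
  have hm : MeasurableSet {t : ℝ | η < |t|} := measurableSet_lt measurable_const (by fun_prop)
  rw [setIntegral_indicator hm, truncHilbert]
  rw [setIntegral_eq_of_subset_of_forall_sdiff_eq_zero hm
    (inter_subset_right : Icc (-1 : ℝ) 1 ∩ {t : ℝ | η < |t|} ⊆ _)]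
  · have i1 : IntegrableOn (hilbertIntegrand γ φt u g x) (Icc (-1 : ℝ) 1 ∩ {t : ℝ | η < |t|}) :=
      (integrableOn_hilbertIntegrand h hu x).mono_set inter_subset_left
    have i2 : IntegrableOn (fun t : ℝ => g x * ((t : ℂ))⁻¹)
        (Icc (-1 : ℝ) 1 ∩ {t : ℝ | η < |t|}) := by
      refine Integrable.const_mul ?_ _
      refine Measure.integrableOn_of_bounded (M := η⁻¹) ?_ ?_ ?_
      · exact ((measure_mono inter_subset_left).trans_lt (by simp)).ne
      · exact (by fun_prop : Measurable fun t : ℝ => ((t : ℂ))⁻¹).aestronglyMeasurable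
      · refine (ae_restrict_iff' (measurableSet_Icc.inter hm)).2 (ae_of_all _ fun t ht => ?_)
        rw [norm_inv, Complex.norm_real, Real.norm_eq_abs]
        have : η < |t| := ht.2
        gcongr
    have e : ∀ t, g !₂[x 0 - t, x 1 - u x * γ t] * ((φt t / t : ℝ) : ℂ) =
        hilbertIntegrand γ φt u g x t + g x * ((t : ℂ))⁻¹ := fun t => by
      rw [hilbertIntegrand]; push_cast; ring
    simp only [e]
    rw [integral_add i1 i2, integral_const_mul, setIntegral_inv_eq_zero, mul_zero, add_zero]
  · intro t ht
    have : φt t = 0 := by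
      by_contra hne
      exact ht.2 ⟨abs_le.1 (h.supp_cut t hne).1, ht.1⟩
    simp [this]

lemma tendsto_truncHilbert (h : IsCutCurve L B γ φt) (hu : LipschitzWith (1 / 2) u) (x : Plane) :
    Tendsto (truncHilbert γ φt u g x) (𝓝[>] 0)
      (𝓝 (∫ t in Icc (-1) 1, hilbertIntegrand γ φt u g x t)) := by
  have hi := integrableOn_hilbertIntegrand (g := g) h hu x
  have key : Tendsto (fun η : ℝ => ∫ t in Icc (-1) 1,
      {t : ℝ | η < |t|}.indicator (hilbertIntegrand γ φt u g x) t) (𝓝[>] 0)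
      (𝓝 (∫ t in Icc (-1) 1, hilbertIntegrand γ φt u g x t)) := by
    refine tendsto_integral_filter_of_dominated_convergence
      (fun t => ‖hilbertIntegrand γ φt u g x t‖) (Eventually.of_forall fun η => ?_)
      (Eventually.of_forall fun η => ae_of_all _ fun t => norm_indicator_le_norm_self _ _)
      hi.norm ?_
    · exact hi.aestronglyMeasurable.indicator (measurableSet_lt measurable_const (by fun_prop))
    · have : ∀ᵐ t : ℝ ∂(volume.restrict (Icc (-1) 1)), t ≠ 0 :=
        ae_restrict_of_ae (by simp [ae_iff])
      filter_upwards [this] with t ht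
      refine tendsto_const_nhds.congr' ?_
      have : ∀ᶠ η : ℝ in 𝓝[>] 0, η < |t| :=
        nhdsWithin_le_nhds (eventually_lt_nhds (abs_pos.2 ht))
      filter_upwards [this] with η hη
      rw [indicator_of_mem (by exact hη)]
  refine key.congr' ?_
  filter_upwards [self_mem_nhdsWithin] with η hη
  exact (truncHilbert_eq h hu x hη).symm

lemma hilbertAlong_eq (h : IsCutCurve L B γ φt) (hu : LipschitzWith (1 / 2) u) (x : Plane) :
    hilbertAlong γ φt u g x = ∫ t in Icc (-1) 1, hilbertIntegrand γ φt u g x t :=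
  (tendsto_truncHilbert h hu x).limUnder_eq

lemma exists_isDecayLip_hilbertAlong (h : IsCutCurve L B γ φt) (hu : LipschitzWith (1 / 2) u)
    (g : 𝓢(Plane, ℂ)) : ∃ C, IsDecayLip C (hilbertAlong γ φt u g) := by
  obtain ⟨C, hC, hb⟩ := exists_hilbertIntegrand_le h hu g
  have vol : volume.real (Icc (-1 : ℝ) 1) = 2 := by simp; norm_num
  refine ⟨C * 2, by positivity, fun x => ?_, fun x x' hx => ?_⟩
  · rw [hilbertAlong_eq h hu]
    refine (norm_setIntegral_le_of_norm_le_const (by simp)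
      fun t ht => (hb t (abs_le_one_of_mem ht)).1 x).trans (le_of_eq ?_)
    rw [vol]; ring
  · rw [hilbertAlong_eq h hu, hilbertAlong_eq h hu, ← integral_sub
      (integrableOn_hilbertIntegrand h hu x) (integrableOn_hilbertIntegrand h hu x')]
    refine (norm_setIntegral_le_of_norm_le_const (by simp)
      fun t ht => (hb t (abs_le_one_of_mem ht)).2 x x' hx).trans (le_of_eq ?_)
    rw [vol]; ring

/-- The off-diagonal part of the translate by `t` along the curve. -/
noncomputable def offTranslate (γ : ℝ → ℝ) (u : Plane → ℝ) (q : ℝ → ℂ) (k : ℤ) (g : Plane → ℂ)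
    (x : Plane) (t : ℝ) : ℂ :=
  g !₂[x 0 - t, x 1 - u x * γ t] -
    ∫ z, dil k q z * g !₂[x 0 - t, x 1 - z - u !₂[x 0, x 1 - z] * γ t]

lemma hilbertIntegrand_sub_partialConv {q : 𝓢(ℝ, ℂ)} {k : ℤ} (h : IsCutCurve L B γ φt)
    (hu : Continuous u) (hq : partialConv k q g = g) (x : Plane) (t : ℝ) :
    hilbertIntegrand γ φt u g x t -
      ∫ z, dil k q z * hilbertIntegrand γ φt u g !₂[x 0, x 1 - z] t =
      ((φt t / t : ℝ) : ℂ) * offTranslate γ u q k g x t := by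
  obtain ⟨M, hM⟩ := schwartz_exists_bound g
  have c1 : Continuous fun z : ℝ => g !₂[x 0 - t, x 1 - z - u !₂[x 0, x 1 - z] * γ t] :=
    g.continuous.comp ((continuous_curve h hu).comp
      ((continuous_shift.comp (by fun_prop : Continuous fun z : ℝ => (x, z))).prodMk
        (continuous_const (y := t))))
  have c2 : Continuous fun z : ℝ => g !₂[x 0, x 1 - z] :=
    g.continuous.comp (continuous_shift.comp (by fun_prop : Continuous fun z : ℝ => (x, z)))
  have iq := (isTame_dil k q).integrable
  have i1 : Integrable fun z : ℝ =>
      dil k q z * g !₂[x 0 - t, x 1 - z - u !₂[x 0, x 1 - z] * γ t] :=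
    iq.mul_bdd c1.aestronglyMeasurable (ae_of_all _ fun z => hM _)
  have i2 : Integrable fun z : ℝ => dil k q z * g !₂[x 0, x 1 - z] :=
    iq.mul_bdd c2.aestronglyMeasurable (ae_of_all _ fun z => hM _)
  have e : ∫ z, dil k q z * hilbertIntegrand γ φt u g !₂[x 0, x 1 - z] t =
      ((φt t / t : ℝ) : ℂ) * (∫ z, dil k q z *
        g !₂[x 0 - t, x 1 - z - u !₂[x 0, x 1 - z] * γ t]) - ((t : ℂ))⁻¹ * g x := by
    rw [← congrFun hq x, partialConv, ← integral_const_mul, ← integral_const_mul,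
      ← integral_sub (i1.const_mul _) (i2.const_mul _)]
    congr 1
    ext z
    simp only [hilbertIntegrand]
    push_cast
    ring
  rw [e, hilbertIntegrand, offTranslate]
  push_cast
  ring

lemma integral_mul_setIntegral_swap {b : ℝ → ℂ} (hb : Integrable b) {A : ℝ → ℝ → ℂ}
    (hm : Measurable (Function.uncurry A)) {C : ℝ} (hC : ∀ z, ∀ t ∈ Icc (-1 : ℝ) 1, ‖A z t‖ ≤ C) :
    IntegrableOn (fun t => ∫ z, b z * A z t) (Icc (-1) 1) ∧
      ∫ z, b z * ∫ t in Icc (-1) 1, A z t = ∫ t in Icc (-1) 1, ∫ z, b z * A z t := by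
  have i0 : Integrable (fun y : ℝ × ℝ => b y.1 * (1 : ℂ))
      (volume.prod (volume.restrict (Icc (-1 : ℝ) 1))) :=
    hb.mul_prod (g := fun _ : ℝ => (1 : ℂ)) (integrable_const _)
  simp only [mul_one] at i0
  have i1 : Integrable (Function.uncurry fun z t => b z * A z t)
      (volume.prod (volume.restrict (Icc (-1 : ℝ) 1))) := by
    refine i0.mul_bdd (c := C) hm.aestronglyMeasurable ?_
    refine (Measure.ae_prod_iff_ae_ae (measurableSet_le hm.norm measurable_const)).2 ?_
    exact ae_of_all _ fun z => (ae_restrict_iff' measurableSet_Icc).2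
      (ae_of_all _ fun t ht => hC z t ht)
  refine ⟨i1.integral_prod_right, ?_⟩
  rw [← integral_integral_swap i1]
  simp only [integral_const_mul]

lemma hilbertAlong_sub_partialConv {q : 𝓢(ℝ, ℂ)} {k : ℤ} (h : IsCutCurve L B γ φt)
    (hu : LipschitzWith (1 / 2) u) (hq : partialConv k q g = g) (x : Plane) :
    hilbertAlong γ φt u g x - partialConv k q (hilbertAlong γ φt u g) x =
      ∫ t in Icc (-1) 1, ((φt t / t : ℝ) : ℂ) * offTranslate γ u q k g x t := by
  obtain ⟨C, hC, hb⟩ := exists_hilbertIntegrand_le h hu g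
  set T : ℝ × ℝ → Plane × ℝ := fun y => (!₂[x 0, x 1 - y.1], y.2) with hT
  have cT : Continuous T :=
    (continuous_shift.comp (by fun_prop : Continuous fun y : ℝ × ℝ => (x, y.1))).prodMk
      continuous_snd
  have m1 := (measurable_hilbertIntegrand h hu.continuous g.continuous).comp cT.measurable
  obtain ⟨i1, e1⟩ := integral_mul_setIntegral_swap (isTame_dil k q).integrable
    (A := fun z t => hilbertIntegrand γ φt u g !₂[x 0, x 1 - z] t) m1 (C := C) fun z t ht => by
      refine ((hb t (abs_le_one_of_mem ht)).1 _).trans ?_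
      exact div_le_self hC.le (one_le_pow₀ (by linarith [norm_nonneg (!₂[x 0, x 1 - z] : Plane)]))
  have e : partialConv k q (hilbertAlong γ φt u g) x =
      ∫ t in Icc (-1) 1, ∫ z, dil k q z * hilbertIntegrand γ φt u g !₂[x 0, x 1 - z] t := by
    rw [← e1, partialConv]
    congr 1
    ext z
    rw [hilbertAlong_eq h hu]
  rw [e, hilbertAlong_eq h hu, ← integral_sub (integrableOn_hilbertIntegrand h hu x) i1]
  exact integral_congr_ae (ae_of_all _ fun t =>
    hilbertIntegrand_sub_partialConv h hu.continuous hq x t)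

end PrincipalValue

section Projection

variable {φ ψ : ℝ → ℂ} {f : 𝓢(Plane, ℂ)} {k : ℤ}

lemma exists_schwartz_freqCut (h1 : ContDiff ℝ ∞ φ) (h2 : HasCompactSupport φ) (f : 𝓢(Plane, ℂ))
    (k : ℤ) : ∃ G : 𝓢(Plane, ℂ), ∀ ξ, G ξ = freqCut φ k f ξ := by
  set T : Plane →L[ℝ] ℝ := (2 : ℝ) ^ (-k) • EuclideanSpace.proj (𝕜 := ℝ) 1 with hT
  have hg : Function.HasTemperateGrowth ((h2.toSchwartzMap h1) ∘ T) :=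
    (h2.toSchwartzMap h1).hasTemperateGrowth.comp T.hasTemperateGrowth
  refine ⟨SchwartzMap.smulLeftCLM ℂ ((h2.toSchwartzMap h1) ∘ T) (𝓕 f), fun ξ => ?_⟩
  rw [SchwartzMap.smulLeftCLM_apply_apply hg, freqCut, SchwartzMap.fourier_coe]
  rfl

/-- Frequency projections of Schwartz functions are Schwartz functions. -/
lemma exists_schwartz_proj₂ (h1 : ContDiff ℝ ∞ φ) (h2 : HasCompactSupport φ) (f : 𝓢(Plane, ℂ))
    (k : ℤ) : ∃ g : 𝓢(Plane, ℂ), ⇑g = proj₂ φ k f ∧ 𝓕 (⇑g) = freqCut φ k f := by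
  obtain ⟨G, hG⟩ := exists_schwartz_freqCut h1 h2 f k
  have e : ⇑G = freqCut φ k f := funext hG
  refine ⟨𝓕⁻ G, ?_, ?_⟩
  · rw [proj₂, SchwartzMap.fourierInv_coe, e]
  · rw [← SchwartzMap.fourier_coe, FourierTransform.fourier_fourierInv_eq, e]

lemma integrable_freqCut_schwartz (h1 : ContDiff ℝ ∞ φ) (h2 : HasCompactSupport φ)
    (f : 𝓢(Plane, ℂ)) (k : ℤ) : Integrable (freqCut φ k f) := by
  obtain ⟨G, hG⟩ := exists_schwartz_freqCut h1 h2 f k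
  rw [← show ⇑G = freqCut φ k f from funext hG]
  exact G.integrable

lemma proj₂_schwartz_eq {a : 𝓢(ℝ, ℂ)} (ha : ∀ s, 𝓕 a s = φ s) (h1 : ContDiff ℝ ∞ φ)
    (h2 : HasCompactSupport φ) (f : 𝓢(Plane, ℂ)) (k : ℤ) : proj₂ φ k f = partialConv k a f := by
  obtain ⟨M, hM⟩ := schwartz_exists_bound f
  exact proj₂_eq_partialConv ha f.integrable f.continuous hM (integrable_freqCut_schwartz h1 h2 f k)

lemma partialConv_proj₂ {q : 𝓢(ℝ, ℂ)} (hq : ∀ s, 𝓕 q s = ψ s) (hφψ : ∀ s, ψ s * φ s = φ s)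
    (h1 : ContDiff ℝ ∞ φ) (h2 : HasCompactSupport φ) {g : 𝓢(Plane, ℂ)} (hg : ⇑g = proj₂ φ k f)
    (hg' : 𝓕 (⇑g) = freqCut φ k f) : partialConv k q g = g := by
  have e : freqCut ψ k g = freqCut φ k f := by
    ext ξ
    rw [freqCut, hg', freqCut, ← mul_assoc, hφψ]
  obtain ⟨M, hM⟩ := schwartz_exists_bound g
  rw [← proj₂_eq_partialConv hq g.integrable g.continuous hM
    (by rw [e]; exact integrable_freqCut_schwartz h1 h2 f k), proj₂, e, hg, proj₂]

lemma partialConv_point (k : ℤ) (a : ℝ → ℂ) (F : Plane → ℂ) (p w : ℝ) :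
    partialConv k a F !₂[p, w] = convAt k a (fun y => F !₂[p, y]) w := by
  simp only [partialConv, convAt, kernelOp]
  rw [← integral_sub_left_eq_self _ volume w]
  congr 1
  ext z
  simp

lemma continuous_slice {F : Plane → ℂ} (hF : Continuous F) (p : ℝ) :
    Continuous fun y : ℝ => F !₂[p, y] :=
  hF.comp (continuous_point.comp (by fun_prop : Continuous fun y : ℝ => (p, y)))

lemma isTame_slice (f : 𝓢(Plane, ℂ)) (p : ℝ) : IsTame fun y => f !₂[p, y] := by
  have hc := continuous_slice f.continuous p
  obtain ⟨M, hM⟩ := schwartz_exists_bound f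
  refine ⟨hc.measurable, ?_, M, fun y => hM _⟩
  obtain ⟨C, hC, h⟩ := schwartz_norm_le f 2
  refine (integrable_inv_one_add_abs_sq.const_mul C).mono' hc.aestronglyMeasurable
    (ae_of_all _ fun y => (h _).trans ?_)
  rw [div_eq_mul_inv]
  have : |y| ≤ ‖(!₂[p, y] : Plane)‖ := PiLp.norm_apply_le (!₂[p, y] : Plane) 1
  gcongr

/-- A Lipschitz bound in the second variable for the projection to frequencies of size `2 ^ k`. -/
noncomputable def lipBound (φ : ℝ → ℂ) (f : Plane → ℂ) (k : ℤ) : ℝ :=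
  ∫ ξ : Plane, 2 * Real.pi * |ξ 1| * ‖freqCut φ k f ξ‖

lemma norm_fourierChar_sub_le (s t : ℝ) :
    ‖(Real.fourierChar s : ℂ) - (Real.fourierChar t : ℂ)‖ ≤ 2 * Real.pi * |s - t| := by
  have e : (Real.fourierChar s : ℂ) - (Real.fourierChar t : ℂ) =
      (Real.fourierChar t : ℂ) *
        (Complex.exp (Complex.I * ((2 * Real.pi * (s - t) : ℝ) : ℂ)) - 1) := by
    simp only [Real.fourierChar_apply]
    rw [mul_sub, mul_one, ← Complex.exp_add]
    congr 2
    push_cast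
    ring
  rw [e, norm_mul, Circle.norm_coe, one_mul]
  refine (Real.norm_exp_I_mul_ofReal_sub_one_le).trans (le_of_eq ?_)
  rw [Real.norm_eq_abs, abs_mul, abs_of_pos (by positivity)]

lemma abs_le_of_freqCut_ne_zero (hs : Function.support φ ⊆ {t : ℝ | 1 / 2 ≤ |t| ∧ |t| ≤ 2})
    {F : Plane → ℂ} {ξ : Plane} (h : freqCut φ k F ξ ≠ 0) : |ξ 1| ≤ 2 * (2 : ℝ) ^ k := by
  have h1 : φ ((2 : ℝ) ^ (-k) * ξ 1) ≠ 0 := left_ne_zero_of_mul h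
  have h2 := (hs h1).2
  rw [abs_mul, abs_of_pos (by positivity), zpow_neg, inv_mul_le_iff₀ (by positivity)] at h2
  linarith

lemma integrable_lipBound (hs : Function.support φ ⊆ {t : ℝ | 1 / 2 ≤ |t| ∧ |t| ≤ 2})
    (h1 : ContDiff ℝ ∞ φ) (h2 : HasCompactSupport φ) (f : 𝓢(Plane, ℂ)) (k : ℤ) :
    Integrable fun ξ : Plane => 2 * Real.pi * |ξ 1| * ‖freqCut φ k f ξ‖ := by
  have hi := integrable_freqCut_schwartz h1 h2 f k
  have c1 := continuous_coord 1
  refine (hi.norm.const_mul (2 * Real.pi * (2 * (2 : ℝ) ^ k))).mono'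
    ((by fun_prop : Continuous fun ξ : Plane => 2 * Real.pi * |ξ 1|).aestronglyMeasurable.mul
      hi.aestronglyMeasurable.norm) (ae_of_all _ fun ξ => ?_)
  rw [Real.norm_of_nonneg (by positivity)]
  by_cases h0 : freqCut φ k f ξ = 0
  · simp [h0]
  · have := abs_le_of_freqCut_ne_zero hs h0
    gcongr

lemma norm_proj₂_sub_le (hs : Function.support φ ⊆ {t : ℝ | 1 / 2 ≤ |t| ∧ |t| ≤ 2})
    (h1 : ContDiff ℝ ∞ φ) (h2 : HasCompactSupport φ) (f : 𝓢(Plane, ℂ)) (k : ℤ) (p w w' : ℝ) :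
    ‖proj₂ φ k f !₂[p, w] - proj₂ φ k f !₂[p, w']‖ ≤ lipBound φ f k * |w - w'| := by
  have hi := integrable_freqCut_schwartz h1 h2 f k
  have i1 : ∀ x : Plane, Integrable fun ξ : Plane =>
      (Real.fourierChar (inner ℝ ξ x) : ℂ) * freqCut φ k f ξ := fun x => by
    have := (Real.fourierIntegral_convergent_iff (μ := volume) (-x)).2 hi
    simpa only [Circle.smul_def, smul_eq_mul, inner_neg_right, neg_neg] using this
  simp only [proj₂, Real.fourierInv_eq, Circle.smul_def, smul_eq_mul]
  rw [← integral_sub (i1 _) (i1 _), lipBound, ← integral_mul_const]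
  refine norm_integral_le_of_norm_le ((integrable_lipBound hs h1 h2 f k).mul_const _)
    (ae_of_all _ fun ξ => ?_)
  rw [← sub_mul, norm_mul]
  have e : inner ℝ ξ (!₂[p, w] : Plane) - inner ℝ ξ (!₂[p, w'] : Plane) = ξ 1 * (w - w') := by
    simp only [PiLp.inner_apply, Fin.sum_univ_two, RCLike.inner_apply, conj_trivial]
    simp
    ring
  have := norm_fourierChar_sub_le (inner ℝ ξ (!₂[p, w] : Plane)) (inner ℝ ξ (!₂[p, w'] : Plane))
  rw [e, abs_mul] at this
  calc _ ≤ 2 * Real.pi * (|ξ 1| * |w - w'|) * ‖freqCut φ k f ξ‖ := by gcongr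
    _ = _ := by ring

lemma sum_abs_mul_norm_le (hs : Function.support φ ⊆ {t : ℝ | 1 / 2 ≤ |t| ∧ |t| ≤ 2}) {M : ℝ}
    (hM : ∀ s, ‖φ s‖ ≤ M) (r : ℝ) (S : Finset ℤ) :
    ∑ k ∈ S, |(2 : ℝ) ^ (-k) * r| * ‖φ ((2 : ℝ) ^ (-k) * r)‖ ≤ 6 * M := by
  have hM0 : 0 ≤ M := (norm_nonneg _).trans (hM 0)
  rcases eq_or_ne r 0 with rfl | hr
  · simp; linarith
  obtain ⟨n, hn1, hn2⟩ := exists_mem_Ico_zpow (abs_pos.2 hr) (one_lt_two (α := ℝ))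
  have hb : ∀ k : ℤ, |(2 : ℝ) ^ (-k) * r| * ‖φ ((2 : ℝ) ^ (-k) * r)‖ ≤ 2 * M := fun k => by
    by_cases h0 : φ ((2 : ℝ) ^ (-k) * r) = 0
    · rw [h0]; simp; linarith
    · exact mul_le_mul (hs h0).2 (hM _) (norm_nonneg _) (by norm_num)
  calc _ ≤ ∑ k ∈ Finset.Icc (n - 1) (n + 1), |(2 : ℝ) ^ (-k) * r| * ‖φ ((2 : ℝ) ^ (-k) * r)‖ := by
        rw [← Finset.sum_filter_of_ne (p := fun k => k ∈ Finset.Icc (n - 1) (n + 1))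
          fun k _ hk => ?_]
        · exact Finset.sum_le_sum_of_subset_of_nonneg (fun k hk => (Finset.mem_filter.1 hk).2)
            fun k _ _ => by positivity
        have h0 : φ ((2 : ℝ) ^ (-k) * r) ≠ 0 := fun h => hk (by rw [h]; simp)
        obtain ⟨a1, a2⟩ := hs h0
        rw [abs_mul, abs_of_pos (by positivity)] at a1 a2
        rw [Finset.mem_Icc]
        have b1 : (2 : ℝ) ^ (-k + n) ≤ 2 ^ (1 : ℤ) := by
          rw [zpow_add₀ two_ne_zero, zpow_one]
          exact le_trans (by gcongr) a2
        have b2 : (2 : ℝ) ^ (-1 : ℤ) < 2 ^ (-k + (n + 1)) := by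
          rw [zpow_add₀ two_ne_zero]
          refine lt_of_le_of_lt (le_trans (by norm_num) a1) ?_
          gcongr
        have c1 := (zpow_le_zpow_iff_right₀ (one_lt_two (α := ℝ))).1 b1
        have c2 := (zpow_lt_zpow_iff_right₀ (one_lt_two (α := ℝ))).1 b2
        omega
    _ ≤ ∑ k ∈ Finset.Icc (n - 1) (n + 1), 2 * M := Finset.sum_le_sum fun k _ => hb k
    _ = _ := by
        rw [Finset.sum_const, Int.card_Icc, show (n + 1 + 1 - (n - 1)).toNat = 3 by omega]
        simp; ring

lemma summable_lipBound (hs : Function.support φ ⊆ {t : ℝ | 1 / 2 ≤ |t| ∧ |t| ≤ 2})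
    (h1 : ContDiff ℝ ∞ φ) (h2 : HasCompactSupport φ) (f : 𝓢(Plane, ℂ)) :
    Summable fun k : ℤ => (2 : ℝ) ^ (-k) * lipBound φ f k := by
  obtain ⟨M, hM⟩ := h2.exists_bound_of_continuous h1.continuous
  have hi : Integrable (𝓕 (⇑f)) := by
    rw [← SchwartzMap.fourier_coe]; exact (𝓕 f).integrable
  refine summable_of_sum_le (c := ∫ ξ, 2 * Real.pi * (6 * M) * ‖𝓕 (⇑f) ξ‖) (fun k => ?_) fun S => ?_
  · exact mul_nonneg (by positivity) (integral_nonneg fun ξ => by positivity)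
  · simp only [lipBound, ← integral_const_mul]
    rw [← integral_finsetSum _ fun k _ => (integrable_lipBound hs h1 h2 f k).const_mul _]
    refine integral_mono (integrable_finsetSum _ fun k _ =>
      (integrable_lipBound hs h1 h2 f k).const_mul _) (hi.norm.const_mul _) fun ξ => ?_
    have := sum_abs_mul_norm_le hs hM (ξ 1) S
    calc _ = 2 * Real.pi * (∑ k ∈ S, |(2 : ℝ) ^ (-k) * ξ 1| * ‖φ ((2 : ℝ) ^ (-k) * ξ 1)‖) *
          ‖𝓕 (⇑f) ξ‖ := by
          rw [Finset.mul_sum, Finset.sum_mul]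
          refine Finset.sum_congr rfl fun k _ => ?_
          rw [freqCut, norm_mul, abs_mul, abs_of_pos (by positivity : (0 : ℝ) < 2 ^ (-k))]
          ring
      _ ≤ _ := by gcongr

lemma integral_norm_dil_mul_abs (k : ℤ) (q : ℝ → ℂ) :
    ∫ z, ‖dil k q z‖ * |z| = (2 : ℝ) ^ (-k) * ∫ z, ‖q z‖ * |z| := by
  have hp : (0 : ℝ) < 2 ^ k := by positivity
  have := Measure.integral_comp_mul_left (fun z => ‖q z‖ * |z|) ((2 : ℝ) ^ k)
  rw [abs_of_pos (by positivity), smul_eq_mul] at this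
  rw [zpow_neg, ← this]
  congr 1
  ext z
  rw [dil, norm_mul, Complex.norm_real, Real.norm_of_nonneg hp.le, abs_mul, abs_of_pos hp]
  ring

lemma integrable_norm_dil_mul_abs (k : ℤ) (q : 𝓢(ℝ, ℂ)) :
    Integrable fun z => ‖dil k q z‖ * |z| := by
  have hp : (0 : ℝ) < 2 ^ k := by positivity
  have h0 : Integrable fun z => ‖q z‖ * |z| := by
    simpa [mul_comm] using q.integrable_pow_mul volume 1
  have := h0.comp_mul_left' hp.ne'
  refine this.congr (ae_of_all _ fun z => ?_)
  simp only
  rw [dil, norm_mul, Complex.norm_real, Real.norm_of_nonneg hp.le, abs_mul, abs_of_pos hp]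
  ring

lemma norm_offTranslate_le {L B : ℝ} {γ φt : ℝ → ℝ} {u : Plane → ℝ} (h : IsCutCurve L B γ φt)
    (hu : LipschitzWith (1 / 2) u) {q : 𝓢(ℝ, ℂ)} {g : 𝓢(Plane, ℂ)} (hq : partialConv k q g = g)
    {N : ℝ} (hN : ∀ p w w', ‖g !₂[p, w] - g !₂[p, w']‖ ≤ N * |w - w'|) (x : Plane) (t : ℝ) :
    ‖offTranslate γ u q k g x t‖ ≤ L * |t| * (∫ z, ‖q z‖ * |z|) * ((2 : ℝ) ^ (-k) * N) := by
  obtain ⟨M, hM⟩ := schwartz_exists_bound g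
  have hN0 : 0 ≤ N := by
    have := (norm_nonneg _).trans (hN 0 1 0)
    simpa using this
  have huc := hu.continuous
  have hL := h.pos_L
  have c1 : Continuous fun z : ℝ => g !₂[x 0 - t, x 1 - z - u !₂[x 0, x 1 - z] * γ t] :=
    g.continuous.comp ((continuous_curve h huc).comp
      ((continuous_shift.comp (by fun_prop : Continuous fun z : ℝ => (x, z))).prodMk
        (continuous_const (y := t))))
  have c2 : Continuous fun z : ℝ => g !₂[x 0 - t, x 1 - u x * γ t - z] :=
    (continuous_slice g.continuous (x 0 - t)).comp (by fun_prop)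
  have iq := (isTame_dil k q).integrable
  have i1 : Integrable fun z : ℝ =>
      dil k q z * g !₂[x 0 - t, x 1 - z - u !₂[x 0, x 1 - z] * γ t] :=
    iq.mul_bdd c1.aestronglyMeasurable (ae_of_all _ fun z => hM _)
  have i2 : Integrable fun z : ℝ => dil k q z * g !₂[x 0 - t, x 1 - u x * γ t - z] :=
    iq.mul_bdd c2.aestronglyMeasurable (ae_of_all _ fun z => hM _)
  have e : g !₂[x 0 - t, x 1 - u x * γ t] =
      ∫ z, dil k q z * g !₂[x 0 - t, x 1 - u x * γ t - z] := by
    conv_lhs => rw [← hq]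
    rfl
  rw [offTranslate, e, ← integral_sub i2 i1]
  have hI : Integrable fun z => (1 / 2 * |γ t| * N) * (‖dil k q z‖ * |z|) :=
    (integrable_norm_dil_mul_abs k q).const_mul _
  refine (norm_integral_le_of_norm_le hI (ae_of_all _ fun z => ?_)).trans ?_
  · rw [← mul_sub, norm_mul]
    have hz : |u x - u !₂[x 0, x 1 - z]| ≤ 1 / 2 * |z| := by
      refine (abs_sub_le_of_lipschitz hu _ _).trans (le_of_eq ?_)
      rw [point_sub_eq, show x - (x + -z • EuclideanSpace.single 1 1) =
        z • EuclideanSpace.single (1 : Fin 2) (1 : ℝ) by rw [neg_smul]; abel, norm_smul,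
        PiLp.norm_single]
      simp
    calc _ ≤ ‖dil k q z‖ * (N * |(x 1 - u x * γ t - z) -
          (x 1 - z - u !₂[x 0, x 1 - z] * γ t)|) := by gcongr; exact hN _ _ _
      _ = ‖dil k q z‖ * (N * (|u x - u !₂[x 0, x 1 - z]| * |γ t|)) := by
          rw [show (x 1 - u x * γ t - z) - (x 1 - z - u !₂[x 0, x 1 - z] * γ t) =
            -((u x - u !₂[x 0, x 1 - z]) * γ t) by ring, abs_neg, abs_mul]
      _ ≤ ‖dil k q z‖ * (N * (1 / 2 * |z| * |γ t|)) := by gcongr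
      _ = _ := by ring
  · rw [integral_const_mul, integral_norm_dil_mul_abs]
    have hq0 : 0 ≤ ∫ z, ‖q z‖ * |z| := integral_nonneg fun z => by positivity
    calc _ ≤ (1 * (L * |t|) * N) * ((2 : ℝ) ^ (-k) * ∫ z, ‖q z‖ * |z|) := by
          gcongr
          · norm_num
          · exact h.bound t
      _ = _ := by ring

end Projection

section Slices

variable {L B : ℝ} {γ φt : ℝ → ℝ} {u : Plane → ℝ} {a q : 𝓢(ℝ, ℂ)} {k : ℤ} {p : ℝ}

lemma measurable_offTranslate (h : IsCutCurve L B γ φt) (hu : Continuous u) {G : Plane → ℂ}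
    (hG : Continuous G) (q : 𝓢(ℝ, ℂ)) (k : ℤ) :
    Measurable fun y : Plane × ℝ => offTranslate γ u q k G y.1 y.2 := by
  have c := continuous_curve h hu
  have cT : Continuous fun y : (Plane × ℝ) × ℝ =>
      ((!₂[y.1.1 0, y.1.1 1 - y.2] : Plane), y.1.2) :=
    (continuous_shift.comp (by fun_prop : Continuous fun y : (Plane × ℝ) × ℝ =>
      (y.1.1, y.2))).prodMk (by fun_prop)
  have c2 := ((continuous_dil k q.continuous).comp (continuous_snd (X := Plane × ℝ))).mul
    (hG.comp (c.comp cT))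
  have m2 := c2.stronglyMeasurable.integral_prod_right' (ν := (volume : Measure ℝ))
  exact (hG.comp c).measurable.sub m2.measurable

lemma offTranslate_partialConv (f : 𝓢(Plane, ℂ)) (a q : 𝓢(ℝ, ℂ)) (x₀ b t : ℝ) :
    offTranslate γ u q k (partialConv k a f) !₂[x₀, b] t =
      convAt k a (fun y => f !₂[x₀ - t, y]) (b - u !₂[x₀, b] * γ t) -
        ∫ v, dil k q (b - v) * convAt k a (fun y => f !₂[x₀ - t, y]) (v - u !₂[x₀, v] * γ t) := by
  rw [← integral_sub_left_eq_self (fun v => dil k q (b - v) *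
    convAt k a (fun y => f !₂[x₀ - t, y]) (v - u !₂[x₀, v] * γ t)) volume b]
  simp only [← partialConv_point, sub_sub_cancel]
  rfl

lemma exists_isNearId_slice (h : IsCutCurve L B γ φt) (hu : LipschitzWith (1 / 2) u) (x₀ : ℝ)
    {t : ℝ}
    (ht : φt t ≠ 0) : ∃ X, IsNearId (L * |t| / 2) (fun b => b - u !₂[x₀, b] * γ t) X := by
  have hL := h.pos_L
  have hs := (h.supp_cut t ht).2
  refine exists_isNearId (by positivity) (by linarith) fun b b' => ?_
  rw [show b - u !₂[x₀, b] * γ t - (b' - u !₂[x₀, b'] * γ t) - (b - b') =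
    -((u !₂[x₀, b] - u !₂[x₀, b']) * γ t) by ring, abs_neg, abs_mul]
  have h1 := abs_sub_le_of_lipschitz hu !₂[x₀, b] !₂[x₀, b']
  have e : (!₂[x₀, b] : Plane) - !₂[x₀, b'] = !₂[0, b - b'] := by
    ext i
    fin_cases i <;> simp
  have h2 : ‖(!₂[0, b - b'] : Plane)‖ ≤ |b - b'| := by
    refine (norm_point_le _ _).trans ?_
    simp
  rw [e] at h1
  calc _ ≤ 1 / 2 * |b - b'| * (L * |t|) := by
        gcongr
        · exact h1.trans (by gcongr)
        · exact h.bound t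
    _ = _ := by ring

/-- The `L^p` bound for a fixed translate. -/
lemma exists_offTranslate_Lp (hp : 1 < p) (ha0 : ∫ r, a r = 0) (hq0 : ∫ r, q r = 0)
    (hqa : ∀ r, ∫ z, q z * a (r - z) = a r) :
    ∃ C : ℝ, 0 < C ∧ ∀ (L B : ℝ) (γ φt : ℝ → ℝ), IsCutCurve L B γ φt → ∀ u : Plane → ℝ,
      LipschitzWith (1 / 2) u → ∀ (f : 𝓢(Plane, ℂ)) (S : Finset ℤ) (t : ℝ), t ≠ 0 → φt t ≠ 0 →
      ∫⁻ x, ‖∑ k ∈ S, offTranslate γ u q k (partialConv k a f) x t‖ₑ ^ p ≤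
        ENNReal.ofReal (C * √(L * |t| / 2) ^ p) * ∫⁻ x, ‖f x‖ₑ ^ p := by
  obtain ⟨C, hC, hcomm⟩ := exists_comm_Lp hp a q ha0 hq0 hqa
  refine ⟨C, hC, fun L B γ φt h u hu f S t ht hφ => ?_⟩
  have hL := h.pos_L
  obtain ⟨M, hM⟩ := schwartz_exists_bound f
  have m1 : Measurable fun x => ‖∑ k ∈ S, offTranslate γ u q k (partialConv k a f) x t‖ₑ ^ p := by
    refine (Measurable.enorm ?_).pow_const p
    refine Finset.measurable_fun_sum _ fun k _ => ?_
    have := (measurable_offTranslate h hu.continuous (continuous_partialConv (k := k) (b := a)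
      f.continuous hM) q k).comp (measurable_prodMk_right (y := t))
    simpa only [Function.comp_def] using this
  rw [lintegral_plane m1, lintegral_plane (f.continuous.measurable.enorm.pow_const p),
    ← lintegral_sub_right_eq_self (fun x₀ => ∫⁻ y, ‖f !₂[x₀, y]‖ₑ ^ p) t,
    ← lintegral_const_mul' _ _ ENNReal.ofReal_ne_top]
  refine lintegral_mono fun x₀ => ?_
  obtain ⟨X, hX⟩ := exists_isNearId_slice h hu x₀ hφ
  have := hcomm _ _ X hX (by positivity) _ (isTame_slice f (x₀ - t))
    (continuous_slice f.continuous _) S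
  simp only [offTranslate_partialConv]
  exact this

end Slices

section Holder

lemma lintegral_mul_rpow_le {α : Type*} [MeasurableSpace α] {μ : Measure α} {w h : α → ℝ≥0∞} {p : ℝ}
    (hp : 1 < p) (hw : AEMeasurable w μ) (hh : AEMeasurable h μ) :
    (∫⁻ t, w t * h t ∂μ) ^ p ≤ (∫⁻ t, w t ∂μ) ^ (p - 1) * ∫⁻ t, w t * h t ^ p ∂μ := by
  have hpq := (Real.HolderConjugate.conjExponent hp).symm
  set r := p.conjExponent
  have hp0 : 0 < p := by linarith
  have hr0 := hpq.pos
  have key := ENNReal.lintegral_mul_le_Lp_mul_Lq μ hpq (f := fun t => w t ^ (1 / r))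
    (g := fun t => w t ^ (1 / p) * h t) (hw.pow_const _) ((hw.pow_const _).mul hh)
  have e1 : ∀ t, w t ^ (1 / r) * (w t ^ (1 / p) * h t) = w t * h t := fun t => by
    rw [← mul_assoc, ← ENNReal.rpow_add_of_nonneg _ _ (by positivity) (by positivity), one_div,
      one_div, hpq.inv_add_inv_eq_one, ENNReal.rpow_one]
  have e2 : ∀ t, (w t ^ (1 / r)) ^ r = w t := fun t => by
    rw [← ENNReal.rpow_mul, one_div_mul_cancel hr0.ne', ENNReal.rpow_one]
  have e3 : ∀ t, (w t ^ (1 / p) * h t) ^ p = w t * h t ^ p := fun t => by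
    rw [ENNReal.mul_rpow_of_nonneg _ _ hp0.le, ← ENNReal.rpow_mul, one_div_mul_cancel hp0.ne',
      ENNReal.rpow_one]
  simp only [Pi.mul_apply, e1, e2, e3] at key
  have := ENNReal.rpow_le_rpow key hp0.le
  rw [ENNReal.mul_rpow_of_nonneg _ _ hp0.le, ← ENNReal.rpow_mul, ← ENNReal.rpow_mul,
    one_div_mul_cancel hp0.ne', ENNReal.rpow_one] at this
  convert this using 3
  have h3 := hpq.inv_add_inv_eq_one
  have h4 := hpq.symm.ne_zero
  field_simp at h3 ⊢
  linarith

/-- The mass of the weight `|t| ^ (-1/2)` on `[-1, 1]`. -/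
noncomputable def sqrtMass : ℝ≥0∞ := ∫⁻ t in Icc (-1 : ℝ) 1, ENNReal.ofReal (√|t|)⁻¹

lemma sqrtMass_lt_top : sqrtMass < ⊤ := by
  have hi : IntegrableOn (fun t : ℝ => (√|t|)⁻¹) (Metric.ball 0 2) := by
    refine integrableOn_ball_of_norm_le_rpow (μ := volume) (C := 1) (α := 1 / 2) (by simp)
      (by simp; norm_num) (ae_of_all _ fun t => ?_) (by fun_prop)
    rw [one_mul, Real.norm_of_nonneg (by positivity), Real.sqrt_eq_rpow, Real.norm_eq_abs,
      Real.rpow_neg (abs_nonneg _)]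
  have hi2 : IntegrableOn (fun t : ℝ => (√|t|)⁻¹) (Icc (-1) 1) :=
    hi.mono_set fun t ht => by
      rw [mem_ball_zero_iff, Real.norm_eq_abs]
      linarith [abs_le_one_of_mem ht]
  refine lt_of_le_of_lt (lintegral_mono fun t => ?_) hi2.2
  rw [← ofReal_norm]
  exact ENNReal.ofReal_le_ofReal (le_abs_self _)

/-- Integration against `dt / t` of a family of functions whose `L^p` norms are `O(√|t|)`. -/
lemma lintegral_setLIntegral_rpow_le {p : ℝ} (hp : 1 < p) {H : Plane → ℝ → ℝ≥0∞}
    (hH : Measurable (Function.uncurry H)) {K : ℝ≥0∞}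
    (hK : ∀ t, t ≠ 0 → ∫⁻ x, H x t ^ p ≤ ENNReal.ofReal (√|t| ^ p) * K) :
    ∫⁻ x, (∫⁻ t in Icc (-1 : ℝ) 1, ENNReal.ofReal |t|⁻¹ * H x t) ^ p ≤ sqrtMass ^ p * K := by
  have hp0 : 0 < p := by linarith
  set v : ℝ → ℝ≥0∞ := fun t => ENNReal.ofReal (√|t|)⁻¹ with hv
  have mv : Measurable v := by fun_prop
  have mHx : ∀ x, Measurable (H x) := fun x => hH.comp measurable_prodMk_left
  have mHt : ∀ t, Measurable fun x => H x t := fun t => hH.comp measurable_prodMk_right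
  have e1 : ∀ t : ℝ, ENNReal.ofReal |t|⁻¹ = v t * v t := fun t => by
    rw [hv, ← ENNReal.ofReal_mul (by positivity), ← mul_inv, Real.mul_self_sqrt (abs_nonneg _)]
  have hW : sqrtMass = ∫⁻ t in Icc (-1 : ℝ) 1, v t := rfl
  have hWt := sqrtMass_lt_top
  have m2 : Measurable (Function.uncurry fun x t => v t * (v t * H x t) ^ p) := by
    simp only [Function.uncurry_def]
    exact (mv.comp measurable_snd).mul (((mv.comp measurable_snd).mul hH).pow_const p)
  calc ∫⁻ x, (∫⁻ t in Icc (-1 : ℝ) 1, ENNReal.ofReal |t|⁻¹ * H x t) ^ p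
      ≤ ∫⁻ x, sqrtMass ^ (p - 1) * ∫⁻ t in Icc (-1 : ℝ) 1, v t * (v t * H x t) ^ p := by
        refine lintegral_mono fun x => ?_
        simp only [e1, mul_assoc]
        exact lintegral_mul_rpow_le hp mv.aemeasurable (mv.mul (mHx x)).aemeasurable
    _ = sqrtMass ^ (p - 1) * ∫⁻ t in Icc (-1 : ℝ) 1, ∫⁻ x, v t * (v t * H x t) ^ p := by
        rw [lintegral_const_mul' _ _ (ENNReal.rpow_ne_top_of_nonneg (by linarith) hWt.ne),
          lintegral_lintegral_swap m2.aemeasurable]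
    _ ≤ sqrtMass ^ (p - 1) * ∫⁻ t in Icc (-1 : ℝ) 1, v t * K := by
        refine mul_le_mul' le_rfl (lintegral_mono_ae ?_)
        have : ∀ᵐ t : ℝ ∂(volume.restrict (Icc (-1) 1)), t ≠ 0 :=
          ae_restrict_of_ae (by simp [ae_iff])
        filter_upwards [this] with t ht
        rw [lintegral_const_mul' _ _ ENNReal.ofReal_ne_top]
        refine mul_le_mul' le_rfl ?_
        simp only [ENNReal.mul_rpow_of_nonneg _ _ hp0.le]
        rw [lintegral_const_mul' _ _ (ENNReal.rpow_ne_top_of_nonneg hp0.le ENNReal.ofReal_ne_top)]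
        refine (mul_le_mul' le_rfl (hK t ht)).trans (le_of_eq ?_)
        have hs : 0 < √|t| := Real.sqrt_pos.2 (abs_pos.2 ht)
        rw [← mul_assoc, ENNReal.ofReal_rpow_of_pos (by positivity),
          ← ENNReal.ofReal_mul (by positivity), ← Real.mul_rpow (by positivity) (by positivity),
          inv_mul_cancel₀ hs.ne', Real.one_rpow, ENNReal.ofReal_one, one_mul]
    _ = sqrtMass ^ (p - 1) * (sqrtMass * K) := by rw [lintegral_mul_const _ mv, ← hW]
    _ = _ := by
        rw [← mul_assoc]
        congr 1
        conv_lhs => rw [← ENNReal.rpow_one sqrtMass, ← ENNReal.rpow_mul, one_mul]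
        rw [← ENNReal.rpow_add_of_nonneg _ _ (by linarith) zero_le_one, sub_add_cancel]

end Holder

section OffDiagonal

variable {L B : ℝ} {γ φt : ℝ → ℝ} {u : Plane → ℝ} {a q : 𝓢(ℝ, ℂ)} {φ ψ : ℝ → ℂ}

/-- The relation between the two frequency cutoffs and the corresponding convolution kernels. -/
structure IsCutPair (φ ψ : ℝ → ℂ) (a q : 𝓢(ℝ, ℂ)) : Prop where
  smooth_left : ContDiff ℝ ∞ φ
  compact_left : HasCompactSupport φ
  supp_left : Function.support φ ⊆ {t : ℝ | 1 / 2 ≤ |t| ∧ |t| ≤ 2}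
  smooth_right : ContDiff ℝ ∞ ψ
  compact_right : HasCompactSupport ψ
  fourier_left : ∀ s, 𝓕 a s = φ s
  fourier_right : ∀ s, 𝓕 q s = ψ s
  mul_eq : ∀ s, ψ s * φ s = φ s
  right_zero : ψ 0 = 0

namespace IsCutPair

lemma integral_left (hc : IsCutPair φ ψ a q) : ∫ r, a r = 0 := by
  refine integral_schwartz_eq_zero ?_
  rw [hc.fourier_left]
  by_contra h0
  have := (hc.supp_left h0).1
  norm_num at this

lemma integral_right (hc : IsCutPair φ ψ a q) : ∫ r, q r = 0 :=
  integral_schwartz_eq_zero (by rw [hc.fourier_right, hc.right_zero])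

lemma integral_mul (hc : IsCutPair φ ψ a q) (r : ℝ) : ∫ z, q z * a (r - z) = a r :=
  integral_mul_eq_of_fourier_mul_eq (fun ξ => by
    rw [hc.fourier_left, hc.fourier_right, hc.mul_eq]) r

lemma exists_projection (hc : IsCutPair φ ψ a q) (f : 𝓢(Plane, ℂ)) (k : ℤ) :
    ∃ g : 𝓢(Plane, ℂ), ⇑g = proj₂ φ k f ∧ ⇑g = partialConv k a f ∧ partialConv k q g = g ∧
      ∀ p w w', ‖g !₂[p, w] - g !₂[p, w']‖ ≤ lipBound φ f k * |w - w'| := by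
  obtain ⟨g, h1, h2⟩ := exists_schwartz_proj₂ hc.smooth_left hc.compact_left f k
  refine ⟨g, h1, ?_, ?_, fun p w w' => ?_⟩
  · rw [h1, proj₂_schwartz_eq hc.fourier_left hc.smooth_left hc.compact_left]
  · exact partialConv_proj₂ hc.fourier_right hc.mul_eq hc.smooth_left hc.compact_left h1 h2
  · rw [h1]
    exact norm_proj₂_sub_le hc.supp_left hc.smooth_left hc.compact_left f k p w w'

end IsCutPair

lemma integrable_freqCut_hilbertAlong (h : IsCutCurve L B γ φt) (hu : LipschitzWith (1 / 2) u)
    (hc : IsCutPair φ ψ a q) (f : 𝓢(Plane, ℂ)) (k : ℤ) :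
    Integrable (hilbertAlong γ φt u (proj₂ φ k f)) ∧
      Integrable (freqCut ψ k (hilbertAlong γ φt u (proj₂ φ k f))) := by
  obtain ⟨g, h1, -⟩ := hc.exists_projection f k
  rw [← h1]
  obtain ⟨C, hC⟩ := exists_isDecayLip_hilbertAlong h hu g
  exact ⟨hC.integrable, hC.integrable_freqCut hc.smooth_right.continuous hc.compact_right k⟩

lemma offDiagTerm_eq (h : IsCutCurve L B γ φt) (hu : LipschitzWith (1 / 2) u)
    (hc : IsCutPair φ ψ a q) (f : 𝓢(Plane, ℂ)) (k : ℤ) (x : Plane) :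
    offDiagTerm γ φt φ ψ u f k x =
      ∫ t in Icc (-1) 1, ((φt t / t : ℝ) : ℂ) * offTranslate γ u q k (partialConv k a f) x t := by
  obtain ⟨g, h1, h2, h3, -⟩ := hc.exists_projection f k
  obtain ⟨C, hC⟩ := exists_isDecayLip_hilbertAlong h hu g
  rw [offDiagTerm, ← h1, proj₂_eq_partialConv hc.fourier_right hC.integrable hC.continuous
    hC.norm_le (hC.integrable_freqCut hc.smooth_right.continuous hc.compact_right k),
    hilbertAlong_sub_partialConv h hu h3, ← h2]

lemma norm_div_mul_offTranslate_le (h : IsCutCurve L B γ φt) (hu : LipschitzWith (1 / 2) u)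
    (hc : IsCutPair φ ψ a q) (f : 𝓢(Plane, ℂ)) (k : ℤ) (x : Plane) (t : ℝ) :
    ‖((φt t / t : ℝ) : ℂ) * offTranslate γ u q k (partialConv k a f) x t‖ ≤
      B * L * (∫ z, ‖q z‖ * |z|) * ((2 : ℝ) ^ (-k) * lipBound φ f k) := by
  obtain ⟨g, h1, h2, h3, h4⟩ := hc.exists_projection f k
  have hL := h.pos_L
  have hB := h.pos_B
  have hI : 0 ≤ ∫ z, ‖q z‖ * |z| := integral_nonneg fun z => by positivity
  have hl : 0 ≤ lipBound φ f k := integral_nonneg fun z => by positivity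
  have hb := norm_offTranslate_le h hu h3 h4 x t
  rw [← h2, norm_mul, Complex.norm_real, norm_div, Real.norm_eq_abs, Real.norm_eq_abs]
  rcases eq_or_ne t 0 with rfl | ht
  · simp; positivity
  have ht' : 0 < |t| := abs_pos.2 ht
  calc _ ≤ B / |t| * (L * |t| * (∫ z, ‖q z‖ * |z|) * ((2 : ℝ) ^ (-k) * lipBound φ f k)) := by
        gcongr
        exact h.bound_cut t
    _ = _ := by field_simp

lemma measurable_div_mul_offTranslate (h : IsCutCurve L B γ φt) (hu : LipschitzWith (1 / 2) u)
    (f : 𝓢(Plane, ℂ)) (a q : 𝓢(ℝ, ℂ)) (k : ℤ) :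
    Measurable fun y : Plane × ℝ =>
      ((φt y.2 / y.2 : ℝ) : ℂ) * offTranslate γ u q k (partialConv k a f) y.1 y.2 := by
  obtain ⟨M, hM⟩ := schwartz_exists_bound f
  have hφ := h.cont_cut
  have m1 : Measurable fun y : Plane × ℝ => ((φt y.2 / y.2 : ℝ) : ℂ) :=
    Complex.measurable_ofReal.comp ((hφ.measurable.comp measurable_snd).div measurable_snd)
  exact m1.mul (measurable_offTranslate h hu.continuous
    (continuous_partialConv (k := k) (b := a) f.continuous hM) q k)

lemma stronglyMeasurable_offDiagTerm (h : IsCutCurve L B γ φt) (hu : LipschitzWith (1 / 2) u)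
    (hc : IsCutPair φ ψ a q) (f : 𝓢(Plane, ℂ)) (k : ℤ) :
    StronglyMeasurable (offDiagTerm γ φt φ ψ u f k) := by
  rw [show offDiagTerm γ φt φ ψ u f k = _ from funext (offDiagTerm_eq h hu hc f k)]
  exact (measurable_div_mul_offTranslate h hu f a q k).stronglyMeasurable.integral_prod_right'

lemma summable_offDiagTerm (h : IsCutCurve L B γ φt) (hu : LipschitzWith (1 / 2) u)
    (hc : IsCutPair φ ψ a q) (f : 𝓢(Plane, ℂ)) (x : Plane) :
    Summable fun k : ℤ => offDiagTerm γ φt φ ψ u f k x := by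
  have hs := (summable_lipBound hc.supp_left hc.smooth_left hc.compact_left f).mul_left
    (B * L * (∫ z, ‖q z‖ * |z|))
  refine Summable.of_norm_bounded (hs.mul_right 2) fun k => ?_
  rw [offDiagTerm_eq h hu hc]
  refine (norm_setIntegral_le_of_norm_le_const (by simp)
    fun t _ => norm_div_mul_offTranslate_le h hu hc f k x t).trans (le_of_eq ?_)
  congr 1
  simp; norm_num

lemma sum_offDiagTerm_eq (h : IsCutCurve L B γ φt) (hu : LipschitzWith (1 / 2) u)
    (hc : IsCutPair φ ψ a q) (f : 𝓢(Plane, ℂ)) (S : Finset ℤ) (x : Plane) :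
    ∑ k ∈ S, offDiagTerm γ φt φ ψ u f k x = ∫ t in Icc (-1) 1, ((φt t / t : ℝ) : ℂ) *
      ∑ k ∈ S, offTranslate γ u q k (partialConv k a f) x t := by
  simp only [offDiagTerm_eq h hu hc, Finset.mul_sum]
  rw [integral_finsetSum]
  intro k _
  have m := (measurable_div_mul_offTranslate h hu f a q k).comp (measurable_prodMk_left (x := x))
  refine Measure.integrableOn_of_bounded (by simp) m.aestronglyMeasurable
    (ae_of_all _ fun t => norm_div_mul_offTranslate_le h hu hc f k x t)

/-- The uniform `L^p` bound for the partial sums of the off-diagonal terms. -/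
lemma exists_sum_offDiagTerm_Lp {p : ℝ} (hp : 1 < p) (h : IsCutCurve L B γ φt)
    (hc : IsCutPair φ ψ a q) :
    ∃ K : ℝ≥0∞, K < ⊤ ∧ ∀ u : Plane → ℝ, LipschitzWith (1 / 2) u → ∀ (f : 𝓢(Plane, ℂ))
      (S : Finset ℤ),
      ∫⁻ x, ‖∑ k ∈ S, offDiagTerm γ φt φ ψ u f k x‖ₑ ^ p ≤ K * ∫⁻ x, ‖f x‖ₑ ^ p := by
  obtain ⟨C, hC, hCb⟩ := exists_offTranslate_Lp hp hc.integral_left hc.integral_right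
    hc.integral_mul
  have hp0 : 0 < p := by linarith
  have hL := h.pos_L
  have hB := h.pos_B
  refine ⟨sqrtMass ^ p * ENNReal.ofReal (B ^ p * (C * √(L / 2) ^ p)), ?_, fun u hu f S => ?_⟩
  · exact ENNReal.mul_lt_top (ENNReal.rpow_lt_top_of_nonneg hp0.le sqrtMass_lt_top.ne)
      ENNReal.ofReal_lt_top
  obtain ⟨M, hM⟩ := schwartz_exists_bound f
  set D : Plane → ℝ → ℂ := fun x t => ∑ k ∈ S, offTranslate γ u q k (partialConv k a f) x t with hD
  have mD : Measurable (Function.uncurry D) := by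
    simp only [Function.uncurry_def, hD]
    exact Finset.measurable_fun_sum _ fun k _ => measurable_offTranslate h hu.continuous
      (continuous_partialConv (k := k) (b := a) f.continuous hM) q k
  set H : Plane → ℝ → ℝ≥0∞ := fun x t => ‖φt t‖ₑ * ‖D x t‖ₑ with hH
  have mH : Measurable (Function.uncurry H) := by
    simp only [Function.uncurry_def, hH]
    exact (h.cont_cut.measurable.comp measurable_snd).enorm.mul mD.enorm
  have eB : ∀ t, ‖φt t‖ₑ ≤ ENNReal.ofReal B := fun t => by
    rw [← ofReal_norm]
    exact ENNReal.ofReal_le_ofReal (h.bound_cut t)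
  have hK : ∀ t, t ≠ 0 → ∫⁻ x, H x t ^ p ≤ ENNReal.ofReal (√|t| ^ p) *
      (ENNReal.ofReal (B ^ p * (C * √(L / 2) ^ p)) * ∫⁻ x, ‖f x‖ₑ ^ p) := fun t ht => by
    by_cases hφ : φt t = 0
    · simp only [hH, hφ, enorm_zero, zero_mul, ENNReal.zero_rpow_of_pos hp0, lintegral_zero]
      exact zero_le
    simp only [hH, ENNReal.mul_rpow_of_nonneg _ _ hp0.le]
    rw [lintegral_const_mul' _ _ (ENNReal.rpow_ne_top_of_nonneg hp0.le enorm_ne_top)]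
    refine (mul_le_mul' (ENNReal.rpow_le_rpow (eB t) hp0.le)
      (hCb L B γ φt h u hu f S t ht hφ)).trans (le_of_eq ?_)
    rw [ENNReal.ofReal_rpow_of_pos hB, ← mul_assoc, ← mul_assoc,
      ← ENNReal.ofReal_mul (by positivity),
      ← ENNReal.ofReal_mul (by positivity)]
    congr 2
    rw [show L * |t| / 2 = |t| * (L / 2) by ring, Real.sqrt_mul (abs_nonneg _),
      Real.mul_rpow (Real.sqrt_nonneg _) (Real.sqrt_nonneg _)]
    ring
  rw [mul_assoc]
  refine le_trans (lintegral_mono fun x => ?_) (lintegral_setLIntegral_rpow_le hp mH hK)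
  rw [sum_offDiagTerm_eq h hu hc]
  refine ENNReal.rpow_le_rpow ?_ hp0.le
  refine (enorm_integral_le_lintegral_enorm _).trans (le_of_eq (lintegral_congr fun t => ?_))
  rw [enorm_mul, hH, ← mul_assoc]
  congr 1
  rw [← ofReal_norm, ← ofReal_norm, Complex.norm_real, norm_div, Real.norm_eq_abs, Real.norm_eq_abs,
    ← ENNReal.ofReal_mul (by positivity), div_eq_inv_mul]

lemma memLp_of_tendsto_of_eLpNorm_le {α E : Type*} [MeasurableSpace α] {μ : Measure α}
    [NormedAddCommGroup E] {p K : ℝ≥0∞} (hK : K < ⊤) {s : ℕ → α → E} {S : α → E}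
    (ms : ∀ n, AEStronglyMeasurable (s n) μ) (bound : ∀ n, eLpNorm (s n) p μ ≤ K)
    (lim : ∀ x, Tendsto (fun n => s n x) atTop (𝓝 (S x))) :
    MemLp S p μ ∧ eLpNorm S p μ ≤ K := by
  have lim' : ∀ᵐ x ∂μ, Tendsto (fun n => s n x) atTop (𝓝 (S x)) := ae_of_all _ lim
  have fatou : eLpNorm S p μ ≤ K :=
    (Lp.eLpNorm_lim_le_liminf_eLpNorm ms S lim').trans
      (liminf_le_of_le (by isBoundedDefault) fun b hb =>
        let ⟨n, hn⟩ := hb.exists; hn.trans (bound n))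
  exact ⟨⟨aestronglyMeasurable_of_tendsto_ae atTop ms lim', fatou.trans_lt hK⟩, fatou⟩

lemma exists_tsum_offDiagTerm_Lp {p : ℝ≥0∞} (hp : 1 < p) (hpt : p < ⊤) (h : IsCutCurve L B γ φt)
    (hc : IsCutPair φ ψ a q) :
    ∃ C : ℝ, 0 < C ∧ ∀ u : Plane → ℝ, LipschitzWith (1 / 2) u → ∀ f : 𝓢(Plane, ℂ),
      MemLp (fun x : Plane => ∑' k : ℤ, offDiagTerm γ φt φ ψ u f k x) p ∧
      eLpNorm (fun x : Plane => ∑' k : ℤ, offDiagTerm γ φt φ ψ u f k x) p ≤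
        ENNReal.ofReal C * eLpNorm f p := by
  have hp0 : p ≠ 0 := (zero_lt_one.trans hp).ne'
  have hr : 1 < p.toReal := by
    rw [← ENNReal.toReal_one]
    exact (ENNReal.toReal_lt_toReal ENNReal.one_ne_top hpt.ne).2 hp
  obtain ⟨K, hK, hKb⟩ := exists_sum_offDiagTerm_Lp hr h hc
  obtain ⟨K', hK'⟩ : ∃ K', K' = K ^ (1 / p.toReal) := ⟨_, rfl⟩
  have hK't : K' < ⊤ := hK' ▸ ENNReal.rpow_lt_top_of_nonneg (by positivity) hK.ne
  have hle : K' ≤ ENNReal.ofReal (K'.toReal + 1) := by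
    rw [ENNReal.le_ofReal_iff_toReal_le hK't.ne (by positivity)]
    linarith
  refine ⟨K'.toReal + 1, by positivity, fun u hu f => ?_⟩
  have hf : eLpNorm f p < ⊤ := (f.memLp p volume).eLpNorm_lt_top
  refine memLp_of_tendsto_of_eLpNorm_le
    (s := fun (n : ℕ) x => ∑ k ∈ Finset.Icc (-n : ℤ) n, offDiagTerm γ φt φ ψ u f k x)
    (ENNReal.mul_lt_top ENNReal.ofReal_lt_top hf)
    (fun n => (Finset.stronglyMeasurable_fun_sum _ fun k _ =>
      stronglyMeasurable_offDiagTerm h hu hc f k).aestronglyMeasurable) (fun n => ?_) fun x => ?_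
  · refine le_trans ?_ (mul_le_mul' hle le_rfl)
    rw [eLpNorm_eq_lintegral_rpow_enorm_toReal hp0 hpt.ne,
      eLpNorm_eq_lintegral_rpow_enorm_toReal hp0 hpt.ne, hK',
      ← ENNReal.mul_rpow_of_nonneg _ _ (by positivity)]
    exact ENNReal.rpow_le_rpow (hKb u hu f _) (by positivity)
  · have hI : Tendsto (fun n : ℕ => Finset.Icc (-n : ℤ) n) atTop atTop :=
      Finset.tendsto_Icc_neg_atTop_atTop.comp tendsto_natCast_atTop_atTop
    exact (summable_offDiagTerm h hu hc f x).hasSum.comp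
      (by rwa [SummationFilter.unconditional_filter])

end OffDiagonal

section Curve

variable {γ : ℝ → ℝ}

lemma IsAdmissibleCurve.exists_linear_bound (hγ : IsAdmissibleCurve γ) :
    ∃ L : ℝ, 1 ≤ L ∧ ∀ t ∈ Icc (-1 : ℝ) 1, |γ t| ≤ L * |t| := by
  obtain ⟨K, hK⟩ := hγ.smooth.exists_lipschitzOnWith (by simp) (convex_Icc _ _) isCompact_Icc
  refine ⟨K + 1, by linarith [K.coe_nonneg], fun t ht => ?_⟩
  have := hK.dist_le_mul t ht 0 (by norm_num)
  rw [hγ.zero, Real.dist_eq, Real.dist_eq, sub_zero, sub_zero] at this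
  linarith [abs_nonneg t]

lemma IsAdmissibleCurve.exists_isCutCurve (hγ : IsAdmissibleCurve γ) {L : ℝ} (hL : 1 ≤ L)
    (hb : ∀ t ∈ Icc (-1 : ℝ) 1, |γ t| ≤ L * |t|) {ε : ℝ} (h0 : 0 < ε) (hε : ε ≤ 1 / (2 * L))
    {φt : ℝ → ℝ} (h1 : ContDiff ℝ ∞ φt) (h2 : Function.support φt ⊆ Ioo (-ε) ε) (h3 : φt 0 = 1) :
    ∃ (B : ℝ) (γ' : ℝ → ℝ), IsCutCurve L B γ' φt ∧ ∀ t, φt t ≠ 0 → γ t = γ' t := by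
  have hL0 : 0 < L := by linarith
  have hLε : L * ε ≤ 1 / 2 := by
    rw [le_div_iff₀ (by positivity)] at hε
    linarith
  have hε1 : ε ≤ 1 / 2 := by nlinarith
  have hcs : HasCompactSupport φt :=
    HasCompactSupport.of_support_subset_isCompact isCompact_Icc (h2.trans Ioo_subset_Icc_self)
  obtain ⟨M, hM⟩ := hcs.exists_bound_of_continuous h1.continuous
  obtain ⟨K, hK⟩ := h1.lipschitzWith_of_hasCompactSupport hcs (by simp)
  have hM0 : 0 ≤ M := (norm_nonneg _).trans (hM 0)
  set c : ℝ → ℝ := fun t => max (-ε) (min t ε) with hc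
  have hc1 : ∀ t, c t ∈ Icc (-1 : ℝ) 1 := fun t =>
    ⟨le_max_of_le_left (by linarith), max_le (by linarith) ((min_le_right _ _).trans (by linarith))⟩
  have hc2 : ∀ t, |c t| ≤ ε := fun t =>
    abs_le.2 ⟨le_max_left _ _, max_le (by linarith) (min_le_right _ _)⟩
  have hc3 : ∀ t, |c t| ≤ |t| := fun t => by
    refine abs_le.2 ⟨?_, max_le ?_ ((min_le_left _ _).trans (le_abs_self _))⟩
    · refine le_max_of_le_right (le_min (neg_abs_le _) ?_)
      linarith [abs_nonneg t]
    · linarith [abs_nonneg t]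
  have hin : ∀ t, φt t ≠ 0 → t ∈ Ioo (-ε) ε := fun t ht => h2 ht
  refine ⟨M + K + 1, fun t => γ (c t), ⟨hL0, by positivity, ?_, fun t => ?_, fun t => ?_,
    h1.continuous, fun t => ?_, fun t => ?_, fun t ht => ?_⟩, fun t ht => ?_⟩
  · exact hγ.smooth.continuousOn.comp_continuous (by fun_prop) hc1
  · exact (hb _ (hc1 t)).trans (mul_le_mul_of_nonneg_left (hc3 t) hL0.le)
  · refine (hb _ (hc1 t)).trans (le_trans ?_ hLε)
    gcongr
    exact hc2 t
  · exact (hM t).trans (by linarith [K.coe_nonneg])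
  · have := hK.dist_le_mul t 0
    rw [h3, Real.dist_eq, Real.dist_eq, sub_zero] at this
    refine this.trans ?_
    gcongr
    linarith
  · have h4 : |t| ≤ ε := (abs_lt.2 (hin t ht)).le
    exact ⟨by linarith, le_trans (by gcongr) hLε⟩
  · obtain ⟨h5, h6⟩ := hin t ht
    have : c t = t := by
      rw [hc]
      simp only
      rw [min_eq_left h6.le, max_eq_right h5.le]
    show γ t = γ (c t)
    rw [this]

lemma truncHilbert_congr {γ γ' φt : ℝ → ℝ} (h : ∀ t, φt t ≠ 0 → γ t = γ' t) :
    truncHilbert γ φt = truncHilbert γ' φt := by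
  ext u g x η
  rw [truncHilbert, truncHilbert]
  congr 1
  ext t
  by_cases ht : φt t = 0
  · simp [ht]
  · rw [h t ht]

end Curve


theorem off_diagonal_Lp (γ : ℝ → ℝ) (hγ : IsAdmissibleCurve γ) :
    -- the smallness threshold for `ε₀` depends only on `γ`
    ∃ ε₁ : ℝ, 0 < ε₁ ∧ ∀ ε₀ : ℝ, 0 < ε₀ → ε₀ ≤ ε₁ →
    ∀ φt : ℝ → ℝ, ContDiff ℝ ∞ φt → (∀ t, 0 ≤ φt t) →
      Function.support φt ⊆ Ioo (-ε₀) ε₀ →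
      (∀ t ∈ Icc (-(ε₀ / 2)) (ε₀ / 2), φt t = 1) →
    ∀ φ : ℝ → ℂ, ContDiff ℝ ∞ φ →
      Function.support φ ⊆ {t : ℝ | 1 / 2 ≤ |t| ∧ |t| ≤ 2} →
      (∀ t : ℝ, t ≠ 0 → HasSum (fun k : ℤ => φ ((2 : ℝ) ^ (-k) * t)) 1) →
    ∀ ψ : ℝ → ℂ, ContDiff ℝ ∞ ψ → HasCompactSupport ψ → tsupport ψ ⊆ {0}ᶜ →
      (∀ ξ : ℝ, 1 / 4 ≤ |ξ| → |ξ| ≤ 4 → ψ ξ = 1) →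
    ∀ p : ℝ≥0∞, 1 < p → p < ⊤ →
    -- the constant is uniform in `u` and `f`
    ∃ C : ℝ, 0 < C ∧
    ∀ u : Plane → ℝ, (∀ x, 0 < u x) → LipschitzWith (1 / 2) u →
    ∀ f : 𝓢(Plane, ℂ),
      -- the principal values defining `H^γ P²ₖ f` exist
      (∀ (k : ℤ) (x : Plane), ∃ L : ℂ,
        Tendsto (truncHilbert γ φt u (proj₂ φ k f) x) (𝓝[>] 0) (𝓝 L)) ∧
      -- the Fourier integrals defining `P̃²ₖ H^γ P²ₖ f` converge absolutely
      (∀ k : ℤ, Integrable (hilbertAlong γ φt u (proj₂ φ k f)) ∧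
        Integrable (freqCut ψ k (hilbertAlong γ φt u (proj₂ φ k f)))) ∧
      -- the series converges (absolutely) almost everywhere, to a function in `L^p`
      (∀ᵐ x : Plane, Summable fun k : ℤ => offDiagTerm γ φt φ ψ u f k x) ∧
      MemLp (fun x : Plane => ∑' k : ℤ, offDiagTerm γ φt φ ψ u f k x) p ∧
      eLpNorm (fun x : Plane => ∑' k : ℤ, offDiagTerm γ φt φ ψ u f k x) p ≤
        ENNReal.ofReal C * eLpNorm f p := by
  obtain ⟨L, hL, hb⟩ := hγ.exists_linear_bound
  refine ⟨1 / (2 * L), by positivity, ?_⟩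
  intro ε₀ h0 hε φt hφt _ hsupp hone φ hφ hφs _ ψ hψ hψc hψ0 hψ1 p hp hpt
  obtain ⟨B, γ', hcut, hγγ'⟩ := hγ.exists_isCutCurve hL hb h0 hε hφt hsupp
    (hone 0 ⟨by linarith, by linarith⟩)
  have hφc : HasCompactSupport φ :=
    HasCompactSupport.of_support_subset_isCompact (isCompact_Icc (a := (-2 : ℝ)) (b := 2))
      fun t ht => abs_le.1 (hφs ht).2
  obtain ⟨a, ha⟩ := exists_schwartz_fourier_eq hφ hφc
  obtain ⟨q, hq⟩ := exists_schwartz_fourier_eq hψ hψc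
  have hc : IsCutPair φ ψ a q :=
    ⟨hφ, hφc, hφs, hψ, hψc, ha, hq, fun s => by
      by_cases hs : φ s = 0
      · rw [hs, mul_zero]
      · have := hφs hs
        rw [hψ1 s (by linarith [this.1]) (by linarith [this.2]), one_mul],
      image_eq_zero_of_notMem_tsupport fun hmem => hψ0 hmem rfl⟩
  obtain ⟨C, hC, hCb⟩ := exists_tsum_offDiagTerm_Lp hp hpt hcut hc
  have e1 : truncHilbert γ φt = truncHilbert γ' φt := truncHilbert_congr hγγ'
  have e2 : hilbertAlong γ φt = hilbertAlong γ' φt := by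
    ext u g x
    rw [hilbertAlong, hilbertAlong, e1]
  have e3 : offDiagTerm γ φt φ ψ = offDiagTerm γ' φt φ ψ := by
    ext u f k x
    rw [offDiagTerm, offDiagTerm, e2]
  refine ⟨C, hC, fun u _ hu f => ?_⟩
  rw [e1, e2, e3]
  refine ⟨fun k x => ?_, fun k => integrable_freqCut_hilbertAlong hcut hu hc f k,
    ae_of_all _ fun x => summable_offDiagTerm hcut hu hc f x, hCb u hu f⟩
  obtain ⟨g, hg, -⟩ := hc.exists_projection f k
  rw [← hg]
  exact ⟨_, tendsto_truncHilbert hcut hu x⟩
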